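/- Let a ≥ 3 and b > a be coprime integers, write S = ab − a − b, and let δ be a real number with 0 < δ < e^{−3/2}, δS ≥ 17, and a < δS. Then π*(a,b) > Δ(δ,a,S) · π(S), where Δ(δ,a,S) = (1 − (2/φ(a)) · N(δ,a) · (1 − log a/log(δS))^{−1} − log(δS)/(δS)) · δ, N(δ,a) denotes the number of integers v with 1 ≤ v ≤ δa and gcd(v,a) = 1, π*(a,b) is the number of primes not representable as au + bv with u, v nonnegative integers, and π(x) is the number of primes not exceeding x. -/

import Mathlib

/-- `piStar a b` is the number of primes not representable as `a*u + b*v`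
with `u, v` nonnegative integers, i.e. the number of primes not in the
numerical semigroup `⟨a, b⟩`. -/
noncomputable def piStar (a b : ℕ) : ℕ :=
  Set.ncard {p : ℕ | p.Prime ∧ ¬ ∃ u v : ℕ, p = a * u + b * v}

/-- `S a b = a*b - a - b` (the Frobenius-type quantity). -/
def S (a b : ℕ) : ℕ := a * b - a - b

/-- `N δ a` is the number of integers `v` with `1 ≤ v ≤ δ·a` and `gcd(v,a) = 1`. -/
noncomputable def N (δ : ℝ) (a : ℕ) : ℕ :=
  Set.ncard {v : ℕ | 1 ≤ v ∧ (v : ℝ) ≤ δ * (a : ℝ) ∧ Nat.gcd v a = 1}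

section
open Finset
namespace PS
open ArithmeticFunction
open Chebyshev ArithmeticFunction in
theorem log_fact_eq (n : ℕ) : Real.log (n.factorial : ℝ) = ∑ m ∈ Ioc 0 n, vonMangoldt m * ((n / m : ℕ) : ℝ) := by
  rw [← ArithmeticFunction.sum_Ioc_mul_zeta_eq_sum, ArithmeticFunction.vonMangoldt_mul_zeta]
  induction n with
  | zero => simp
  | succ k ih =>
    rw [Finset.sum_Ioc_succ_top (by omega), ← ih, Nat.factorial_succ]
    push_cast
    rw [Real.log_mul (by positivity) (by positivity)]
    simp [ArithmeticFunction.log_apply]; ring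

open Chebyshev ArithmeticFunction in
theorem psi_div (n d : ℕ) (hd : 0 < d) :
    ψ ((n / d : ℕ) : ℝ) = ∑ m ∈ Ioc 0 n, vonMangoldt m * (if d ≤ n / m then 1 else 0) := by
  unfold Chebyshev.psi
  rw [Nat.floor_natCast]
  simp only [mul_ite, mul_one, mul_zero]
  rw [← Finset.sum_filter]
  apply Finset.sum_congr _ (fun _ _ => rfl)
  ext m
  simp only [mem_Ioc, mem_filter]
  constructor
  · rintro ⟨h0, h1⟩
    have h2 : m * d ≤ n := by rwa [Nat.le_div_iff_mul_le hd] at h1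
    refine ⟨⟨h0, by nlinarith⟩, ?_⟩
    rw [Nat.le_div_iff_mul_le h0]; linarith
  · rintro ⟨⟨h0, h1⟩, h2⟩
    rw [Nat.le_div_iff_mul_le h0] at h2
    refine ⟨h0, ?_⟩
    rw [Nat.le_div_iff_mul_le hd]; linarith

theorem log_fact_div (n d : ℕ) :
    Real.log ((n / d).factorial : ℝ) = ∑ m ∈ Ioc 0 n, vonMangoldt m * ((n / m / d : ℕ) : ℝ) := by
  rw [log_fact_eq]
  have h : Ioc 0 (n / d) ⊆ Ioc 0 n := Ioc_subset_Ioc_right (Nat.div_le_self _ _)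
  rw [← Finset.sum_subset h]
  · apply Finset.sum_congr rfl
    intro m _
    rw [Nat.div_div_eq_div_mul, Nat.div_div_eq_div_mul, mul_comm d m]
  · intro m hm hm'
    simp only [mem_Ioc, not_and, not_le] at hm hm'
    have h3 := hm' hm.1
    rw [Nat.div_div_eq_div_mul, mul_comm m d, ← Nat.div_div_eq_div_mul, Nat.div_eq_of_lt h3]
    simp

noncomputable def Tc (n : ℕ) : ℝ := Real.log (n.factorial : ℝ) - Real.log ((n / 2).factorial : ℝ)
  - Real.log ((n / 3).factorial : ℝ) - Real.log ((n / 5).factorial : ℝ) + Real.log ((n / 30).factorial : ℝ)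

theorem Tc_eq (n : ℕ) : Tc n = ∑ m ∈ Ioc 0 n, vonMangoldt m *
    (((n / m : ℕ) : ℝ) - ((n / m / 2 : ℕ) : ℝ) - ((n / m / 3 : ℕ) : ℝ) - ((n / m / 5 : ℕ) : ℝ) + ((n / m / 30 : ℕ) : ℝ)) := by
  unfold Tc
  rw [log_fact_div n 2, log_fact_div n 3, log_fact_div n 5, log_fact_div n 30, log_fact_eq]
  simp only [mul_sub, mul_add, sum_sub_distrib, sum_add_distrib]

theorem F_upper (j : ℕ) : j + j / 30 ≤ j / 2 + j / 3 + j / 5 + (if 1 ≤ j then 1 else 0) := by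
  split_ifs <;> omega

theorem F_lower (j : ℕ) : j / 2 + j / 3 + j / 5 + (if 1 ≤ j then 1 else 0) + (if 7 ≤ j then 1 else 0) ≤
    j + j / 30 + (if 6 ≤ j then 1 else 0) + (if 10 ≤ j then 1 else 0) := by
  split_ifs <;> omega

open Chebyshev in
theorem Tc_le (n : ℕ) : Tc n ≤ ψ n := by
  have h1 := psi_div n 1 one_pos
  rw [Nat.div_one] at h1
  rw [h1, Tc_eq]
  apply Finset.sum_le_sum
  intro m _
  apply mul_le_mul_of_nonneg_left _ vonMangoldt_nonneg
  have h := F_upper (n / m)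
  have h' : ((n / m + n / m / 30 : ℕ) : ℝ) ≤ ((n / m / 2 + n / m / 3 + n / m / 5 + (if 1 ≤ n / m then 1 else 0) : ℕ) : ℝ) := by
    exact_mod_cast h
  push_cast at h' ⊢
  linarith

open Chebyshev in
theorem le_Tc (n : ℕ) : ψ n + ψ ((n / 7 : ℕ) : ℝ) ≤ Tc n + ψ ((n / 6 : ℕ) : ℝ) + ψ ((n / 10 : ℕ) : ℝ) := by
  have h1 := psi_div n 1 one_pos
  rw [Nat.div_one] at h1
  rw [h1, Tc_eq, psi_div n 7 (by norm_num), psi_div n 6 (by norm_num), psi_div n 10 (by norm_num),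
    ← sum_add_distrib, ← sum_add_distrib, ← sum_add_distrib]
  apply Finset.sum_le_sum
  intro m _
  rw [← mul_add, ← mul_add, ← mul_add]
  apply mul_le_mul_of_nonneg_left _ vonMangoldt_nonneg
  have h := F_lower (n / m)
  have h' : ((n / m / 2 + n / m / 3 + n / m / 5 + (if 1 ≤ n / m then 1 else 0) + (if 7 ≤ n / m then 1 else 0) : ℕ) : ℝ)
    ≤ ((n / m + n / m / 30 + (if 6 ≤ n / m then 1 else 0) + (if 10 ≤ n / m then 1 else 0) : ℕ) : ℝ) := by
    exact_mod_cast h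
  push_cast at h' ⊢
  linarith

theorem logfact_lower (n : ℕ) (hn : 1 ≤ n) : n * Real.log n - n + 1 ≤ Real.log (n.factorial : ℝ) := by
  induction n, hn using Nat.le_induction with
  | base => simp
  | succ k hk ih =>
    rw [Nat.factorial_succ]
    push_cast
    have hk' : (0:ℝ) < k := by exact_mod_cast hk
    rw [Real.log_mul (by positivity) (by positivity)]
    have h : Real.log ((k:ℝ) + 1) - Real.log k ≤ 1 / k := by
      rw [← Real.log_div (by positivity) (by positivity)]
      have := Real.log_le_sub_one_of_pos (show (0:ℝ) < (k+1)/k by positivity)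
      have e : ((k:ℝ)+1)/k - 1 = 1 / k := by field_simp; ring
      linarith
    have h2 : k * (Real.log ((k:ℝ) + 1) - Real.log k) ≤ 1 := by
      calc _ ≤ k * (1 / (k:ℝ)) := by gcongr
        _ = 1 := by field_simp
    nlinarith

theorem logfact_upper (n : ℕ) (hn : 1 ≤ n) : Real.log (n.factorial : ℝ) ≤ n * Real.log n - n + 1 + Real.log n := by
  induction n, hn using Nat.le_induction with
  | base => simp
  | succ k hk ih =>
    rw [Nat.factorial_succ]
    push_cast
    have hk' : (0:ℝ) < k := by exact_mod_cast hk
    rw [Real.log_mul (by positivity) (by positivity)]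
    have h : 1 / ((k:ℝ) + 1) ≤ Real.log ((k:ℝ) + 1) - Real.log k := by
      rw [← Real.log_div (by positivity) (by positivity)]
      have := Real.one_sub_inv_le_log_of_pos (show (0:ℝ) < (k+1)/k by positivity)
      have e : 1 - (((k:ℝ)+1)/k)⁻¹ = 1 / (k + 1) := by field_simp; ring
      linarith
    have h2 : 1 ≤ (k + 1) * (Real.log ((k:ℝ) + 1) - Real.log k) := by
      calc 1 = (k + 1) * (1 / ((k:ℝ) + 1)) := by field_simp
        _ ≤ _ := by gcongr
    nlinarith

theorem T_lower (x : ℝ) (hx : 1 ≤ x) : x * Real.log x - x + 1 - Real.log x ≤ Real.log (⌊x⌋₊.factorial : ℝ) := by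
  have hn : 1 ≤ ⌊x⌋₊ := Nat.le_floor (by simpa using hx)
  have h1 := logfact_lower _ hn
  have h2 : (⌊x⌋₊ : ℝ) ≤ x := Nat.floor_le (by linarith)
  have h3 : x < ⌊x⌋₊ + 1 := Nat.lt_floor_add_one x
  set n : ℝ := (⌊x⌋₊ : ℝ) with hnn
  have hn' : (1:ℝ) ≤ n := by rw [hnn]; exact_mod_cast hn
  have h4 : Real.log x - Real.log n ≤ x / n - 1 := by
    rw [← Real.log_div (by positivity) (by positivity)]
    exact Real.log_le_sub_one_of_pos (by positivity)
  have h5 : n * (Real.log x - Real.log n) ≤ x - n := by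
    calc _ ≤ n * (x / n - 1) := by gcongr
      _ = x - n := by field_simp
  have h6 : (x - n) * Real.log x ≤ 1 * Real.log x := by
    apply mul_le_mul_of_nonneg_right (by linarith) (Real.log_nonneg hx)
  nlinarith

theorem T_upper (x : ℝ) (hx : 1 ≤ x) : Real.log (⌊x⌋₊.factorial : ℝ) ≤ x * Real.log x - x + 1 + Real.log x := by
  have hn : 1 ≤ ⌊x⌋₊ := Nat.le_floor (by simpa using hx)
  have h1 := logfact_upper _ hn
  have h2 : (⌊x⌋₊ : ℝ) ≤ x := Nat.floor_le (by linarith)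
  set n : ℝ := (⌊x⌋₊ : ℝ) with hnn
  have hn' : (1:ℝ) ≤ n := by rw [hnn]; exact_mod_cast hn
  have h4 : n / x ≥ 0 := by positivity
  have h7 : Real.log n ≤ Real.log x := Real.log_le_log (by positivity) h2
  have h8 : 1 - n / x ≤ Real.log x - Real.log n := by
    rw [← Real.log_div (by positivity) (by positivity)]
    have := Real.one_sub_inv_le_log_of_pos (show (0:ℝ) < x/n by positivity)
    rw [inv_div] at this; exact this
  have h9 : x - n ≤ x * (Real.log x - Real.log n) := by
    calc x - n = x * (1 - n / x) := by field_simp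
      _ ≤ _ := by gcongr
  have h10 : 0 ≤ Real.log n := Real.log_nonneg hn'
  nlinarith

noncomputable def cA : ℝ := Real.log 2 / 2 + Real.log 3 / 3 + Real.log 5 / 5 - Real.log 30 / 30

theorem log30 : Real.log 30 = Real.log 2 + Real.log 3 + Real.log 5 := by
  rw [← Real.log_mul (by norm_num) (by norm_num), ← Real.log_mul (by norm_num) (by norm_num)]; norm_num

theorem floor_div' (x : ℝ) (d : ℕ) : ⌊x⌋₊ / d = ⌊x / d⌋₊ := (Nat.floor_div_natCast x d).symm

theorem Tc_lower (x : ℝ) (hx : 30 ≤ x) : cA * x - 5 * Real.log x + 5 ≤ Tc ⌊x⌋₊ := by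
  unfold Tc
  rw [floor_div' x 2, floor_div' x 3, floor_div' x 5, floor_div' x 30]
  have h1 := T_lower x (by linarith)
  have h2 := T_upper (x / (2:ℕ)) (by push_cast; linarith)
  have h3 := T_upper (x / (3:ℕ)) (by push_cast; linarith)
  have h5 := T_upper (x / (5:ℕ)) (by push_cast; linarith)
  have h30 := T_lower (x / (30:ℕ)) (by push_cast; linarith)
  push_cast at h2 h3 h5 h30 ⊢
  rw [Real.log_div (by positivity) (by norm_num)] at h2 h3 h5 h30
  have : (3:ℝ) ≤ Real.log 30 := by
    rw [Real.le_log_iff_exp_le (by norm_num)]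
    have := Real.exp_one_lt_d9
    calc Real.exp 3 = Real.exp 1 ^ 3 := by rw [← Real.exp_nat_mul]; norm_num
      _ ≤ 3 ^ 3 := by gcongr; linarith
      _ ≤ 30 := by norm_num
  unfold cA
  have := log30
  nlinarith

theorem Tc_upper (x : ℝ) (hx : 30 ≤ x) : Tc ⌊x⌋₊ ≤ cA * x + 5 * Real.log x - 7 := by
  unfold Tc
  rw [floor_div' x 2, floor_div' x 3, floor_div' x 5, floor_div' x 30]
  have h1 := T_upper x (by linarith)
  have h2 := T_lower (x / (2:ℕ)) (by push_cast; linarith)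
  have h3 := T_lower (x / (3:ℕ)) (by push_cast; linarith)
  have h5 := T_lower (x / (5:ℕ)) (by push_cast; linarith)
  have h30 := T_upper (x / (30:ℕ)) (by push_cast; linarith)
  push_cast at h2 h3 h5 h30 ⊢
  rw [Real.log_div (by positivity) (by norm_num)] at h2 h3 h5 h30
  have : (3:ℝ) ≤ Real.log 30 := by
    rw [Real.le_log_iff_exp_le (by norm_num)]
    have := Real.exp_one_lt_d9
    calc Real.exp 3 = Real.exp 1 ^ 3 := by rw [← Real.exp_nat_mul]; norm_num
      _ ≤ 3 ^ 3 := by gcongr; linarith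
      _ ≤ 30 := by norm_num
  unfold cA
  have := log30
  nlinarith
end PS
end

section
namespace PS
open Chebyshev

theorem log5_b : (1.609436:ℝ) < Real.log 5 ∧ Real.log 5 < 1.609441 := by
  have h2 := Real.log_two_gt_d9
  have h2' := Real.log_two_lt_d9
  have e : (28:ℝ) * Real.log 5 = 65 * Real.log 2 + Real.log (5^28/2^65) := by
    rw [Real.log_div (by norm_num) (by norm_num), Real.log_pow, Real.log_pow]; push_cast; ring
  have u := Real.log_le_sub_one_of_pos (show (0:ℝ) < 5^28/2^65 by positivity)
  have l := Real.one_sub_inv_le_log_of_pos (show (0:ℝ) < 5^28/2^65 by positivity)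
  norm_num at u l e
  constructor <;> linarith

theorem cA_b : (0.92128:ℝ) < cA ∧ cA < 0.9213 := by
  have := log5_b
  have h2 := Real.log_two_gt_d9
  have h2' := Real.log_two_lt_d9
  have h3 := Real.log_three_gt_d9
  have h3' := Real.log_three_lt_d9
  unfold cA
  rw [log30]
  constructor <;> linarith [this.1, this.2]

theorem psi_lower (x : ℝ) (hx : 30 ≤ x) : cA * x - 5 * Real.log x + 5 ≤ ψ x := by
  rw [psi_eq_psi_coe_floor]
  exact (Tc_lower x hx).trans (Tc_le _)

theorem psi_fl (x : ℝ) (d : ℕ) : ψ ((⌊x⌋₊ / d : ℕ) : ℝ) = ψ (x / d) := by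
  rw [psi_eq_psi_coe_floor (x / d), Nat.floor_div_natCast]

theorem psi_step (x : ℝ) (hx : 30 ≤ x) :
    ψ x + ψ (x / 7) ≤ cA * x + 5 * Real.log x - 7 + ψ (x / 6) + ψ (x / 10) := by
  have h := le_Tc ⌊x⌋₊
  rw [psi_fl, psi_fl, psi_fl, ← psi_eq_psi_coe_floor] at h
  have := Tc_upper x hx
  push_cast at h
  linarith

theorem psi30 : ψ 30 ≤ 30 := by
  have h : ψ ((30:ℕ):ℝ) ≤ 30 := by
    rw [psi_eq_log_lcmUpto]
    have : Nat.lcmUpto 30 = 2329089562800 := by decide +kernel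
    rw [this]
    have h2' := Real.log_two_lt_d9
    calc Real.log ((2329089562800:ℕ):ℝ) ≤ Real.log (2^42) := Real.log_le_log (by norm_num) (by norm_num)
      _ = 42 * Real.log 2 := by rw [Real.log_pow]; norm_num
      _ ≤ 30 := by linarith
  simpa using h

theorem psi_first (n : ℕ) : ∀ x : ℝ, 1 ≤ x → x ≤ 6 ^ n → ψ x ≤ 1.2 * cA * x + 2 * Real.log x ^ 2 + 30 := by
  have hc := cA_b
  have base : ∀ x : ℝ, 1 ≤ x → x ≤ 30 → ψ x ≤ 1.2 * cA * x + 2 * Real.log x ^ 2 + 30 := by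
    intro x h1 h2
    have := (psi_mono h2).trans psi30
    have := hc.1
    have : 0 ≤ 1.2 * cA * x := by nlinarith
    nlinarith [sq_nonneg (Real.log x)]
  induction n with
  | zero => intro x h1 h2; exact base x h1 (by norm_num at h2; linarith)
  | succ n ih =>
    intro x h1 h2
    rcases le_total x 30 with h | h
    · exact base x h1 h
    have h6 := ih (x / 6) (by linarith) (by rw [pow_succ] at h2; linarith)
    have hs := psi_step x h
    have hm : ψ (x / 10) ≤ ψ (x / 7) := psi_mono (by linarith)
    rw [Real.log_div (by linarith) (by norm_num)] at h6
    have l6 : 1.79 < Real.log 6 ∧ Real.log 6 < 1.792 := by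
      have : Real.log 6 = Real.log 2 + Real.log 3 := by rw [← Real.log_mul (by norm_num) (by norm_num)]; norm_num
      have h2 := Real.log_two_gt_d9
      have h2' := Real.log_two_lt_d9
      have h3 := Real.log_three_gt_d9
      have h3' := Real.log_three_lt_d9
      rw [this]; constructor <;> linarith
    have lx : 0 ≤ Real.log x := Real.log_nonneg h1
    nlinarith [l6.1, l6.2, mul_nonneg lx (sub_nonneg.2 l6.1.le)]

theorem psi_first' (x : ℝ) (hx : 1 ≤ x) : ψ x ≤ 1.2 * cA * x + 2 * Real.log x ^ 2 + 30 := by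
  obtain ⟨n, hn⟩ := pow_unbounded_of_one_lt x (show (1:ℝ) < 6 by norm_num)
  exact psi_first n x hx hn.le

theorem psi_second (x : ℝ) (hx : 300 ≤ x) :
    ψ x ≤ ψ (x / 6) + 0.90025 * x + 10 * Real.log x + 9 + 2 * Real.log (x/10) ^ 2 := by
  have hc := cA_b
  have h1 := psi_step x (by linarith)
  have h2 := psi_lower (x / 7) (by linarith)
  have h3 := psi_first' (x / 10) (by linarith)
  rw [Real.log_div (by linarith) (by norm_num)] at h2
  have l7 : 1.8 ≤ Real.log 7 := by
    have h2 := Real.log_two_gt_d9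
    have : Real.log (2^14) ≤ Real.log (7^5) := Real.log_le_log (by norm_num) (by norm_num)
    rw [Real.log_pow, Real.log_pow] at this
    push_cast at this; linarith
  nlinarith [hc.1, hc.2]

theorem sq_log_le (A s : ℝ) (hA : 2 ≤ A) (hs : 1 ≤ s) : (A + Real.log s) ^ 2 ≤ A ^ 2 * s := by
  have h := Real.log_le_sub_one_of_pos (show 0 < √s by positivity)
  rw [Real.log_sqrt (by linarith)] at h
  have h0 := Real.log_nonneg hs
  have h1 : 1 ≤ √s := by rw [Real.one_le_sqrt]; exact hs
  have h2 : A + Real.log s ≤ A * √s := by nlinarith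
  have h3 : √s ^ 2 = s := Real.sq_sqrt (by linarith)
  calc (A + Real.log s) ^ 2 ≤ (A * √s) ^ 2 := by gcongr
    _ = _ := by rw [mul_pow, h3]

theorem log_1e5 : (11.5128:ℝ) < Real.log 100000 ∧ Real.log 100000 < 11.51295 := by
  have : Real.log 100000 = 5 * Real.log 2 + 5 * Real.log 5 := by
    rw [show (100000:ℝ) = 2^5*5^5 by norm_num, Real.log_mul (by norm_num) (by norm_num), Real.log_pow, Real.log_pow]
    push_cast; ring
  have h2 := Real.log_two_gt_d9
  have h2' := Real.log_two_lt_d9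
  have := log5_b
  constructor <;> linarith [this.1, this.2]

theorem psi_le_main (x : ℝ) (hx : 100000 ≤ x) : ψ x ≤ 1.0877 * x := by
  obtain ⟨s, rfl⟩ : ∃ s, x = 100000 * s := ⟨x / 100000, by ring⟩
  have hs : 1 ≤ s := by linarith
  have h1 := psi_second (100000 * s) (by linarith)
  have h2 := psi_second (100000 * s / 6) (by linarith)
  have h3 := psi_first' (100000 * s / 6 / 6) (by linarith)
  have h2n := Real.log_two_gt_d9
  have h2n' := Real.log_two_lt_d9
  have h3n := Real.log_three_gt_d9
  have h3n' := Real.log_three_lt_d9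
  have h5 := log5_b
  have hc := cA_b
  have hL := log_1e5
  have ls : Real.log s ≤ s - 1 := Real.log_le_sub_one_of_pos (by linarith)
  have l6 : Real.log 6 = Real.log 2 + Real.log 3 := by rw [← Real.log_mul (by norm_num) (by norm_num)]; norm_num
  have l10 : Real.log 10 = Real.log 2 + Real.log 5 := by rw [← Real.log_mul (by norm_num) (by norm_num)]; norm_num
  have hs0 : s ≠ 0 := by linarith
  have e0 : Real.log (100000 * s) = Real.log 100000 + Real.log s := Real.log_mul (by norm_num) hs0
  have e1 : Real.log (100000 * s / 6) = Real.log 100000 + Real.log s - Real.log 6 := by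
    rw [Real.log_div (by positivity) (by norm_num), e0]
  have e2 : Real.log (100000 * s / 6 / 6) = Real.log 100000 + Real.log s - Real.log 6 - Real.log 6 := by
    rw [Real.log_div (by positivity) (by norm_num), e1]
  have e3 : Real.log (100000 * s / 10) = Real.log 100000 + Real.log s - Real.log 10 := by
    rw [Real.log_div (by positivity) (by norm_num), e0]
  have e4 : Real.log (100000 * s / 6 / 10) = Real.log 100000 + Real.log s - Real.log 6 - Real.log 10 := by
    rw [Real.log_div (by positivity) (by norm_num), e1]
  rw [e0, e3] at h1
  rw [e1, e4] at h2
  rw [e2] at h3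
  have q (B C : ℝ) (hB : 2 ≤ B) (hBC : B ≤ C) : (B + Real.log s) ^ 2 ≤ C ^ 2 * s :=
    (sq_log_le B s hB hs).trans (by gcongr)
  have q1 := q (Real.log 100000 - Real.log 10) 9.22 (by linarith) (by linarith)
  have q2 := q (Real.log 100000 - Real.log 6 - Real.log 10) 7.43 (by linarith) (by linarith)
  have q3 := q (Real.log 100000 - Real.log 6 - Real.log 6) 7.94 (by linarith) (by linarith)
  rw [show Real.log 100000 - Real.log 10 + Real.log s = Real.log 100000 + Real.log s - Real.log 10 by ring] at q1
  rw [show Real.log 100000 - Real.log 6 - Real.log 10 + Real.log s = Real.log 100000 + Real.log s - Real.log 6 - Real.log 10 by ring] at q2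
  rw [show Real.log 100000 - Real.log 6 - Real.log 6 + Real.log s = Real.log 100000 + Real.log s - Real.log 6 - Real.log 6 by ring] at q3
  have hcs : cA * s ≤ 0.9213 * s := by nlinarith [hc.2]
  linarith [hL.1, hL.2, h5.1, h5.2]

theorem rpow_scale (s p C : ℝ) (hs : 1 ≤ s) (hp : p ≤ 1) (hC : (100000:ℝ) ^ p ≤ C) :
    (100000 * s) ^ p ≤ C * s := by
  rw [Real.mul_rpow (by norm_num) (by linarith)]
  have h1 : s ^ p ≤ s := by
    calc s ^ p ≤ s ^ (1:ℝ) := Real.rpow_le_rpow_of_exponent_le hs hp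
      _ = s := Real.rpow_one s
  have : (0:ℝ) ≤ 100000 ^ p := by positivity
  have : (0:ℝ) ≤ s ^ p := by positivity
  nlinarith

theorem psi_pow_le (s : ℝ) (hs : 1 ≤ s) (k : ℕ) (hk : 1 ≤ k) (hk5 : k ≤ 5) (C : ℝ) (hC0 : 0 < C) (hC : 100000 ≤ C ^ k) :
    ψ ((100000 * s) ^ ((k:ℝ)⁻¹)) ≤ 1.1056 * (C * s) + 2 * (11.51295 / k) ^ 2 * s + 30 := by
  have hk0 : (0:ℝ) < k := by exact_mod_cast hk
  have hki : ((k:ℝ)⁻¹) ≤ 1 := by apply inv_le_one_of_one_le₀; exact_mod_cast hk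
  have h1 : (100000:ℝ) ^ ((k:ℝ)⁻¹) ≤ C := by
    have : C = (C ^ k) ^ ((k:ℝ)⁻¹) := by
      rw [Real.pow_rpow_inv_natCast hC0.le (by omega)]
    rw [this]
    exact Real.rpow_le_rpow (by norm_num) hC (by positivity)
  have h2 := rpow_scale s _ C hs hki h1
  have h3 := psi_first' ((100000 * s) ^ ((k:ℝ)⁻¹)) (Real.one_le_rpow (by linarith) (by positivity))
  rw [Real.log_rpow (by linarith), Real.log_mul (by norm_num) (by linarith)] at h3
  have hL := log_1e5
  have q := sq_log_le (Real.log 100000) s (by linarith [hL.1]) hs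
  have q2 : Real.log 100000 ^ 2 * s ≤ 11.51295 ^ 2 * s := by
    have := hL.1
    gcongr; exact hL.2.le
  have hc := cA_b
  have h4 : 1.2 * cA * (100000 * s) ^ ((k:ℝ)⁻¹) ≤ 1.1056 * (C * s) := by
    apply mul_le_mul (by linarith [hc.2]) h2 (by positivity) (by norm_num)
  have h5 : 2 * ((k:ℝ)⁻¹ * (Real.log 100000 + Real.log s)) ^ 2 ≤ 2 * (11.51295 / k) ^ 2 * s := by
    have e : (11.51295 / (k:ℝ)) = (k:ℝ)⁻¹ * 11.51295 := by ring
    rw [e, mul_pow, mul_pow]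
    have : 0 ≤ 2 * ((k:ℝ)⁻¹)^2 := by positivity
    nlinarith
  linarith

theorem theta_ge_main (x : ℝ) (hx : 100000 ≤ x) : 0.9145 * x ≤ θ x := by
  obtain ⟨s, rfl⟩ : ∃ s, x = 100000 * s := ⟨x / 100000, by ring⟩
  have hs : 1 ≤ s := by linarith
  have h1 := psi_sub_theta_le_psi_add_psi_add_psi (100000 * s)
  have p2 := psi_pow_le s hs 2 (by norm_num) (by norm_num) 316.3 (by norm_num) (by norm_num)
  have p3 := psi_pow_le s hs 3 (by norm_num) (by norm_num) 46.5 (by norm_num) (by norm_num)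
  have p5 := psi_pow_le s hs 5 (by norm_num) (by norm_num) 10 (by norm_num) (by norm_num)
  have h2 := psi_lower (100000 * s) (by linarith)
  rw [Real.log_mul (by norm_num) (by linarith)] at h2
  have hL := log_1e5
  have ls : Real.log s ≤ s - 1 := Real.log_le_sub_one_of_pos (by linarith)
  have hc := cA_b
  have hcs : 0.92128 * s ≤ cA * s := by nlinarith [hc.1]
  push_cast at p2 p3 p5
  norm_num at p2 p3 p5 h1 h2 ⊢
  linarith [hL.2]

end PS
end

section
namespace PS
open Chebyshev

/-- Forces evaluation of a natural number. -/
def force {α : Type} (n : ℕ) (f : ℕ → α) : α := Nat.casesOn n (f 0) (fun k => f (Nat.succ k))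

theorem force_eq {α : Type} (n : ℕ) (f : ℕ → α) : force n f = f n := by cases n <;> rfl

/-- Binary search for the binary logarithm. -/
def bs (N : ℕ) (i : ℕ) : ℕ → ℕ := Nat.rec (fun L => L) (fun i ih L => force (Nat.add L (Nat.pow 2 i)) fun L' =>
  cond (Nat.ble 1 (Nat.shiftRight N L')) (ih L') (ih L)) i

/-- Scaled binary logarithm. -/
def lg (n : ℕ) : ℕ := force (Nat.pow n 64) fun N => bs N 11 0

theorem bs_succ (N i L : ℕ) : bs N (i + 1) L = if 2 ^ (L + 2 ^ i) ≤ N then bs N i (L + 2 ^ i) else bs N i L := by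
  have : bs N (i+1) L = force (L + 2 ^ i) fun L' => cond (Nat.ble 1 (N >>> L')) (bs N i L') (bs N i L) := rfl
  rw [this, force_eq, Bool.cond_eq_ite]
  simp only [Nat.ble_eq, Nat.shiftRight_eq_div_pow]
  have : 1 ≤ N / 2 ^ (L + 2 ^ i) ↔ 2 ^ (L + 2 ^ i) ≤ N := by
    rw [Nat.le_div_iff_mul_le (by positivity), one_mul]
  simp only [this]

theorem bs_le (N i : ℕ) : ∀ L, 2 ^ L ≤ N → 2 ^ (bs N i L) ≤ N := by
  induction i with
  | zero => intro L h; exact h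
  | succ i ih =>
    intro L h
    rw [bs_succ]
    split_ifs with h1
    · exact ih _ h1
    · exact ih _ h

theorem lt_bs (N i : ℕ) : ∀ L, N < 2 ^ (L + 2 ^ i) → N < 2 ^ (bs N i L + 1) := by
  induction i with
  | zero => intro L h; exact h
  | succ i ih =>
    intro L h
    rw [bs_succ]
    split_ifs with h1
    · apply ih
      rw [pow_succ] at h
      rwa [show L + 2 ^ i + 2 ^ i = L + 2 ^ i * 2 by ring]
    · exact ih _ (not_le.1 h1)

def cntP (Q m k : ℕ) : ℕ :=
  Nat.rec 0 (fun j r => Nat.add r (Nat.sub 2 (Nat.gcd (Nat.add m (Nat.mul 2 (Nat.succ j))) Q))) k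

def coefA (m : ℕ) : ℕ := bif Nat.blt m 60 then 0 else bif Nat.blt m 130 then 854 else bif Nat.blt m 1000 then 910 else 914

def tabChk (m m' c c' : ℕ) : Bool :=
  cond (Nat.ble (Nat.add (Nat.mul (Nat.mul (coefA (Nat.pred m')) (Nat.pred m')) 64000000) (Nat.mul c 64000000000))
    (Nat.mul (Nat.mul c (lg m)) 693147000))
  (Nat.ble (Nat.mul (Nat.mul c' (Nat.succ (lg m'))) 69314719) (Nat.add (Nat.mul m 6940800000) (Nat.mul c' 7360000000))) false

def stepK (E m : ℕ) : ℕ := cond (Nat.ble (Nat.succ (Nat.div m 512)) (Nat.div (Nat.sub E m) 2)) (Nat.succ (Nat.div m 512)) (Nat.div (Nat.sub E m) 2)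

def tab (Q E c1 tl1 tu1 : ℕ) (fuel : ℕ) : ℕ → ℕ → ℕ → ℕ → Bool :=
  Nat.rec (fun m c tl tu => cond (Nat.beq m E) (cond (Nat.beq c c1) (cond (Nat.beq tl tl1) (Nat.beq tu tu1) false) false) false)
    (fun _ ih m c tl tu =>
      force (stepK E m) fun k => force (Nat.add m (Nat.mul 2 k)) fun m' => force (cntP Q m k) fun d => force (Nat.add c d) fun c' =>
      force (Nat.add tl (Nat.mul d (lg m))) fun tl' => force (Nat.add tu (Nat.mul d (Nat.succ (lg m')))) fun tu' =>
      cond (tabChk m m' c c') (ih m' c' tl' tu') false) fuel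

set_option maxRecDepth 100000 in
theorem tab1 : force (Nat.factorial 18) (fun Q => tab Q 359 72 29307 31917 175 19 8 0 2432) = true := by decide +kernel

set_option maxRecDepth 100000 in
theorem tab2 : force (Nat.factorial 316) (fun Q => tab Q 99999 9592 9195944 9211544 1330 359 72 29307 31917) = true := by
  decide +kernel

theorem lg_le (n : ℕ) (hn : 1 ≤ n) : (lg n : ℝ) * Real.log 2 ≤ 64 * Real.log n := by
  have h : 2 ^ lg n ≤ n ^ 64 := by
    unfold lg; rw [force_eq]; exact bs_le _ _ _ (Nat.one_le_pow _ _ hn)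
  have h' : (2:ℝ) ^ lg n ≤ (n:ℝ) ^ 64 := by exact_mod_cast h
  have := Real.log_le_log (by positivity) h'
  rw [Real.log_pow, Real.log_pow] at this
  exact_mod_cast this

theorem le_lg (n : ℕ) (hn : 1 ≤ n) (hn' : n < 2 ^ 32) : 64 * Real.log n ≤ ((lg n : ℝ) + 1) * Real.log 2 := by
  have h : n ^ 64 < 2 ^ (lg n + 1) := by
    unfold lg; rw [force_eq]; apply lt_bs
    calc n ^ 64 < (2 ^ 32) ^ 64 := Nat.pow_lt_pow_left hn' (by norm_num)
      _ = 2 ^ (0 + 2 ^ 11) := by rw [← pow_mul, Nat.zero_add]; congr 1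
  have h' : (n:ℝ) ^ 64 ≤ (2:ℝ) ^ (lg n + 1) := by exact_mod_cast h.le
  have hn0 : (0:ℝ) < n := by exact_mod_cast hn
  have := Real.log_le_log (by positivity) h'
  rw [Real.log_pow, Real.log_pow] at this
  exact_mod_cast this

theorem prime_iff_gcd (B n : ℕ) (h1 : B < n) (h2 : n < (B + 1) ^ 2) (h3 : 2 ≤ n) :
    n.Prime ↔ Nat.gcd n B.factorial = 1 := by
  constructor
  · intro hp
    have : Nat.Coprime n B.factorial := (Nat.Prime.coprime_iff_not_dvd hp).2 (by rw [hp.dvd_factorial]; omega)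
    exact this
  · intro hg
    by_contra hnp
    have h4 := Nat.minFac_sq_le_self (by omega) hnp
    have h5 : n.minFac ≤ B := by
      by_contra h6
      have : (B + 1) ^ 2 ≤ n.minFac ^ 2 := Nat.pow_le_pow_left (by omega) 2
      omega
    have h6 : n.minFac ∣ B.factorial := Nat.dvd_factorial (Nat.minFac_pos n) h5
    have h7 := Nat.dvd_gcd (Nat.minFac_dvd n) h6
    rw [hg] at h7
    have := (Nat.minFac_prime (show n ≠ 1 by omega)).one_lt
    have := Nat.le_of_dvd one_pos h7
    omega

theorem cntP_eq (B m k : ℕ) (hB : B < m) (hm : 2 ≤ m) (he : m % 2 = 1) (hk : m + 2 * k < (B + 1) ^ 2) :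
    cntP B.factorial m k = ((Finset.Ioc m (m + 2 * k)).filter Nat.Prime).card := by
  induction k with
  | zero => simp [cntP]
  | succ k ih =>
    have e : cntP B.factorial m (k+1) = cntP B.factorial m k +
      (2 - Nat.gcd (m + 2 * (k + 1)) B.factorial) := rfl
    rw [e, ih (by omega)]
    have e2 : Finset.Ioc m (m + 2 * (k + 1)) = insert (m + 2 * k + 1) (insert (m + 2 * k + 2) (Finset.Ioc m (m + 2 * k))) := by
      ext x; simp only [Finset.mem_Ioc, Finset.mem_insert]; omega
    have np : ¬ (m + 2 * k + 1).Prime := by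
      intro hp
      rcases hp.eq_two_or_odd with h | h <;> omega
    rw [e2, Finset.filter_insert, if_neg np, Finset.filter_insert]
    have hiff := prime_iff_gcd B (m + 2 * k + 2) (by omega) (by omega) (by omega)
    by_cases hp : (m + 2 * k + 2).Prime
    · rw [if_pos hp, Finset.card_insert_of_notMem (by simp)]
      have := hiff.1 hp
      rw [show m + 2 * (k + 1) = m + 2 * k + 2 by ring, this]
    · rw [if_neg hp]
      have : Nat.gcd (m + 2 * k + 2) B.factorial ≠ 1 := fun h => hp (hiff.2 h)
      rw [show m + 2 * (k + 1) = m + 2 * k + 2 by ring]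
      have : 0 < Nat.gcd (m + 2 * k + 2) B.factorial := Nat.gcd_pos_of_pos_left _ (by omega)
      omega

theorem pi_add (m n : ℕ) (h : m ≤ n) :
    Nat.primeCounting n = Nat.primeCounting m + ((Finset.Ioc m n).filter Nat.Prime).card := by
  have e (x : ℕ) : Nat.primeCounting x = ((Finset.Ioc 0 x).filter Nat.Prime).card := by
    rw [Nat.primeCounting, Nat.primeCounting', Nat.count_eq_card_filter_range]
    congr 1; ext p; simp only [Finset.mem_filter, Finset.mem_range, Finset.mem_Ioc]
    constructor
    · rintro ⟨h, hp⟩; exact ⟨⟨hp.pos, by omega⟩, hp⟩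
    · rintro ⟨h, hp⟩; exact ⟨by omega, hp⟩
  rw [e, e, ← Finset.Ioc_union_Ioc_eq_Ioc (Nat.zero_le m) h, Finset.filter_union,
    Finset.card_union_of_disjoint]
  apply Finset.disjoint_filter_filter
  apply Finset.disjoint_left.2; intro x hx hx'; simp at hx hx'; omega

theorem theta_add (m n : ℕ) (h : m ≤ n) :
    θ (n:ℝ) = θ (m:ℝ) + ∑ p ∈ (Finset.Ioc m n).filter Nat.Prime, Real.log p := by
  unfold theta
  rw [Nat.floor_natCast, Nat.floor_natCast, ← Finset.Ioc_union_Ioc_eq_Ioc (Nat.zero_le m) h, Finset.filter_union,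
    Finset.sum_union]
  apply Finset.disjoint_filter_filter
  apply Finset.disjoint_left.2; intro x hx hx'; simp at hx hx'; omega

def Inv (m c tl tu : ℕ) : Prop := Nat.primeCounting m = c ∧ (tl:ℝ) * Real.log 2 ≤ 64 * θ (m:ℝ) ∧
  64 * θ (m:ℝ) ≤ tu * Real.log 2

def Good (n : ℕ) : Prop := (coefA n : ℝ) / 1000 * n ≤ Nat.primeCounting n * (Real.log n - 1) ∧
  Nat.primeCounting n * (Real.log n - 1.15) ≤ 1.0845 * n

theorem coefA_mono (m n : ℕ) (h : m ≤ n) : coefA m ≤ coefA n := by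
  simp only [coefA, Bool.cond_eq_ite, Nat.blt_eq]
  split_ifs <;> omega

theorem tab_step (m c tl tu m' c' d : ℕ) (hm : 3 ≤ m) (hmm : m ≤ m') (hm3 : m' < 2 ^ 32) (hi : Inv m c tl tu)
    (hd : d = ((Finset.Ioc m m').filter Nat.Prime).card) (hc : c' = c + d)
    (hchk : tabChk m m' c c' = true) :
    Inv m' c' (tl + d * lg m) (tu + d * (lg m' + 1)) ∧ ∀ n, m ≤ n → n < m' → Good n := by
  have hl2 := Real.log_two_gt_d9
  have hl2' := Real.log_two_lt_d9
  obtain ⟨h1, h2, h3⟩ := hi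
  have hpi := pi_add m m' hmm
  have hth := theta_add m m' hmm
  have lm := lg_le m (by omega)
  have lm' := le_lg m' (by omega) hm3
  have hm0 : (0:ℝ) < m := by exact_mod_cast (by omega : 0 < m)
  refine ⟨⟨by rw [hpi, h1, hc, hd], ?_, ?_⟩, ?_⟩
  · have : (d:ℝ) * Real.log m ≤ ∑ p ∈ (Finset.Ioc m m').filter Nat.Prime, Real.log p := by
      rw [hd, ← nsmul_eq_mul]
      apply Finset.card_nsmul_le_sum
      intro p hp
      simp only [Finset.mem_filter, Finset.mem_Ioc] at hp
      exact Real.log_le_log hm0 (by exact_mod_cast hp.1.1.le)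
    have h5 : (d:ℝ) * (lg m * Real.log 2) ≤ d * (64 * Real.log m) := by gcongr
    push_cast; rw [hth]; nlinarith
  · have : ∑ p ∈ (Finset.Ioc m m').filter Nat.Prime, Real.log p ≤ (d:ℝ) * Real.log m' := by
      rw [hd, ← nsmul_eq_mul]
      apply Finset.sum_le_card_nsmul
      intro p hp
      simp only [Finset.mem_filter, Finset.mem_Ioc] at hp
      exact Real.log_le_log (by exact_mod_cast hp.2.pos) (by exact_mod_cast hp.1.2)
    have h5 : (d:ℝ) * (64 * Real.log m') ≤ d * ((lg m' + 1) * Real.log 2) := by gcongr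
    push_cast; rw [hth]; nlinarith
  · intro n hn hn'
    have hchk' : (coefA (m' - 1) * (m' - 1) * 64000000 + c * 64000000000 ≤ c * lg m * 693147000) ∧
        c' * (lg m' + 1) * 69314719 ≤ m * 6940800000 + c' * 7360000000 := by
      unfold tabChk at hchk
      rw [Bool.cond_eq_ite] at hchk
      split_ifs at hchk with hh
      exact ⟨Nat.le_of_ble_eq_true hh, Nat.le_of_ble_eq_true hchk⟩
    obtain ⟨k1, k2⟩ := hchk'
    have p1 := pi_add m n hn
    have p2 := pi_add n m' hn'.le
    have hn0 : (0:ℝ) < n := by exact_mod_cast (by omega : 0 < n)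
    have pc : c ≤ Nat.primeCounting n := by omega
    have pc' : Nat.primeCounting n ≤ c' := by omega
    have ln : Real.log m ≤ Real.log n := Real.log_le_log hm0 (by exact_mod_cast hn)
    have ln' : Real.log n ≤ Real.log m' := Real.log_le_log hn0 (by exact_mod_cast hn'.le)
    have pcR : (c:ℝ) ≤ Nat.primeCounting n := by exact_mod_cast pc
    have pcR' : (Nat.primeCounting n : ℝ) ≤ c' := by exact_mod_cast pc'
    constructor
    · have ca : coefA n * n ≤ coefA (m' - 1) * (m' - 1) := Nat.mul_le_mul (coefA_mono _ _ (by omega)) (by omega)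
      have k3 : coefA n * n * 64000000 + c * 64000000000 ≤ c * lg m * 693147000 :=
        (Nat.add_le_add_right (Nat.mul_le_mul_right _ ca) _).trans k1
      have k4 : (coefA n : ℝ) * n * 64000000 + c * 64000000000 ≤ c * lg m * 693147000 := by exact_mod_cast k3
      have k5 : (c:ℝ) * lg m * 693147000 ≤ c * (64 * Real.log m) * 1000000000 := by
        have : (lg m : ℝ) * 693147 ≤ (64 * Real.log m) * 1000000 := by
          have : (lg m : ℝ) * 0.693147 ≤ lg m * Real.log 2 := by gcongr; linarith
          linarith
        have : (c:ℝ) * (lg m * 693147) ≤ c * ((64 * Real.log m) * 1000000) := by gcongr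
        linarith
      have k6 : (coefA n : ℝ) / 1000 * n ≤ c * (Real.log m - 1) := by linarith
      have h1' : 0 ≤ Real.log m - 1 := by
        have h3 : Real.log 3 ≤ Real.log m := Real.log_le_log (by norm_num) (by exact_mod_cast hm)
        have := Real.log_three_gt_d9
        linarith
      calc _ ≤ _ := k6
        _ ≤ _ := by gcongr
    · have k4 : (c':ℝ) * (lg m' + 1) * 69314719 ≤ m * 6940800000 + c' * 7360000000 := by exact_mod_cast k2
      have k5 : (c':ℝ) * (64 * Real.log m') * 100000000 ≤ c' * (lg m' + 1) * 69314719 := by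
        have : (64 * Real.log m') * 100000000 ≤ (lg m' + 1) * 69314719 := by
          have : ((lg m' : ℝ) + 1) * Real.log 2 ≤ (lg m' + 1) * 0.69314719 := by gcongr; linarith
          linarith
        have : (c':ℝ) * ((64 * Real.log m') * 100000000) ≤ c' * ((lg m' + 1) * 69314719) := by gcongr
        linarith
      have k6 : (c':ℝ) * (Real.log m' - 1.15) ≤ 1.0845 * m := by linarith
      have hmn : (m:ℝ) ≤ n := by exact_mod_cast hn
      rcases le_total (Real.log n) 1.15 with hh | hh
      · have := Nat.cast_nonneg (α := ℝ) (Nat.primeCounting n)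
        nlinarith
      · calc (Nat.primeCounting n : ℝ) * (Real.log n - 1.15) ≤ c' * (Real.log m' - 1.15) := by
              apply mul_le_mul pcR' (by linarith) (by linarith) (by positivity)
          _ ≤ _ := k6
          _ ≤ _ := by gcongr

theorem tab_sound (B E c1 tl1 tu1 : ℕ) (hE : E < (B + 1) ^ 2) (hE' : E < 2 ^ 32) (hE2 : E % 2 = 1) (fuel : ℕ) :
    ∀ m c tl tu, B < m → 3 ≤ m → m % 2 = 1 → m ≤ E → Inv m c tl tu →
    tab B.factorial E c1 tl1 tu1 fuel m c tl tu = true →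
    Inv E c1 tl1 tu1 ∧ ∀ n, m ≤ n → n < E → Good n := by
  induction fuel with
  | zero =>
    intro m c tl tu _ _ _ _ hi h
    have h' : (cond (Nat.beq m E) (cond (Nat.beq c c1) (cond (Nat.beq tl tl1) (Nat.beq tu tu1) false) false) false) = true := h
    simp only [Bool.cond_eq_ite] at h'
    split_ifs at h' with h1 h2 h3
    rw [Nat.eq_of_beq_eq_true h1, Nat.eq_of_beq_eq_true h2, Nat.eq_of_beq_eq_true h3, Nat.eq_of_beq_eq_true h'] at hi
    refine ⟨hi, fun n h5 h6 => ?_⟩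
    have := Nat.eq_of_beq_eq_true h1
    omega
  | succ f ih =>
    intro m c tl tu hB hm ho hmE hi h
    have h' : (force (stepK E m) fun k => force (m + 2 * k) fun m' => force (cntP B.factorial m k) fun d => force (c + d) fun c' =>
      force (tl + d * lg m) fun tl' => force (tu + d * (lg m' + 1)) fun tu' =>
      cond (tabChk m m' c c') (tab B.factorial E c1 tl1 tu1 f m' c' tl' tu') false) = true := h
    simp only [force_eq] at h'
    have hk : 2 * stepK E m ≤ E - m := by
      unfold stepK
      rw [Bool.cond_eq_ite]
      have e1 : Nat.div m 512 = m / 512 := rfl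
      have e2 : Nat.div (Nat.sub E m) 2 = (E - m) / 2 := rfl
      rw [e1, e2]
      split_ifs with hh
      · have := Nat.le_of_ble_eq_true hh
        omega
      · omega
    generalize stepK E m = k at h' hk
    rw [Bool.cond_eq_ite] at h'
    split_ifs at h' with h1
    obtain ⟨i1, g1⟩ := tab_step m c tl tu (m + 2 * k) _ _ hm (by omega) (by omega) hi
      (cntP_eq B m k hB (by omega) ho (by omega)) rfl h1
    obtain ⟨i2, g2⟩ := ih _ _ _ _ (by omega) (by omega) (by omega) (by omega) i1 h'
    refine ⟨i2, fun n h5 h6 => ?_⟩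
    rcases lt_or_ge n (m + 2 * k) with h7 | h7
    · exact g1 n h5 h7
    · exact g2 n h7 h6

theorem inv19 : Inv 19 8 0 2432 := by
  refine ⟨by decide +kernel, ?_, ?_⟩
  · have := theta_nonneg ((19:ℕ):ℝ)
    push_cast at *; linarith
  · have := theta_le_log4_mul_x (x := ((19:ℕ):ℝ)) (by positivity)
    rw [show (4:ℝ) = 2 ^ 2 by norm_num, Real.log_pow] at this
    push_cast at *
    linarith

theorem small_good : Inv 99999 9592 9195944 9211544 ∧ ∀ n, 19 ≤ n → n < 99999 → Good n := by
  have t1 := tab1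
  have t2 := tab2
  rw [force_eq] at t1 t2
  obtain ⟨i1, g1⟩ := tab_sound 18 359 72 29307 31917 (by norm_num) (by norm_num) (by norm_num) 175 19 8 0 2432 (by norm_num)
    (by norm_num) (by norm_num) (by norm_num) inv19 t1
  obtain ⟨i2, g2⟩ := tab_sound 316 99999 9592 9195944 9211544 (by norm_num) (by norm_num) (by norm_num) 1330 _ _ _ _ (by norm_num)
    (by norm_num) (by norm_num) (by norm_num) i1 t2
  refine ⟨i2, fun n h1 h2 => ?_⟩
  rcases lt_or_ge n 359 with h | h
  · exact g1 n h1 h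
  · exact g2 n h h2
end PS
end

section
namespace PS
open Chebyshev

theorem hasDeriv_G (c t : ℝ) (ht : 0 < t) (h1 : Real.log t ≠ 0) (h2 : Real.log t - c ≠ 0) :
    HasDerivAt (fun t : ℝ => t / (Real.log t - c) - t / Real.log t)
      ((Real.log t - c - 1) / (Real.log t - c) ^ 2 - (Real.log t - 1) / Real.log t ^ 2) t := by
  have hl := Real.hasDerivAt_log ht.ne'
  have e1 := (hasDerivAt_id' t).div (hl.sub_const c) h2
  have e2 := (hasDerivAt_id' t).div hl h1
  refine (e1.sub e2).congr_deriv ?_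
  have h3 : t * t⁻¹ = 1 := mul_inv_cancel₀ ht.ne'
  rw [one_mul, one_mul, h3]

theorem K_bounds_aux (m n : ℕ) (hm : m = 99999) (hn : n = 100000) (hI : Inv m 9592 9195944 9211544) :
    (926:ℝ) ≤ Nat.primeCounting n - θ 100000 / Real.log 100000 ∧
    (Nat.primeCounting n : ℝ) - θ 100000 / Real.log 100000 ≤ 942 := by
  obtain ⟨h1, h2, h3⟩ := hI
  have he : (Finset.Ioc m n).filter Nat.Prime = ∅ := by
    rw [show Finset.Ioc m n = {100000} by ext x; simp only [Finset.mem_Ioc, Finset.mem_singleton]; omega]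
    rw [Finset.filter_singleton, if_neg]
    norm_num
  have p := pi_add m n (by omega)
  have t := theta_add m n (by omega)
  rw [he] at p t
  simp only [Finset.card_empty, Finset.sum_empty, add_zero] at p t
  rw [← t] at h2 h3
  have hnR : (n:ℝ) = 100000 := by rw [hn]; norm_num
  rw [hnR] at h2 h3
  rw [p, h1]
  obtain ⟨l1, l2⟩ := log_1e5
  have hl2 := Real.log_two_gt_d9
  have hl2' := Real.log_two_lt_d9
  push_cast at h2 h3
  have e1 : θ 100000 / Real.log 100000 ≤ 8666 := by
    rw [div_le_iff₀ (by linarith)]; nlinarith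
  have e2 : 8650 ≤ θ 100000 / Real.log 100000 := by
    rw [le_div_iff₀ (by linarith)]; nlinarith
  push_cast
  constructor <;> linarith

theorem K_bounds (n : ℕ) (hn : n = 100000) : (926:ℝ) ≤ Nat.primeCounting n - θ 100000 / Real.log 100000 ∧
    (Nat.primeCounting n : ℝ) - θ 100000 / Real.log 100000 ≤ 942 :=
  K_bounds_aux 99999 n rfl hn small_good.1

theorem pi_split (n : ℕ) (hn : n = 100000) (x : ℝ) (hx : 100000 ≤ x) : (Nat.primeCounting ⌊x⌋₊ : ℝ) = θ x / Real.log x +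
    ((Nat.primeCounting n : ℝ) - θ 100000 / Real.log 100000) + ∫ t in (100000:ℝ)..x, θ t / (t * Real.log t ^ 2) := by
  have h1 := primeCounting_eq_theta_div_log_add_integral (x := x) (by linarith)
  have h2 := primeCounting_eq_theta_div_log_add_integral (x := 100000) (by norm_num)
  have hf : ⌊(100000:ℝ)⌋₊ = n := by
    rw [hn, show (100000:ℝ) = ((100000:ℕ):ℝ) by norm_num, Nat.floor_natCast]
  rw [hf] at h2
  have hi := integrableOn_theta_div_id_mul_log_sq x
  have i1 : IntervalIntegrable (fun t => θ t / (t * Real.log t ^ 2)) MeasureTheory.volume 2 100000 := by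
    rw [intervalIntegrable_iff_integrableOn_Icc_of_le (by norm_num)]
    exact hi.mono_set (Set.Icc_subset_Icc le_rfl hx)
  have i2 : IntervalIntegrable (fun t => θ t / (t * Real.log t ^ 2)) MeasureTheory.volume 100000 x := by
    rw [intervalIntegrable_iff_integrableOn_Icc_of_le hx]
    exact hi.mono_set (Set.Icc_subset_Icc (by norm_num) le_rfl)
  have := intervalIntegral.integral_add_adjacent_intervals i1 i2
  rw [h1, ← this, h2]; ring

theorem log_ge_1e5 (t : ℝ) (ht : 100000 ≤ t) : 11.5128 < Real.log t :=
  log_1e5.1.trans_le (Real.log_le_log (by norm_num) ht)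

theorem cont_G (c x : ℝ) (hc : c ≤ 2) : ContinuousOn (fun t : ℝ => t / (Real.log t - c) - t / Real.log t) (Set.Icc 100000 x) := by
  intro t ht
  have h := log_ge_1e5 t ht.1
  exact (hasDeriv_G c t (by linarith [ht.1]) (by linarith) (by linarith)).continuousAt.continuousWithinAt

theorem pi_upper_big (x : ℝ) (hx : 100000 ≤ x) : (Nat.primeCounting ⌊x⌋₊ : ℝ) * (Real.log x - 1.15) ≤ 1.0877 * x := by
  obtain ⟨n, hn⟩ : ∃ n : ℕ, n = 100000 := ⟨_, rfl⟩
  rw [pi_split n hn x hx]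
  have hi := integrableOn_theta_div_id_mul_log_sq x
  have hI := intervalIntegral.integral_le_sub_of_hasDeriv_right_of_le (a := 100000) (b := x)
    (g := fun t => 1.0877 * (t / (Real.log t - 1.15) - t / Real.log t))
    (g' := fun t => 1.0877 * ((Real.log t - 1.15 - 1) / (Real.log t - 1.15) ^ 2 - (Real.log t - 1) / Real.log t ^ 2))
    (φ := fun t => θ t / (t * Real.log t ^ 2)) hx ((cont_G 1.15 x (by norm_num)).const_mul _) (by
      intro t ht
      have h := log_ge_1e5 t ht.1.le
      exact ((hasDeriv_G 1.15 t (by linarith [ht.1]) (by linarith) (by linarith)).const_mul _).hasDerivWithinAt)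
    (hi.mono_set (Set.Icc_subset_Icc (by norm_num) le_rfl)) (by
      intro t ht
      have h := log_ge_1e5 t ht.1.le
      have ht0 : 0 < t := by linarith [ht.1]
      have h5 := (theta_le_psi t).trans (psi_le_main t ht.1.le)
      have h6 : θ t / (t * Real.log t ^ 2) ≤ 1.0877 * (1 / Real.log t ^ 2) := by
        rw [div_le_iff₀ (by positivity)]
        have : 1.0877 * (1 / Real.log t ^ 2) * (t * Real.log t ^ 2) = 1.0877 * t := by
          field_simp
        linarith
      refine h6.trans ?_
      gcongr
      have h7 : 1 / Real.log t ≤ (Real.log t - 1.15 - 1) / (Real.log t - 1.15) ^ 2 := by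
        rw [div_le_div_iff₀ (by linarith) (by nlinarith)]; nlinarith
      have : 1 / Real.log t = 1 / Real.log t ^ 2 + (Real.log t - 1) / Real.log t ^ 2 := by
        field_simp; ring
      linarith)
  have h := log_ge_1e5 x hx
  have h5 := (theta_le_psi x).trans (psi_le_main x hx)
  have h6 : θ x / Real.log x ≤ 1.0877 * (x / Real.log x) := by
    rw [← mul_div_assoc]; gcongr
  obtain ⟨l1, l2⟩ := log_1e5
  have h7 : 960 ≤ (100000:ℝ) / (Real.log 100000 - 1.15) - 100000 / Real.log 100000 := by
    have a1 : (100000:ℝ) / (11.51295 - 1.15) ≤ (100000:ℝ) / (Real.log 100000 - 1.15) := by gcongr; linarith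
    have a2 : (100000:ℝ) / Real.log 100000 ≤ 100000 / 11.5128 := by gcongr
    norm_num at a1 a2 ⊢
    linarith
  have hK := (K_bounds n hn).2
  have : θ x / Real.log x + ((Nat.primeCounting n : ℝ) - θ 100000 / Real.log 100000) +
      ∫ t in (100000:ℝ)..x, θ t / (t * Real.log t ^ 2) ≤ 1.0877 * (x / (Real.log x - 1.15)) := by
    linarith
  calc _ ≤ 1.0877 * (x / (Real.log x - 1.15)) * (Real.log x - 1.15) := by gcongr; linarith
    _ = _ := by
      have : Real.log x - 1.15 ≠ 0 := by linarith
      field_simp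

theorem pi_lower_big (x : ℝ) (hx : 100000 ≤ x) : 0.9145 * x ≤ (Nat.primeCounting ⌊x⌋₊ : ℝ) * (Real.log x - 1) := by
  obtain ⟨n, hn⟩ : ∃ n : ℕ, n = 100000 := ⟨_, rfl⟩
  rw [pi_split n hn x hx]
  have hi := integrableOn_theta_div_id_mul_log_sq x
  have hI := intervalIntegral.sub_le_integral_of_hasDeriv_right_of_le (a := 100000) (b := x)
    (g := fun t => 0.9145 * (t / (Real.log t - 1) - t / Real.log t))
    (g' := fun t => 0.9145 * ((Real.log t - 1 - 1) / (Real.log t - 1) ^ 2 - (Real.log t - 1) / Real.log t ^ 2))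
    (φ := fun t => θ t / (t * Real.log t ^ 2)) hx ((cont_G 1 x (by norm_num)).const_mul _) (by
      intro t ht
      have h := log_ge_1e5 t ht.1.le
      exact ((hasDeriv_G 1 t (by linarith [ht.1]) (by linarith) (by linarith)).const_mul _).hasDerivWithinAt)
    (hi.mono_set (Set.Icc_subset_Icc (by norm_num) le_rfl)) (by
      intro t ht
      have h := log_ge_1e5 t ht.1.le
      have ht0 : 0 < t := by linarith [ht.1]
      have h5 := theta_ge_main t ht.1.le
      have h6 : 0.9145 * (1 / Real.log t ^ 2) ≤ θ t / (t * Real.log t ^ 2) := by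
        rw [le_div_iff₀ (by positivity)]
        have : 0.9145 * (1 / Real.log t ^ 2) * (t * Real.log t ^ 2) = 0.9145 * t := by
          field_simp
        linarith
      refine le_trans ?_ h6
      gcongr
      have h7 : (Real.log t - 1 - 1) / (Real.log t - 1) ^ 2 ≤ 1 / Real.log t := by
        rw [div_le_div_iff₀ (by nlinarith) (by linarith)]; nlinarith
      have : 1 / Real.log t = 1 / Real.log t ^ 2 + (Real.log t - 1) / Real.log t ^ 2 := by
        field_simp; ring
      linarith)
  have h := log_ge_1e5 x hx
  have h5 := theta_ge_main x hx
  have h6 : 0.9145 * (x / Real.log x) ≤ θ x / Real.log x := by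
    rw [← mul_div_assoc]; gcongr
  obtain ⟨l1, l2⟩ := log_1e5
  have h7 : (100000:ℝ) / (Real.log 100000 - 1) - 100000 / Real.log 100000 ≤ 1000 := by
    have a1 : (100000:ℝ) / (Real.log 100000 - 1) ≤ (100000:ℝ) / (11.5128 - 1) := by gcongr
    have a2 : (100000:ℝ) / 11.51295 ≤ 100000 / Real.log 100000 := by gcongr
    norm_num at a1 a2 ⊢
    linarith
  have hK := (K_bounds n hn).1
  have : 0.9145 * (x / (Real.log x - 1)) ≤ θ x / Real.log x + ((Nat.primeCounting n : ℝ) - θ 100000 / Real.log 100000) +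
      ∫ t in (100000:ℝ)..x, θ t / (t * Real.log t ^ 2) := by
    linarith
  calc _ = 0.9145 * (x / (Real.log x - 1)) * (Real.log x - 1) := by
        have : Real.log x - 1 ≠ 0 := by linarith
        field_simp
    _ ≤ _ := by gcongr; linarith

theorem good_99999 (n : ℕ) (hn : n = 99999) : (0.914:ℝ) * 99999 ≤ Nat.primeCounting n * (Real.log 99999 - 1) ∧
    Nat.primeCounting n * (Real.log 99999 - 1.15) ≤ (1.0877:ℝ) * 99999 := by
  have hp : Nat.primeCounting n = 9592 := by rw [hn]; exact small_good.1.1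
  rw [hp]
  obtain ⟨l1, l2⟩ := log_1e5
  have h1 : Real.log 99999 ≤ Real.log 100000 := Real.log_le_log (by norm_num) (by norm_num)
  have h2 : Real.log 100000 ≤ Real.log 99999 + 0.0001 := by
    have : Real.log 100000 ≤ Real.log (99999 * Real.exp 0.0001) := Real.log_le_log (by norm_num) (by linarith [Real.add_one_le_exp (0.0001:ℝ)])
    rwa [Real.log_mul (by norm_num) (Real.exp_pos _).ne', Real.log_exp] at this
  push_cast
  constructor <;> linarith

theorem pi_upper (n : ℕ) (hn : 19 ≤ n) : (Nat.primeCounting n : ℝ) * (Real.log n - 1.15) ≤ 1.0877 * n := by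
  rcases lt_trichotomy n 99999 with h | h | h
  · have := (small_good.2 n hn h).2
    have : (0:ℝ) ≤ n := by positivity
    linarith
  · have h2 := (good_99999 n h).2
    have h3 : (n:ℝ) = 99999 := by rw [h]; norm_num
    rwa [h3]
  · have := pi_upper_big n (by exact_mod_cast h)
    rwa [Nat.floor_natCast] at this

theorem pi_lower (n : ℕ) (hn : 19 ≤ n) : (coefA n : ℝ) / 1000 * n ≤ (Nat.primeCounting n : ℝ) * (Real.log n - 1) := by
  have hc : (coefA n : ℝ) ≤ 914 := by
    have : coefA n ≤ 914 := by
      simp only [coefA, Bool.cond_eq_ite]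
      split_ifs <;> norm_num
    exact_mod_cast this
  have : (0:ℝ) ≤ n := by positivity
  rcases lt_trichotomy n 99999 with h | h | h
  · exact (small_good.2 n hn h).1
  · have h2 := (good_99999 n h).1
    have h3 : (n:ℝ) = 99999 := by rw [h]; norm_num
    rw [h3]; linarith
  · have := pi_lower_big n (by exact_mod_cast h)
    rw [Nat.floor_natCast] at this
    nlinarith
end PS
end

section
namespace PS
open ArithmeticFunction in
theorem mu_sum_one (n : ℕ) (_ : n ≠ 0) : ∑ d ∈ n.divisors, (ArithmeticFunction.moebius d : ℝ) = if n = 1 then 1 else 0 := by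
  have h := congrArg (fun f => f n) moebius_mul_coe_zeta
  simp only [coe_mul_zeta_apply, one_apply] at h
  have : ((∑ d ∈ n.divisors, ArithmeticFunction.moebius d : ℤ) : ℝ) = ((if n = 1 then 1 else 0 : ℤ) : ℝ) := by rw [h]
  push_cast at this
  exact this

/-- The set of sieving moduli. -/
def SD (q R : ℕ) : Finset ℕ := (Finset.Icc 1 R).filter (fun d => Squarefree d ∧ d.Coprime q)

noncomputable def SG (q R : ℕ) : ℝ := ∑ m ∈ SD q R, 1 / (Nat.totient m : ℝ)

noncomputable def lam (q R d : ℕ) : ℝ := (ArithmeticFunction.moebius d : ℝ) * d / SG q R *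
  ∑ m ∈ (SD q R).filter (d ∣ ·), 1 / (Nat.totient m : ℝ)

theorem mem_SD {q R d : ℕ} : d ∈ SD q R ↔ (1 ≤ d ∧ d ≤ R) ∧ Squarefree d ∧ d.Coprime q := by
  simp [SD]

theorem SD_dvd {q R d m : ℕ} (hm : m ∈ SD q R) (hd : d ∣ m) : d ∈ SD q R := by
  rw [mem_SD] at *
  have := Nat.pos_of_dvd_of_pos hd hm.1.1
  exact ⟨⟨this, (Nat.le_of_dvd hm.1.1 hd).trans hm.1.2⟩, hm.2.1.squarefree_of_dvd hd, hm.2.2.coprime_dvd_left hd⟩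

theorem one_mem_SD {q R : ℕ} (hR : 1 ≤ R) : 1 ∈ SD q R := by
  rw [mem_SD]; exact ⟨⟨le_rfl, hR⟩, squarefree_one, Nat.coprime_one_left q⟩

theorem SG_pos {q R : ℕ} (hR : 1 ≤ R) : 0 < SG q R := by
  unfold SG
  apply Finset.sum_pos
  · intro m hm
    have : 0 < Nat.totient m := Nat.totient_pos.2 (mem_SD.1 hm).1.1
    positivity
  · exact ⟨1, one_mem_SD hR⟩

theorem lam_one {q R : ℕ} (hR : 1 ≤ R) : lam q R 1 = 1 := by
  unfold lam
  have := SG_pos (q := q) hR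
  have e : (SD q R).filter (1 ∣ ·) = SD q R := by simp
  rw [e]
  change _ * SG q R = 1
  simp
  field_simp

/-- Diagonalisation: the sum of `λ_d / d` over multiples of `r`. -/
theorem lam_inv {q R r : ℕ} (hr : r ∈ SD q R) :
    ∑ d ∈ (SD q R).filter (r ∣ ·), lam q R d / d = (ArithmeticFunction.moebius r : ℝ) / (SG q R * Nat.totient r) := by
  have h1 : ∀ d ∈ (SD q R).filter (r ∣ ·), lam q R d / d =
      ∑ m ∈ SD q R, if d ∣ m then (ArithmeticFunction.moebius d : ℝ) / SG q R * (1 / (Nat.totient m : ℝ)) else 0 := by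
    intro d hd
    have hd0 : (d:ℝ) ≠ 0 := by
      have := (mem_SD.1 (Finset.mem_filter.1 hd).1).1.1
      positivity
    rw [← Finset.sum_filter, ← Finset.mul_sum, lam]
    field_simp
  rw [Finset.sum_congr rfl h1, Finset.sum_comm]
  have h2 : ∀ m ∈ SD q R, (∑ d ∈ (SD q R).filter (r ∣ ·), if d ∣ m then (ArithmeticFunction.moebius d : ℝ) / SG q R * (1 / (Nat.totient m : ℝ)) else 0)
      = if m = r then (ArithmeticFunction.moebius r : ℝ) / (SG q R * Nat.totient r) else 0 := by
    intro m hm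
    rw [← Finset.sum_filter]
    by_cases hrm : r ∣ m
    · obtain ⟨s, rfl⟩ := hrm
      have hm' := mem_SD.1 hm
      have hs0 : s ≠ 0 := by rintro rfl; simp at hm'
      have hr0 : r ≠ 0 := by rintro rfl; simp at hm'
      have e : ((SD q R).filter (r ∣ ·)).filter (· ∣ r * s) = s.divisors.image (r * ·) := by
        ext d
        simp only [Finset.mem_filter, Finset.mem_image, Nat.mem_divisors]
        constructor
        · rintro ⟨⟨h1, k, rfl⟩, h3⟩
          exact ⟨k, ⟨Nat.dvd_of_mul_dvd_mul_left (Nat.pos_of_ne_zero hr0) h3, hs0⟩, rfl⟩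
        · rintro ⟨k, ⟨hk, -⟩, rfl⟩
          have : r * k ∣ r * s := Nat.mul_dvd_mul_left r hk
          exact ⟨⟨SD_dvd hm this, Dvd.intro k rfl⟩, this⟩
      rw [e, Finset.sum_image (by intro x _ y _ h; exact Nat.eq_of_mul_eq_mul_left (Nat.pos_of_ne_zero hr0) h)]
      have e2 : ∀ k ∈ s.divisors, (ArithmeticFunction.moebius (r * k) : ℝ) / SG q R * (1 / (Nat.totient (r * s) : ℝ)) =
          (ArithmeticFunction.moebius r : ℝ) / SG q R * (1 / (Nat.totient (r * s) : ℝ)) * (ArithmeticFunction.moebius k : ℝ) := by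
        intro k hk
        have hc : Nat.Coprime r k := by
          have h5 : Nat.Coprime r s := Nat.coprime_of_squarefree_mul hm'.2.1
          exact h5.coprime_dvd_right (Nat.dvd_of_mem_divisors hk)
        rw [ArithmeticFunction.isMultiplicative_moebius.map_mul_of_coprime hc]
        push_cast; ring
      rw [Finset.sum_congr rfl e2, ← Finset.mul_sum, mu_sum_one s hs0]
      by_cases hs : s = 1
      · subst hs; simp; ring
      · rw [if_neg hs, if_neg]
        · simp
        · intro h
          apply hs
          exact Nat.eq_of_mul_eq_mul_left (Nat.pos_of_ne_zero hr0) (by rw [h, mul_one])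
    · rw [if_neg (by rintro rfl; exact hrm dvd_rfl)]
      apply Finset.sum_eq_zero
      intro d hd
      simp only [Finset.mem_filter] at hd
      exact absurd (hd.1.2.trans hd.2) hrm
  rw [Finset.sum_congr rfl h2, Finset.sum_ite_eq' , if_pos hr]

theorem quad_form {q R : ℕ} (hR : 1 ≤ R) :
    ∑ d ∈ SD q R, ∑ e ∈ SD q R, lam q R d * lam q R e / (Nat.lcm d e : ℝ) = 1 / SG q R := by
  have h1 : ∀ d ∈ SD q R, ∀ e ∈ SD q R, lam q R d * lam q R e / (Nat.lcm d e : ℝ) =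
      ∑ r ∈ SD q R, (Nat.totient r : ℝ) * ((if r ∣ d then lam q R d / d else 0) * (if r ∣ e then lam q R e / e else 0)) := by
    intro d hd e he
    have hd1 := mem_SD.1 hd
    have he1 := mem_SD.1 he
    have hg0 : Nat.gcd d e ≠ 0 := Nat.gcd_ne_zero_left (by omega)
    have h2 : (Nat.gcd d e : ℝ) = ∑ r ∈ (Nat.gcd d e).divisors, (Nat.totient r : ℝ) := by
      rw [← Nat.cast_sum, Nat.sum_totient]
    have h3 : (SD q R).filter (fun r => r ∣ d ∧ r ∣ e) = (Nat.gcd d e).divisors := by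
      ext r
      simp only [Finset.mem_filter, Nat.mem_divisors, Nat.dvd_gcd_iff]
      constructor
      · rintro ⟨h, h'⟩; exact ⟨h', hg0⟩
      · rintro ⟨h', -⟩; exact ⟨SD_dvd hd h'.1, h'⟩
    have h4 : ∀ r ∈ SD q R, (Nat.totient r : ℝ) * ((if r ∣ d then lam q R d / d else 0) * (if r ∣ e then lam q R e / e else 0))
        = if (r ∣ d ∧ r ∣ e) then (Nat.totient r : ℝ) * (lam q R d / d * (lam q R e / e)) else 0 := by
      intro r _
      by_cases a1 : r ∣ d <;> by_cases a2 : r ∣ e <;> simp [a1, a2]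
    rw [Finset.sum_congr rfl h4, ← Finset.sum_filter, h3, ← Finset.sum_mul, ← h2]
    have h5 : (Nat.gcd d e : ℝ) * Nat.lcm d e = d * e := by exact_mod_cast Nat.gcd_mul_lcm d e
    have hd0 : (d:ℝ) ≠ 0 := by exact_mod_cast (by omega : d ≠ 0)
    have he0 : (e:ℝ) ≠ 0 := by exact_mod_cast (by omega : e ≠ 0)
    have hl0 : (Nat.lcm d e : ℝ) ≠ 0 := by exact_mod_cast Nat.lcm_ne_zero (by omega) (by omega)
    field_simp
    linear_combination (-(lam q R d * lam q R e)) * h5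
  rw [Finset.sum_congr rfl (fun d hd => Finset.sum_congr rfl (h1 d hd))]
  have h2 : ∀ d ∈ SD q R, ∑ e ∈ SD q R, ∑ r ∈ SD q R, (Nat.totient r : ℝ) * ((if r ∣ d then lam q R d / d else 0) * (if r ∣ e then lam q R e / e else 0))
      = ∑ r ∈ SD q R, (if r ∣ d then lam q R d / d else 0) * ((Nat.totient r : ℝ) * ∑ e ∈ SD q R, (if r ∣ e then lam q R e / e else 0)) := by
    intro d _
    rw [Finset.sum_comm]
    apply Finset.sum_congr rfl
    intro r _
    rw [Finset.mul_sum, Finset.mul_sum]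
    apply Finset.sum_congr rfl
    intro e _; ring
  rw [Finset.sum_congr rfl h2, Finset.sum_comm]
  have h3 : ∀ r ∈ SD q R, ∑ d ∈ SD q R, (if r ∣ d then lam q R d / d else 0) * ((Nat.totient r : ℝ) * ∑ e ∈ SD q R, (if r ∣ e then lam q R e / e else 0))
      = 1 / SG q R ^ 2 * (1 / (Nat.totient r : ℝ)) := by
    intro r hr
    rw [← Finset.sum_mul, ← Finset.sum_filter, lam_inv hr]
    have hG := SG_pos (q := q) hR
    have hr1 := mem_SD.1 hr
    have hp : (0:ℝ) < Nat.totient r := by exact_mod_cast Nat.totient_pos.2 (by omega)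
    have hmu : (ArithmeticFunction.moebius r : ℝ) ^ 2 = 1 := by
      have := ArithmeticFunction.moebius_sq_eq_one_of_squarefree hr1.2.1
      exact_mod_cast this
    field_simp
    exact hmu
  rw [Finset.sum_congr rfl h3, ← Finset.mul_sum]
  have hG := SG_pos (q := q) hR
  change 1 / SG q R ^ 2 * SG q R = _
  field_simp

theorem sum_inv_totient (d : ℕ) (hd : Squarefree d) : ∑ k ∈ d.divisors, 1 / (Nat.totient k : ℝ) = d / Nat.totient d := by
  induction d using Nat.recOnPosPrimePosCoprime with
  | zero => simp at hd
  | one => simp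
  | prime_pow p n hp hn =>
    have h1 : n = 1 := by
      by_contra h
      have := (Nat.squarefree_pow_iff hp.ne_one (by omega)).1 hd
      omega
    subst h1
    rw [pow_one, Nat.Prime.divisors hp, Finset.sum_pair hp.one_lt.ne, Nat.totient_one, Nat.totient_prime hp,
      Nat.cast_sub hp.one_le]
    have : (1:ℝ) < p := by exact_mod_cast hp.one_lt
    have : (p:ℝ) - 1 ≠ 0 := by linarith
    push_cast
    field_simp
    ring
  | coprime a b ha hb hab iha ihb =>
    have hs := (Nat.squarefree_mul hab).1 hd
    rw [Nat.divisors_mul, Finset.mul_def, Finset.sum_image hab.mul_injOn_divisors, Finset.sum_product, Nat.totient_mul hab,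
      Nat.cast_mul, Nat.cast_mul, ← div_mul_div_comm, ← iha hs.1, ← ihb hs.2, Finset.sum_mul_sum]
    refine Finset.sum_congr rfl fun i hi => Finset.sum_congr rfl fun j hj => ?_
    have : Nat.Coprime i j := (hab.coprime_dvd_left (Nat.dvd_of_mem_divisors hi)).coprime_dvd_right (Nat.dvd_of_mem_divisors hj)
    rw [Nat.totient_mul this]; push_cast
    rw [div_mul_div_comm, one_mul]

theorem lam_abs_le {q R d : ℕ} (hd : d ∈ SD q R) : |lam q R d| ≤ 1 := by
  have hd1 := mem_SD.1 hd
  have hG := SG_pos (q := q) (R := R) (by omega)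
  have hd0 : (0:ℝ) < d := by exact_mod_cast hd1.1.1
  have key : (d:ℝ) * ∑ m ∈ (SD q R).filter (d ∣ ·), 1 / (Nat.totient m : ℝ) ≤ SG q R := by
    have h1 : (d:ℝ) * ∑ m ∈ (SD q R).filter (d ∣ ·), 1 / (Nat.totient m : ℝ) =
        ∑ x ∈ d.divisors ×ˢ (SD q R).filter (d ∣ ·), 1 / (Nat.totient (x.1 * (x.2 / d)) : ℝ) := by
      rw [Finset.sum_product]
      have hphi : (0:ℝ) < Nat.totient d := by exact_mod_cast Nat.totient_pos.2 (by omega)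
      have h2 : (d:ℝ) = Nat.totient d * ∑ k ∈ d.divisors, 1 / (Nat.totient k : ℝ) := by
        rw [sum_inv_totient d hd1.2.1]; field_simp
      rw [h2, mul_assoc, Finset.sum_mul_sum, Finset.mul_sum]
      refine Finset.sum_congr rfl fun k hk => ?_
      rw [Finset.mul_sum]
      refine Finset.sum_congr rfl fun m hm => ?_
      obtain ⟨hm1, s, rfl⟩ := Finset.mem_filter.1 hm
      have hm2 := mem_SD.1 hm1
      have hc : Nat.Coprime d s := Nat.coprime_of_squarefree_mul hm2.2.1
      rw [Nat.mul_div_cancel_left s hd1.1.1, Nat.totient_mul hc,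
        Nat.totient_mul (hc.coprime_dvd_left (Nat.dvd_of_mem_divisors hk))]
      push_cast
      field_simp
    rw [h1]
    unfold SG
    have hinj : Set.InjOn (fun x : ℕ × ℕ => x.1 * (x.2 / d)) (d.divisors ×ˢ (SD q R).filter (d ∣ ·) : Finset (ℕ × ℕ)) := by
      rintro ⟨k, m⟩ hx ⟨k', m'⟩ hx' h
      rw [Finset.mem_coe, Finset.mem_product] at hx hx'
      obtain ⟨hm1, s, hs⟩ := Finset.mem_filter.1 hx.2
      obtain ⟨hm1', s', hs'⟩ := Finset.mem_filter.1 hx'.2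
      simp only at hs hs' hm1 hm1' hx hx'
      subst hs hs'
      simp only [Nat.mul_div_cancel_left _ hd1.1.1] at h
      have hc : Nat.Coprime d s := Nat.coprime_of_squarefree_mul (mem_SD.1 hm1).2.1
      have hc' : Nat.Coprime d s' := Nat.coprime_of_squarefree_mul (mem_SD.1 hm1').2.1
      have hk := Nat.dvd_of_mem_divisors hx.1
      have hk' := Nat.dvd_of_mem_divisors hx'.1
      have g1 : Nat.gcd (k * s) d = k := by
        rw [Nat.Coprime.gcd_mul_right_cancel _ hc.symm, Nat.gcd_eq_left hk]
      have g2 : Nat.gcd (k' * s') d = k' := by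
        rw [Nat.Coprime.gcd_mul_right_cancel _ hc'.symm, Nat.gcd_eq_left hk']
      have hkk : k = k' := by rw [← g1, ← g2, h]
      subst hkk
      have hk0 : 0 < k := Nat.pos_of_dvd_of_pos hk hd1.1.1
      have := Nat.eq_of_mul_eq_mul_left hk0 h
      rw [this]
    rw [← Finset.sum_image (f := fun n => 1 / (Nat.totient n : ℝ)) hinj]
    apply Finset.sum_le_sum_of_subset_of_nonneg
    · intro n hn
      obtain ⟨⟨k, m⟩, hx, rfl⟩ := Finset.mem_image.1 hn
      rw [Finset.mem_product] at hx
      obtain ⟨hm1, s, hs⟩ := Finset.mem_filter.1 hx.2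
      simp only at hs hm1 hx ⊢
      subst hs
      rw [Nat.mul_div_cancel_left _ hd1.1.1]
      exact SD_dvd hm1 (Nat.mul_dvd_mul_right (Nat.dvd_of_mem_divisors hx.1) s)
    · intro i _ _; positivity
  have hmu : |(ArithmeticFunction.moebius d : ℝ)| ≤ 1 := by
    have := ArithmeticFunction.abs_moebius_le_one (n := d)
    exact_mod_cast this
  have h0 : 0 ≤ ∑ m ∈ (SD q R).filter (d ∣ ·), 1 / (Nat.totient m : ℝ) := Finset.sum_nonneg fun i _ => by positivity
  unfold lam
  rw [abs_mul, abs_div, abs_mul, abs_of_pos hG, abs_of_pos hd0, abs_of_nonneg h0, div_mul_eq_mul_div, div_le_one hG]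
  calc _ ≤ 1 * d * ∑ m ∈ (SD q R).filter (d ∣ ·), 1 / (Nat.totient m : ℝ) := by gcongr
    _ ≤ _ := by rw [one_mul]; exact key

theorem totient_prod (n : ℕ) : (Nat.totient n : ℝ) = n * ∏ p ∈ n.primeFactors, (1 - (p:ℝ)⁻¹) := by
  have := Nat.totient_eq_mul_prod_factors n
  have h2 : ((Nat.totient n : ℚ) : ℝ) = ((n * ∏ p ∈ n.primeFactors, (1 - (p:ℚ)⁻¹) : ℚ) : ℝ) := by rw [this]
  push_cast at h2
  exact h2

/-- The completely multiplicative function `1/n`. -/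
noncomputable def invHom : ℕ →* ℝ where
  toFun n := (n:ℝ)⁻¹
  map_one' := by simp
  map_mul' := by intro x y; push_cast; rw [mul_inv]

theorem factored_sum (s : Finset ℕ) (hs : ∀ p ∈ s, p.Prime) (T : Finset ℕ) (hT : ∀ n ∈ T, n ∈ Nat.factoredNumbers s) :
    ∑ n ∈ T, (n:ℝ)⁻¹ ≤ ∏ p ∈ s, (1 - (p:ℝ)⁻¹)⁻¹ := by
  have h := (EulerProduct.summable_and_hasSum_factoredNumbers_prod_filter_prime_geometric (f := invHom) (by
    intro p hp
    have : (1:ℝ) < p := by exact_mod_cast hp.one_lt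
    change ‖(p:ℝ)⁻¹‖ < 1
    rw [Real.norm_eq_abs, abs_of_pos (by positivity)]
    exact inv_lt_one_of_one_lt₀ this) s).2
  have e : s.filter Nat.Prime = s := Finset.filter_true_of_mem hs
  rw [e] at h
  have h2 := sum_le_hasSum (T.attach.map ⟨fun x => (⟨x.1, hT x.1 x.2⟩ : Nat.factoredNumbers s), by
    intro x y hxy; simp at hxy; exact hxy⟩) (fun i _ => by
      change 0 ≤ ((i:ℕ):ℝ)⁻¹; positivity) h
  rw [Finset.sum_map] at h2
  change ∑ x ∈ T.attach, ((x.1:ℕ):ℝ)⁻¹ ≤ _ at h2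
  rwa [Finset.sum_attach T (fun n => (n:ℝ)⁻¹)] at h2

/-- Radical of the part of `n` coprime to `q`. -/
def radq (q n : ℕ) : ℕ := ∏ p ∈ n.primeFactors \ q.primeFactors, p

theorem SG_lower (q R : ℕ) (hq : 2 ∣ q) (hq0 : 0 < q) :
    ∑ n ∈ (Finset.Icc 1 R).filter Odd, (n:ℝ)⁻¹ ≤ q / (2 * Nat.totient q) * SG q R := by
  have hmem : ∀ n ∈ (Finset.Icc 1 R).filter Odd, radq q n ∈ SD q R := by
    intro n hn
    simp only [Finset.mem_filter, Finset.mem_Icc] at hn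
    have hdv : radq q n ∣ n := (Finset.prod_dvd_prod_of_subset _ _ _ Finset.sdiff_subset).trans (Nat.prod_primeFactors_dvd n)
    rw [mem_SD]
    refine ⟨⟨Nat.pos_of_dvd_of_pos hdv (by omega), (Nat.le_of_dvd (by omega) hdv).trans hn.1.2⟩, ?_, ?_⟩
    · unfold radq
      apply Finset.squarefree_prod_of_pairwise_isCoprime
      · intro a ha b hb hab
        simp only [Finset.coe_sdiff, Set.mem_sdiff, Finset.mem_coe] at ha hb
        have := (Nat.coprime_primes (Nat.prime_of_mem_primeFactors ha.1) (Nat.prime_of_mem_primeFactors hb.1)).2 hab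
        exact Nat.coprime_iff_isRelPrime.1 this
      · intro i hi
        exact (Nat.prime_of_mem_primeFactors (Finset.mem_sdiff.1 hi).1).prime.squarefree
    · unfold radq
      apply Nat.Coprime.prod_left
      intro p hp
      rw [Finset.mem_sdiff] at hp
      have hpp := Nat.prime_of_mem_primeFactors hp.1
      rw [Nat.Prime.coprime_iff_not_dvd hpp]
      intro h
      exact hp.2 (Nat.mem_primeFactors.2 ⟨hpp, h, by omega⟩)
  rw [← Finset.sum_fiberwise_of_maps_to hmem]
  unfold SG
  rw [Finset.mul_sum]
  apply Finset.sum_le_sum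
  intro m hm
  have hm1 := mem_SD.1 hm
  have hm0 : (0:ℝ) < m := by exact_mod_cast hm1.1.1
  have hdisj : Disjoint m.primeFactors q.primeFactors := hm1.2.2.disjoint_primeFactors
  have h2q : 2 ∈ q.primeFactors := Nat.mem_primeFactors.2 ⟨Nat.prime_two, hq, by omega⟩
  set s := m.primeFactors ∪ q.primeFactors.erase 2 with hs
  have hsp : ∀ p ∈ s, p.Prime := by
    intro p hp
    rw [hs, Finset.mem_union, Finset.mem_erase] at hp
    rcases hp with hp | hp
    · exact Nat.prime_of_mem_primeFactors hp
    · exact Nat.prime_of_mem_primeFactors hp.2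
  have hdvd : ∀ n ∈ ((Finset.Icc 1 R).filter Odd).filter (fun n => radq q n = m), m ∣ n := by
    intro n hn
    rw [← (Finset.mem_filter.1 hn).2]
    exact (Finset.prod_dvd_prod_of_subset _ _ _ Finset.sdiff_subset).trans (Nat.prod_primeFactors_dvd n)
  have h1 : ∑ n ∈ ((Finset.Icc 1 R).filter Odd).filter (fun n => radq q n = m), (n:ℝ)⁻¹ =
      (m:ℝ)⁻¹ * ∑ k ∈ (((Finset.Icc 1 R).filter Odd).filter (fun n => radq q n = m)).image (· / m), (k:ℝ)⁻¹ := by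
    rw [Finset.sum_image, Finset.mul_sum]
    · apply Finset.sum_congr rfl
      intro n hn
      obtain ⟨k, rfl⟩ := hdvd n hn
      rw [Nat.mul_div_cancel_left _ hm1.1.1]; push_cast; rw [mul_inv]
    · intro x hx y hy h
      obtain ⟨k, rfl⟩ := hdvd x hx
      obtain ⟨k', rfl⟩ := hdvd y hy
      simp only [Nat.mul_div_cancel_left _ hm1.1.1] at h
      rw [h]
  rw [h1]
  have h2 := factored_sum s hsp ((((Finset.Icc 1 R).filter Odd).filter (fun n => radq q n = m)).image (· / m)) (by
    intro k hk
    obtain ⟨n, hn, rfl⟩ := Finset.mem_image.1 hk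
    have hmn := hdvd n hn
    simp only [Finset.mem_filter, Finset.mem_Icc] at hn
    apply Nat.mem_factoredNumbers_of_dvd _ (Nat.div_dvd_of_dvd hmn)
    apply Nat.mem_factoredNumbers_of_primeFactors_subset (by omega)
    intro p hp
    rw [hs, Finset.mem_union, Finset.mem_erase]
    by_cases hpq : p ∈ q.primeFactors
    · right
      refine ⟨?_, hpq⟩
      rintro rfl
      have := Nat.dvd_of_mem_primeFactors hp
      have ho := hn.1.2
      rw [← Nat.not_even_iff_odd] at ho
      exact ho (even_iff_two_dvd.2 this)
    · left
      have hpp := Nat.prime_of_mem_primeFactors hp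
      refine Nat.mem_primeFactors.2 ⟨hpp, ?_, by omega⟩
      rw [← hn.2]
      exact Finset.dvd_prod_of_mem (fun p => p) (Finset.mem_sdiff.2 ⟨hp, hpq⟩))
  calc _ ≤ (m:ℝ)⁻¹ * ∏ p ∈ s, (1 - (p:ℝ)⁻¹)⁻¹ := by gcongr
    _ = _ := by
      rw [hs, Finset.prod_union (hdisj.mono_right (Finset.erase_subset _ _)), Finset.prod_inv_distrib, Finset.prod_inv_distrib]
      have e1 := totient_prod m
      have e2 := totient_prod q
      rw [← Finset.mul_prod_erase _ _ h2q] at e2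
      rw [e1, e2]
      have p1 : (0:ℝ) < Nat.totient m := by exact_mod_cast Nat.totient_pos.2 (by omega)
      have p2 : (0:ℝ) < Nat.totient q := by exact_mod_cast Nat.totient_pos.2 (by omega)
      rw [e1] at p1
      rw [e2] at p2
      have q0 : (q:ℝ) ≠ 0 := by positivity
      have n1 : ∏ p ∈ m.primeFactors, (1 - (p:ℝ)⁻¹) ≠ 0 := by intro h; rw [h] at p1; simp at p1
      have n2 : ∏ p ∈ q.primeFactors.erase 2, (1 - (p:ℝ)⁻¹) ≠ 0 := by intro h; rw [h] at p2; simp at p2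
      push_cast
      field_simp
      ring
end PS
end

section
namespace PS

theorem count_cls (q m c x y : ℕ) (hq : 0 < q) (hm : 0 < m) (hqm : q.Coprime m) (hxy : x ≤ y) :
    |((((Finset.Ioc x y).filter (fun n => n ≡ c [MOD q])).filter (fun n => m ∣ n)).card : ℝ) - ((y:ℝ) - x) / (q * m)| ≤ 1 := by
  obtain ⟨v, hv1, hv2⟩ := Nat.chineseRemainder hqm c 0
  have e : ((Finset.Ioc x y).filter (fun n => n ≡ c [MOD q])).filter (fun n => m ∣ n) =
      (Finset.Ioc x y).filter (fun n => n ≡ v [MOD (q * m)]) := by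
    rw [Finset.filter_filter]
    apply Finset.filter_congr
    intro n _
    rw [← Nat.modEq_and_modEq_iff_modEq_mul hqm]
    constructor
    · rintro ⟨h1, h2⟩
      exact ⟨h1.trans hv1.symm, ((Nat.modEq_zero_iff_dvd).2 h2).trans hv2.symm⟩
    · rintro ⟨h1, h2⟩
      exact ⟨h1.trans hv1, (Nat.modEq_zero_iff_dvd).1 (h2.trans hv2)⟩
  rw [e]
  have hr : 0 < q * m := Nat.mul_pos hq hm
  have h := Nat.Ioc_filter_modEq_card x y hr v
  set r := q * m with hrdef
  have hrq : (0:ℚ) < (r:ℚ) := by exact_mod_cast hr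
  have hle : ((x:ℚ) - v) / r ≤ ((y:ℚ) - v) / r := by
    have : (x:ℚ) ≤ y := by exact_mod_cast hxy
    gcongr
  have hfl := Int.floor_le_floor hle
  rw [max_eq_left (by linarith)] at h
  have a1 := Int.floor_le (((y:ℚ) - v) / r)
  have a2 := Int.lt_floor_add_one (((y:ℚ) - v) / r)
  have b1 := Int.floor_le (((x:ℚ) - v) / r)
  have b2 := Int.lt_floor_add_one (((x:ℚ) - v) / r)
  have hQ : ((((Finset.Ioc x y).filter (fun n => n ≡ v [MOD r])).card : ℤ) : ℚ) =
    (⌊((y:ℚ) - v) / r⌋ : ℚ) - ⌊((x:ℚ) - v) / r⌋ := by rw [h]; push_cast; ring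
  have e3 : ((y:ℚ) - x) / r = ((y:ℚ) - v) / r - ((x:ℚ) - v) / r := by ring
  have h5 : |(((Finset.Ioc x y).filter (fun n => n ≡ v [MOD r])).card : ℚ) - ((y:ℚ) - x) / r| ≤ 1 := by
    rw [abs_le]
    push_cast at hQ
    rw [hQ, e3]
    constructor <;> linarith
  have h6 : ((|(((Finset.Ioc x y).filter (fun n => n ≡ v [MOD r])).card : ℚ) - ((y:ℚ) - x) / r| : ℚ) : ℝ) ≤ ((1:ℚ):ℝ) := by
    exact_mod_cast h5
  push_cast at h6
  rw [hrdef] at h6 ⊢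
  push_cast at h6
  exact h6

theorem sieve (q R c x y : ℕ) (hR : 1 ≤ R) (hq : 0 < q) (hxy : x ≤ y) :
    (((Finset.Ioc x y).filter (fun p => p.Prime ∧ R < p ∧ p ≡ c [MOD q])).card : ℝ) ≤
      ((y:ℝ) - x) / (q * SG q R) + ((SD q R).card : ℝ) ^ 2 := by
  set I := (Finset.Ioc x y).filter (fun n => n ≡ c [MOD q]) with hI
  have h1 : (((Finset.Ioc x y).filter (fun p => p.Prime ∧ R < p ∧ p ≡ c [MOD q])).card : ℝ) ≤
      ∑ n ∈ I, (∑ d ∈ SD q R, if d ∣ n then lam q R d else 0) ^ 2 := by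
    have : ∀ p ∈ (Finset.Ioc x y).filter (fun p => p.Prime ∧ R < p ∧ p ≡ c [MOD q]),
        (∑ d ∈ SD q R, if d ∣ p then lam q R d else 0) ^ 2 = 1 := by
      intro p hp
      simp only [Finset.mem_filter] at hp
      have : ∀ d ∈ SD q R, (if d ∣ p then lam q R d else 0) = if d = 1 then 1 else 0 := by
        intro d hd
        have hd1 := mem_SD.1 hd
        by_cases h : d = 1
        · subst h; simp [lam_one hR]
        · rw [if_neg h, if_neg]
          intro hdp
          rcases (Nat.dvd_prime hp.2.1).1 hdp with h' | h'
          · exact h h'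
          · omega
      rw [Finset.sum_congr rfl this, Finset.sum_ite_eq', if_pos (one_mem_SD hR)]; norm_num
    rw [Finset.card_eq_sum_ones, Nat.cast_sum]
    rw [Finset.sum_congr rfl (fun p hp => by rw [Nat.cast_one, ← this p hp] :
      ∀ p ∈ (Finset.Ioc x y).filter (fun p => p.Prime ∧ R < p ∧ p ≡ c [MOD q]), ((1:ℕ):ℝ) = (∑ d ∈ SD q R, if d ∣ p then lam q R d else 0) ^ 2)]
    apply Finset.sum_le_sum_of_subset_of_nonneg
    · intro p hp
      simp only [hI, Finset.mem_filter] at hp ⊢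
      exact ⟨hp.1, hp.2.2.2⟩
    · intro i _ _; positivity
  refine h1.trans ?_
  have h2 : ∑ n ∈ I, (∑ d ∈ SD q R, if d ∣ n then lam q R d else 0) ^ 2 =
      ∑ d ∈ SD q R, ∑ e ∈ SD q R, lam q R d * lam q R e * ((I.filter (fun n => Nat.lcm d e ∣ n)).card : ℝ) := by
    simp_rw [sq, Finset.sum_mul_sum]
    rw [Finset.sum_comm]
    refine Finset.sum_congr rfl fun d hd => ?_
    rw [Finset.sum_comm]
    refine Finset.sum_congr rfl fun e he => ?_
    rw [Finset.card_filter (fun n => Nat.lcm d e ∣ n) I, Nat.cast_sum, Finset.mul_sum]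
    refine Finset.sum_congr rfl fun n hn => ?_
    have : Nat.lcm d e ∣ n ↔ d ∣ n ∧ e ∣ n := ⟨fun h => ⟨(Nat.dvd_lcm_left d e).trans h, (Nat.dvd_lcm_right d e).trans h⟩,
      fun h => Nat.lcm_dvd h.1 h.2⟩
    simp only [this]
    by_cases a1 : d ∣ n <;> by_cases a2 : e ∣ n <;> simp [a1, a2]
  rw [h2]
  have h3 : ∀ d ∈ SD q R, ∀ e ∈ SD q R, lam q R d * lam q R e * ((I.filter (fun n => Nat.lcm d e ∣ n)).card : ℝ) ≤
      ((y:ℝ) - x) / q * (lam q R d * lam q R e / (Nat.lcm d e : ℝ)) + 1 := by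
    intro d hd e he
    have hd1 := mem_SD.1 hd
    have he1 := mem_SD.1 he
    have hl : 0 < Nat.lcm d e := Nat.lcm_pos hd1.1.1 he1.1.1
    have hc : q.Coprime (Nat.lcm d e) := by
      have h5 : Nat.Coprime (d * e) q := Nat.Coprime.mul_left hd1.2.2 he1.2.2
      exact (h5.coprime_dvd_left (Nat.lcm_dvd_mul d e)).symm
    have h4 := count_cls q (Nat.lcm d e) c x y hq hl hc hxy
    have h5 : |lam q R d * lam q R e| ≤ 1 := by
      rw [abs_mul]; exact mul_le_one₀ (lam_abs_le hd) (abs_nonneg _) (lam_abs_le he)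
    have h6 : lam q R d * lam q R e * (((I.filter (fun n => Nat.lcm d e ∣ n)).card : ℝ) - ((y:ℝ) - x) / (q * (Nat.lcm d e : ℝ))) ≤ 1 := by
      refine (le_abs_self _).trans ?_
      rw [abs_mul]
      exact mul_le_one₀ h5 (abs_nonneg _) h4
    have h7 : ((y:ℝ) - x) / q * (lam q R d * lam q R e / (Nat.lcm d e : ℝ)) =
        lam q R d * lam q R e * (((y:ℝ) - x) / (q * (Nat.lcm d e : ℝ))) := by
      rw [div_mul_div_comm, mul_div_assoc']; ring
    rw [h7]; linarith
  have h4 : ∑ d ∈ SD q R, ∑ e ∈ SD q R, lam q R d * lam q R e * ((I.filter (fun n => Nat.lcm d e ∣ n)).card : ℝ) ≤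
      ∑ d ∈ SD q R, ∑ e ∈ SD q R, (((y:ℝ) - x) / q * (lam q R d * lam q R e / (Nat.lcm d e : ℝ)) + 1) :=
    Finset.sum_le_sum fun d hd => Finset.sum_le_sum fun e he => h3 d hd e he
  refine h4.trans (le_of_eq ?_)
  simp_rw [Finset.sum_add_distrib, ← Finset.mul_sum]
  rw [quad_form hR]
  simp only [Finset.sum_const, nsmul_eq_mul, mul_one]
  rw [div_mul_div_comm, mul_one]; ring

theorem SD_card (q R : ℕ) (hq : 2 ∣ q) : ((SD q R).card : ℝ) ≤ ((R:ℝ) + 1) / 2 := by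
  have h : (SD q R).card ≤ (R + 1) / 2 := by
    have : SD q R ⊆ (Finset.range ((R + 1) / 2)).image (fun i => 2 * i + 1) := by
      intro d hd
      have hd1 := mem_SD.1 hd
      have ho : d % 2 = 1 := by
        by_contra h
        have h2 : 2 ∣ d := by omega
        have := Nat.dvd_gcd h2 hq
        rw [hd1.2.2] at this
        omega
      rw [Finset.mem_image]
      exact ⟨d / 2, by rw [Finset.mem_range]; omega, by omega⟩
    calc _ ≤ _ := Finset.card_le_card this
      _ ≤ _ := Finset.card_image_le
      _ = _ := Finset.card_range _
  have h2 : 2 * (SD q R).card ≤ R + 1 := by omega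
  have : (2:ℝ) * (SD q R).card ≤ R + 1 := by exact_mod_cast h2
  linarith

theorem odd_sum_lower (j0 : ℕ) (C : ℝ) (h0 : Real.log (2 * j0 + 3) + C ≤ 2 * ∑ i ∈ Finset.range (j0 + 1), (1:ℝ) / (2 * i + 1))
    (j : ℕ) (hj : j0 ≤ j) : Real.log (2 * j + 3) + C ≤ 2 * ∑ i ∈ Finset.range (j + 1), (1:ℝ) / (2 * i + 1) := by
  induction j, hj using Nat.le_induction with
  | base => exact h0
  | succ j hj ih =>
    rw [Finset.sum_range_succ]
    have h1 : Real.log (2 * ((j + 1 : ℕ) : ℝ) + 3) ≤ Real.log (2 * j + 3) + 2 / (2 * j + 3) := by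
      have hp : (0:ℝ) < 2 * j + 3 := by positivity
      have : (2 * ((j + 1 : ℕ) : ℝ) + 3) = (2 * j + 3) * (1 + 2 / (2 * j + 3)) := by
        push_cast; field_simp; ring
      rw [this, Real.log_mul hp.ne' (by positivity)]
      have := Real.log_le_sub_one_of_pos (show (0:ℝ) < 1 + 2 / (2 * j + 3) by positivity)
      linarith
    have e : (1:ℝ) / (2 * ((j + 1 : ℕ) : ℝ) + 1) = 1 / (2 * j + 3) := by push_cast; congr 1; ring
    rw [e]
    have : 2 * (1 / (2 * (j:ℝ) + 3)) = 2 / (2 * j + 3) := by ring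
    linarith

theorem sum_odd_eq (R : ℕ) (j : ℕ) (h : j = (R - 1) / 2) (hR : 1 ≤ R) :
    ∑ n ∈ (Finset.Icc 1 R).filter Odd, (n:ℝ)⁻¹ = ∑ i ∈ Finset.range (j + 1), (1:ℝ) / (2 * i + 1) := by
  have e : (Finset.Icc 1 R).filter Odd = (Finset.range (j + 1)).image (fun i => 2 * i + 1) := by
    ext n
    simp only [Finset.mem_filter, Finset.mem_Icc, Finset.mem_image, Finset.mem_range, Nat.odd_iff]
    constructor
    · rintro ⟨h1, h2⟩; exact ⟨n / 2, by omega, by omega⟩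
    · rintro ⟨i, hi, rfl⟩; omega
  rw [e, Finset.sum_image (by intro a _ b _ h; simpa using h)]
  refine Finset.sum_congr rfl fun i _ => ?_
  push_cast; rw [one_div]

/-- Lower bound of the sieve denominator. -/
theorem SG_log (q : ℕ) (r : ℝ) (hq : 2 ∣ q) (hq0 : 0 < q) (j0 : ℕ) (C : ℝ)
    (h0 : Real.log (2 * j0 + 3) + C ≤ 2 * ∑ i ∈ Finset.range (j0 + 1), (1:ℝ) / (2 * i + 1))
    (hr : (2 * j0 + 1 : ℝ) ≤ r) : Nat.totient q * (Real.log r + C) ≤ q * SG q ⌊r⌋₊ := by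
  have hR : 2 * j0 + 1 ≤ ⌊r⌋₊ := Nat.le_floor (by push_cast; exact hr)
  have hlt := Nat.lt_floor_add_one r
  have h1 := SG_lower q ⌊r⌋₊ hq hq0
  generalize ⌊r⌋₊ = R at *
  rw [sum_odd_eq R _ rfl (by omega)] at h1
  have h2 := odd_sum_lower j0 C h0 ((R - 1) / 2) (by omega)
  have h3 : r ≤ 2 * (((R - 1) / 2 : ℕ) : ℝ) + 3 := by
    have : R + 1 ≤ 2 * ((R - 1) / 2) + 3 := by omega
    have : (R:ℝ) + 1 ≤ 2 * (((R - 1) / 2 : ℕ) : ℝ) + 3 := by exact_mod_cast this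
    linarith
  have hr0 : 0 < r := by
    have : (0:ℝ) ≤ j0 := by positivity
    linarith
  have h4 := Real.log_le_log hr0 h3
  have hphi : (0:ℝ) < Nat.totient q := by exact_mod_cast Nat.totient_pos.2 hq0
  have h5 : Real.log r + C ≤ q / Nat.totient q * SG q R := by
    have : (q:ℝ) / Nat.totient q * SG q R = 2 * (q / (2 * Nat.totient q) * SG q R) := by field_simp
    rw [this]; linarith
  calc Nat.totient q * (Real.log r + C) ≤ Nat.totient q * (q / Nat.totient q * SG q R) := by gcongr
    _ = _ := by field_simp
end PS
end

section
namespace PS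

theorem nonrep_finite (a b : ℕ) (ha : 3 ≤ a) (hab : a < b) (h : Nat.Coprime a b) :
    {p : ℕ | p.Prime ∧ ¬ ∃ u v : ℕ, p = a * u + b * v}.Finite := by
  apply (Set.finite_Iic (a * b - a - b)).subset
  rintro p ⟨_, hp⟩
  by_contra hlt
  have := (frobeniusNumber_iff.1 (frobeniusNumber_pair h (by omega) (by omega))).2 p (by simpa using hlt)
  rw [AddSubmonoid.mem_closure_pair] at this
  obtain ⟨u, v, e⟩ := this
  apply hp
  refine ⟨u, v, ?_⟩
  rw [← e]; simp [mul_comm]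

/-- residues counted by the sieve -/
def cops (a τ : ℕ) : Finset ℕ := (Finset.range τ).filter (fun v => Nat.Coprime v a)

theorem red_count (a b τ : ℕ) (ha : 3 ≤ a) (hab : a < b) (h : Nat.Coprime a b) :
    Nat.primeCounting (τ * b) ≤ piStar a b + 2 +
      ∑ v ∈ cops a τ, ((Finset.Ioc (b * v) (τ * b)).filter (fun p => p.Prime ∧ p ≡ b * v [MOD a])).card := by
  classical
  have e1 : Nat.primeCounting (τ * b) = ((Finset.range (τ * b + 1)).filter Nat.Prime).card := by
    rw [Nat.primeCounting, Nat.primeCounting', Nat.count_eq_card_filter_range]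
  have hfin := nonrep_finite a b ha hab h
  have e2 : piStar a b = hfin.toFinset.card := by
    unfold piStar
    exact Set.ncard_eq_toFinset_card _ hfin
  rw [e1, e2]
  have sub : (Finset.range (τ * b + 1)).filter Nat.Prime ⊆ (hfin.toFinset ∪ {a, b}) ∪
      (cops a τ).biUnion (fun v => (Finset.Ioc (b * v) (τ * b)).filter (fun p => p.Prime ∧ p ≡ b * v [MOD a])) := by
    intro p hp
    rw [Finset.mem_filter, Finset.mem_range] at hp
    obtain ⟨hpl, hpp⟩ := hp
    by_cases hr : ∃ u v : ℕ, p = a * u + b * v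
    · obtain ⟨u, v, e⟩ := hr
      rw [Finset.mem_union]
      by_cases hv : v = 0
      · left
        subst hv
        have : a ∣ p := ⟨u, by simpa using e⟩
        rcases (Nat.dvd_prime hpp).1 this with h1 | h1
        · omega
        · simp [h1]
      by_cases hu : u = 0
      · left
        subst hu
        have : b ∣ p := ⟨v, by simpa using e⟩
        rcases (Nat.dvd_prime hpp).1 this with h1 | h1
        · omega
        · simp [h1]
      right
      rw [Finset.mem_biUnion]
      have hpos : 0 < a * u := Nat.mul_pos (by omega) (by omega)
      refine ⟨v, ?_, ?_⟩
      · unfold cops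
        rw [Finset.mem_filter, Finset.mem_range]
        constructor
        · by_contra hc
          have : b * τ ≤ b * v := Nat.mul_le_mul_left _ (by omega)
          rw [mul_comm] at this
          omega
        · by_contra hc
          obtain ⟨g, hg, hgv, hga⟩ := Nat.Prime.not_coprime_iff_dvd.1 hc
          have hgp : g ∣ p := by rw [e]; exact dvd_add (hga.mul_right _) (hgv.mul_left _)
          have hgeq := (Nat.prime_dvd_prime_iff_eq hg hpp).1 hgp
          have h1 : g ≤ a := Nat.le_of_dvd (by omega) hga
          have h2 : a * 1 ≤ a * u := Nat.mul_le_mul_left _ (by omega)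
          have h3 : b * 1 ≤ b * v := Nat.mul_le_mul_left _ (by omega)
          omega
      · rw [Finset.mem_filter, Finset.mem_Ioc]
        refine ⟨⟨by omega, by omega⟩, hpp, ?_⟩
        rw [e]
        unfold Nat.ModEq
        simp
    · rw [Finset.mem_union, Finset.mem_union]
      left; left
      rw [Set.Finite.mem_toFinset]
      exact ⟨hpp, hr⟩
  calc _ ≤ _ := Finset.card_le_card sub
    _ ≤ _ := Finset.card_union_le _ _
    _ ≤ _ := Nat.add_le_add ((Finset.card_union_le _ _).trans (Nat.add_le_add_left Finset.card_le_two _)) Finset.card_biUnion_le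

theorem class_bound (a b τ v : ℕ) (ha : 3 ≤ a) (hab : a < b) (hv : 1 ≤ v) (hvt : v ≤ τ) (r : ℝ) (j0 : ℕ) (C : ℝ)
    (h0 : Real.log (2 * j0 + 3) + C ≤ 2 * ∑ i ∈ Finset.range (j0 + 1), (1:ℝ) / (2 * i + 1))
    (hr : (2 * j0 + 1 : ℝ) ≤ r) (hrb : r ≤ b) (hG : 0 < Real.log r + C) :
    (((Finset.Ioc (b * v) (τ * b)).filter (fun p => p.Prime ∧ p ≡ b * v [MOD a])).card : ℝ) ≤
      ((τ:ℝ) - v) * b / (Nat.totient a * (Real.log r + C)) + ((r + 1) / 2) ^ 2 := by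
  have hj : (0:ℝ) ≤ j0 := by positivity
  have hR : 1 ≤ ⌊r⌋₊ := by rw [Nat.one_le_floor_iff]; linarith
  have hRb : ⌊r⌋₊ ≤ b := by
    have := Nat.floor_le_floor hrb
    simpa using this
  have key : ∃ q c : ℕ, 2 ∣ q ∧ 0 < q ∧ Nat.totient q = Nat.totient a ∧
      ∀ p, p % 2 = 1 → p ≡ b * v [MOD a] → p ≡ c [MOD q] := by
    rcases Nat.even_or_odd a with he | ho
    · exact ⟨a, b * v, he.two_dvd, by omega, rfl, fun p _ hp => hp⟩
    · have cop : Nat.Coprime 2 a := ho.coprime_two_left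
      obtain ⟨c, hc1, hc2⟩ := Nat.chineseRemainder cop 1 (b * v)
      refine ⟨2 * a, c, ⟨a, rfl⟩, by omega, ?_, ?_⟩
      · rw [Nat.totient_mul cop]; simp
      · intro p hp1 hp2
        rw [← Nat.modEq_and_modEq_iff_modEq_mul cop]
        exact ⟨(show p ≡ 1 [MOD 2] from hp1).trans hc1.symm, hp2.trans hc2.symm⟩
  obtain ⟨q, c, hq2, hq0, hqt, hqc⟩ := key
  have hxy : b * v ≤ τ * b := by rw [mul_comm]; exact Nat.mul_le_mul_right _ hvt
  have hbv : b ≤ b * v := Nat.le_mul_of_pos_right _ hv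
  have s := sieve q ⌊r⌋₊ c (b * v) (τ * b) hR hq0 hxy
  have hsub : (((Finset.Ioc (b * v) (τ * b)).filter (fun p => p.Prime ∧ p ≡ b * v [MOD a])).card : ℝ) ≤
      (((Finset.Ioc (b * v) (τ * b)).filter (fun p => p.Prime ∧ ⌊r⌋₊ < p ∧ p ≡ c [MOD q])).card : ℝ) := by
    norm_cast
    apply Finset.card_le_card
    intro p
    simp only [Finset.mem_filter, Finset.mem_Ioc]
    rintro ⟨⟨h1, h2⟩, h3, h4⟩
    refine ⟨⟨h1, h2⟩, h3, by omega, hqc p ?_ h4⟩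
    rcases h3.eq_two_or_odd with h5 | h5
    · omega
    · exact h5
  have g := SG_log q r hq2 hq0 j0 C h0 hr
  have hqp : (0:ℝ) < q := by exact_mod_cast hq0
  have htp : (0:ℝ) < Nat.totient a := by exact_mod_cast Nat.totient_pos.2 (by omega)
  rw [hqt] at g
  have hd := SD_card q ⌊r⌋₊ hq2
  have hfl : (⌊r⌋₊:ℝ) ≤ r := Nat.floor_le (by linarith)
  have t1 : (((τ * b : ℕ):ℝ) - ((b * v : ℕ):ℝ)) / (q * SG q ⌊r⌋₊) ≤ ((τ:ℝ) - v) * b / (Nat.totient a * (Real.log r + C)) := by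
    have hvt' : (v:ℝ) ≤ τ := by exact_mod_cast hvt
    have : (((τ * b : ℕ):ℝ) - ((b * v : ℕ):ℝ)) = ((τ:ℝ) - v) * b := by push_cast; ring
    rw [this]
    apply div_le_div_of_nonneg_left _ (by positivity) g
    exact mul_nonneg (by linarith) (by positivity)
  have t2 : ((SD q ⌊r⌋₊).card : ℝ) ^ 2 ≤ ((r + 1) / 2) ^ 2 := by
    apply pow_le_pow_left₀ (by positivity)
    linarith
  linarith

/-- the weight sum -/
def Wt (a τ : ℕ) : ℕ := ∑ v ∈ cops a τ, (τ - v)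

theorem lower_main (a b τ : ℕ) (ha : 3 ≤ a) (hab : a < b) (h : Nat.Coprime a b) (r : ℝ) (j0 : ℕ) (C : ℝ)
    (h0 : Real.log (2 * j0 + 3) + C ≤ 2 * ∑ i ∈ Finset.range (j0 + 1), (1:ℝ) / (2 * i + 1))
    (hr : (2 * j0 + 1 : ℝ) ≤ r) (hrb : r ≤ b) (hG : 0 < Real.log r + C) :
    (Nat.primeCounting (τ * b) : ℝ) - 2 - Wt a τ * b / (Nat.totient a * (Real.log r + C)) -
      (cops a τ).card * ((r + 1) / 2) ^ 2 ≤ piStar a b := by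
  have h1 : (Nat.primeCounting (τ * b) : ℝ) ≤ piStar a b + 2 +
      ∑ v ∈ cops a τ, (((Finset.Ioc (b * v) (τ * b)).filter (fun p => p.Prime ∧ p ≡ b * v [MOD a])).card : ℝ) := by
    exact_mod_cast red_count a b τ ha hab h
  have h2 : ∑ v ∈ cops a τ, (((Finset.Ioc (b * v) (τ * b)).filter (fun p => p.Prime ∧ p ≡ b * v [MOD a])).card : ℝ) ≤
      ∑ v ∈ cops a τ, (((τ - v : ℕ):ℝ) * b / (Nat.totient a * (Real.log r + C)) + ((r + 1) / 2) ^ 2) := by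
    apply Finset.sum_le_sum
    intro v hv
    unfold cops at hv
    rw [Finset.mem_filter, Finset.mem_range] at hv
    have hv1 : 1 ≤ v := by
      rcases Nat.eq_zero_or_pos v with hz | hz
      · subst hz
        have := hv.2
        simp at this
        omega
      · exact hz
    have := class_bound a b τ v ha hab hv1 hv.1.le r j0 C h0 hr hrb hG
    rwa [Nat.cast_sub hv.1.le]
  have h3 : ∑ v ∈ cops a τ, (((τ - v : ℕ):ℝ) * b / (Nat.totient a * (Real.log r + C)) + ((r + 1) / 2) ^ 2) =
      Wt a τ * b / (Nat.totient a * (Real.log r + C)) + (cops a τ).card * ((r + 1) / 2) ^ 2 := by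
    rw [Finset.sum_add_distrib, Finset.sum_const, nsmul_eq_mul]
    congr 1
    unfold Wt
    rw [← Finset.sum_div, ← Finset.sum_mul]
    push_cast
    rfl
  linarith
end PS
end

section
namespace PS

theorem exp_bd : Real.exp (-(3/2)) < 0.22314 := by
  have h1 := Real.exp_one_gt_d9
  have h2 : Real.exp (3/2) ^ 2 = Real.exp 1 ^ 3 := by
    rw [← Real.exp_nat_mul, ← Real.exp_nat_mul]; norm_num
  have h3 : (4.48156:ℝ) < Real.exp (3/2) := by
    apply lt_of_pow_lt_pow_left₀ 2 (Real.exp_pos _).le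
    rw [h2]
    calc (4.48156:ℝ)^2 < 2.7182818283 ^ 3 := by norm_num
      _ ≤ _ := pow_le_pow_left₀ (by norm_num) h1.le 3
  rw [Real.exp_neg, inv_lt_comm₀ (Real.exp_pos _) (by norm_num)]
  exact lt_trans (by norm_num) h3

theorem N_eq (δ : ℝ) (a : ℕ) (ha : 3 ≤ a) (hδ : 0 < δ) : N δ a = (cops a (⌊δ * a⌋₊ + 1)).card := by
  unfold N cops
  have : {v : ℕ | 1 ≤ v ∧ (v : ℝ) ≤ δ * (a : ℝ) ∧ Nat.gcd v a = 1} =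
      ((Finset.range (⌊δ * a⌋₊ + 1)).filter (fun v => Nat.Coprime v a) : Finset ℕ) := by
    ext v
    simp only [Set.mem_setOf_eq, Finset.coe_filter, Finset.mem_range, Nat.lt_succ_iff]
    rw [Nat.le_floor_iff (by positivity)]
    constructor
    · rintro ⟨_, h2, h3⟩; exact ⟨h2, h3⟩
    · rintro ⟨h2, h3⟩
      refine ⟨?_, h2, h3⟩
      rcases Nat.eq_zero_or_pos v with hz | hz
      · subst hz; simp at h3; omega
      · exact hz
  rw [this, Set.ncard_coe_finset]

theorem upper_main (a b : ℕ) (ha : 3 ≤ a) (hab : a < b) (δ : ℝ) (hδ : 0 < δ)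
    (hδ' : δ < Real.exp (-(3 / 2))) (h17 : 17 ≤ δ * (S a b : ℝ)) (haS : (a : ℝ) < δ * (S a b : ℝ)) (r : ℝ)
    (hr : r ≤ 1 + Real.log a / (Real.log b - 1.5 - 1 / a)) :
    (1 - 2 / (Nat.totient a : ℝ) * (N δ a : ℝ) * (1 - Real.log a / Real.log (δ * (S a b : ℝ)))⁻¹ -
        Real.log (δ * (S a b : ℝ)) / (δ * (S a b : ℝ))) * δ * (Nat.primeCounting (S a b) : ℝ) <
    max 0 (1 - 2 * r * N δ a / Nat.totient a) * (δ * a) * (1.0877 * (1 - 1 / a)) * b /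
      (Real.log ((a - 1) * b) - 1.15) := by
  have e1 := exp_bd
  have hS77 : 76 < S a b := by
    by_contra hc
    have : (S a b : ℝ) ≤ 76 := by exact_mod_cast not_lt.1 hc
    nlinarith
  have haR : (3:ℝ) ≤ a := by exact_mod_cast ha
  have hbR : (4:ℝ) ≤ b := by exact_mod_cast (by omega : 4 ≤ b)
  have hSle : S a b ≤ (a - 1) * b := by
    unfold S
    rw [Nat.sub_mul]; omega
  have hSleR : (S a b : ℝ) ≤ ((a:ℝ) - 1) * b := by
    have : ((S a b : ℕ):ℝ) ≤ (((a - 1) * b : ℕ):ℝ) := by exact_mod_cast hSle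
    rwa [Nat.cast_mul, Nat.cast_sub (by omega), Nat.cast_one] at this
  set s : ℝ := (S a b : ℝ) with hs
  have hs77 : (77:ℝ) ≤ s := by rw [hs]; exact_mod_cast hS77
  set L := Real.log (δ * s) with hL
  have hlam : 0 < Real.log a := Real.log_pos (by linarith)
  have hLl : Real.log a < L := Real.log_lt_log (by linarith) haS
  have hLle : L < Real.log s - 1.5 := by
    rw [hL, Real.log_mul hδ.ne' (by linarith)]
    have : Real.log δ < -(3/2) := by rwa [Real.log_lt_iff_lt_exp hδ]
    linarith
  have hl4 : 4 < Real.log s := by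
    rw [Real.lt_log_iff_exp_lt (by linarith)]
    have h1 := Real.exp_one_lt_d9
    have : Real.exp 4 = Real.exp 1 ^ 4 := by rw [← Real.exp_nat_mul]; norm_num
    rw [this]
    calc Real.exp 1 ^ 4 ≤ 2.7182818286 ^ 4 := pow_le_pow_left₀ (Real.exp_pos _).le h1.le 4
      _ < 77 := by norm_num
      _ ≤ s := hs77
  have hm : 0 < ((a:ℝ) - 1) * b := by nlinarith
  have hsl : Real.log s ≤ Real.log ((a - 1) * b) := Real.log_le_log (by linarith) hSleR
  have hl : Real.log (((a:ℝ) - 1) * b) ≤ Real.log a + Real.log b - 1 / a := by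
    have : ((a:ℝ) - 1) * b = a * b * (1 - 1 / a) := by field_simp
    have h1a : 1 / (a:ℝ) ≤ 1 / 3 := one_div_le_one_div_of_le (by norm_num) haR
    rw [this, Real.log_mul (by positivity) (by linarith), Real.log_mul (by positivity) (by positivity)]
    have := Real.log_le_sub_one_of_pos (show 0 < 1 - 1 / (a:ℝ) by linarith)
    linarith
  have hrt : r ≤ (1 - Real.log a / L)⁻¹ := by
    have h1 : (1 - Real.log a / L)⁻¹ = 1 + Real.log a / (L - Real.log a) := by
      have : L - Real.log a ≠ 0 := by linarith
      have : L ≠ 0 := by linarith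
      field_simp
      ring
    rw [h1]
    refine hr.trans ?_
    have : Real.log a / (Real.log b - 1.5 - 1 / a) ≤ Real.log a / (L - Real.log a) :=
      div_le_div_of_nonneg_left hlam.le (by linarith) (by linarith)
    linarith
  have hφ : (0:ℝ) < Nat.totient a := by exact_mod_cast Nat.totient_pos.2 (by omega)
  have hπ : (0:ℝ) < Nat.primeCounting (S a b) := by
    have h2 : Nat.primeCounting 2 ≤ Nat.primeCounting (S a b) := Nat.monotone_primeCounting (by omega)
    have h3 : Nat.primeCounting 2 = 1 := by decide
    exact_mod_cast (by omega : 0 < Nat.primeCounting (S a b))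
  have hπu := pi_upper (S a b) (by omega)
  rw [← hs] at hπu
  have hLs : 0 < L / (δ * s) := div_pos (by linarith) (by linarith)
  have step1 : (1 - 2 / (Nat.totient a : ℝ) * (N δ a : ℝ) * (1 - Real.log a / L)⁻¹ - L / (δ * s)) <
      max 0 (1 - 2 * r * N δ a / Nat.totient a) := by
    refine lt_of_lt_of_le ?_ (le_max_right _ _)
    have : 2 * r * N δ a / Nat.totient a = 2 / (Nat.totient a : ℝ) * (N δ a : ℝ) * r := by ring
    rw [this]
    have : 2 / (Nat.totient a : ℝ) * (N δ a : ℝ) * r ≤ 2 / (Nat.totient a : ℝ) * (N δ a : ℝ) * (1 - Real.log a / L)⁻¹ :=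
      mul_le_mul_of_nonneg_left hrt (by positivity)
    linarith
  have step2 : (Nat.primeCounting (S a b) : ℝ) ≤ 1.0877 * ((a - 1) * b) / (Real.log ((a - 1) * b) - 1.15) := by
    rw [le_div_iff₀ (by linarith)]
    -- π * (log m - 1.15) = π*(log s - 1.15) + π * log (m/s)
    have hlog : Real.log ((a - 1) * b) - Real.log s ≤ ((a:ℝ) - 1) * b / s - 1 := by
      rw [← Real.log_div hm.ne' (by linarith)]
      exact Real.log_le_sub_one_of_pos (div_pos hm (by linarith))
    have hq : 0 ≤ ((a:ℝ) - 1) * b / s - 1 := by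
      rw [sub_nonneg, le_div_iff₀ (by linarith)]; linarith
    have h5 : (Nat.primeCounting (S a b) : ℝ) ≤ 1.0877 * s := by nlinarith
    have h6 : (1.0877:ℝ) * ((a - 1) * b) = 1.0877 * s + 1.0877 * s * (((a:ℝ) - 1) * b / s - 1) := by
      have : s ≠ 0 := by linarith
      field_simp; ring
    rw [h6]
    have h7 : (Nat.primeCounting (S a b) : ℝ) * (Real.log ((a - 1) * b) - Real.log s) ≤ 1.0877 * s * (((a:ℝ) - 1) * b / s - 1) :=
      mul_le_mul h5 hlog (by linarith) (by linarith)
    linarith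
  calc _ < max 0 (1 - 2 * r * N δ a / Nat.totient a) * δ * (Nat.primeCounting (S a b) : ℝ) := by
        apply mul_lt_mul_of_pos_right _ hπ
        exact mul_lt_mul_of_pos_right step1 hδ
    _ ≤ max 0 (1 - 2 * r * N δ a / Nat.totient a) * δ * (1.0877 * ((a - 1) * b) / (Real.log ((a - 1) * b) - 1.15)) := by
        apply mul_le_mul_of_nonneg_left step2
        exact mul_nonneg (le_max_left _ _) hδ.le
    _ = _ := by
        field_simp
end PS
end

section
namespace PS

theorem yexp_anti (y0 y : ℝ) (h0 : 2 ≤ y0) (h : y0 ≤ y) : y * Real.exp (-(y / 2)) ≤ y0 * Real.exp (-(y0 / 2)) := by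
  have h1 : y ≤ y0 * Real.exp ((y - y0) / 2) := by
    have := Real.add_one_le_exp ((y - y0) / 2)
    nlinarith
  calc y * Real.exp (-(y / 2)) ≤ y0 * Real.exp ((y - y0) / 2) * Real.exp (-(y / 2)) :=
        mul_le_mul_of_nonneg_right h1 (Real.exp_pos _).le
    _ = _ := by rw [mul_assoc, ← Real.exp_add]; congr 2; ring

/-- validity of a constant `C` beyond `y0`. -/
def CV (y0 C : ℝ) : Prop := 2 ≤ y0 ∧ ∃ j0 : ℕ, Real.log (2 * j0 + 3) + C ≤ 2 * ∑ i ∈ Finset.range (j0 + 1), (1:ℝ) / (2 * i + 1) ∧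
  (2 * j0 + 1 : ℝ) * (y0 * Real.exp (-(y0 / 2))) ≤ 1

set_option maxHeartbeats 1000000 in
theorem core (a b : ℕ) (ha : 3 ≤ a) (hab : a < b) (h : Nat.Coprime a b) (δ : ℝ) (hδ : 0 < δ)
    (hδ' : δ < Real.exp (-(3 / 2))) (h17 : 17 ≤ δ * (S a b : ℝ)) (haS : (a : ℝ) < δ * (S a b : ℝ))
    (y0 C E c g1 g2 V r : ℝ) (A τ : ℕ) (hb : 19 ≤ b) (hτ : 1 ≤ τ) (hA : A ≤ coefA (τ * b))
    (hy : y0 ≤ Real.log b) (hC : CV y0 C) (hE : y0 * Real.exp (-(y0 / 2)) ≤ E)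
    (hu : 0 < Real.log ((a - 1) * b) - 1.15) (hc : Real.log ((a - 1) * b) - 1.15 ≤ c * Real.log b)
    (hg1 : g1 * (Real.log τ + Real.log b - 1) ≤ Real.log ((a - 1) * b) - 1.15)
    (hG : 0 < Real.log b / 2 - Real.log (Real.log b) + C)
    (hg2 : Real.log ((a - 1) * b) - 1.15 ≤ g2 * (Real.log b / 2 - Real.log (Real.log b) + C))
    (hr : r ≤ 1 + Real.log a / (Real.log b - 1.5 - 1 / a))
    (hV : V ≤ A / 1000 * τ * g1 - Wt a τ / Nat.totient a * g2 - c / y0 * ((cops a τ).card * (1 + E) ^ 2 / 4 + 2 * E ^ 2))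
    (hM : max 0 (1 - 2 * r * N δ a / Nat.totient a) * (δ * a) * (1.0877 * (1 - 1 / a)) ≤ V) :
    (1 - 2 / (Nat.totient a : ℝ) * (N δ a : ℝ) * (1 - Real.log a / Real.log (δ * (S a b : ℝ)))⁻¹ -
        Real.log (δ * (S a b : ℝ)) / (δ * (S a b : ℝ))) * δ * (Nat.primeCounting (S a b) : ℝ) < (piStar a b : ℝ) := by
  have up := upper_main a b ha hab δ hδ hδ' h17 haS r hr
  refine lt_of_lt_of_le up ?_
  obtain ⟨hy2, j0, hj1, hj2⟩ := hC
  set y := Real.log b with hyd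
  have hb0 : (0:ℝ) < b := by exact_mod_cast (by omega : 0 < b)
  have hby : (b:ℝ) = Real.exp y := (Real.exp_log hb0).symm
  have hy0 : 0 < y := by linarith
  set u := Real.log (((a:ℝ) - 1) * b) - 1.15 with hud
  set ρ := Real.exp (y / 2) / y with hρ
  have hanti := yexp_anti y0 y hy2 hy
  have hee : Real.exp (y / 2) * Real.exp (-(y / 2)) = 1 := by rw [← Real.exp_add]; simp
  have hρ1 : (2 * j0 + 1 : ℝ) ≤ ρ := by
    rw [hρ, le_div_iff₀ hy0]
    have : (2 * j0 + 1 : ℝ) * (y * Real.exp (-(y / 2))) ≤ 1 := le_trans (mul_le_mul_of_nonneg_left hanti (by positivity)) hj2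
    calc (2 * j0 + 1 : ℝ) * y = (2 * j0 + 1 : ℝ) * (y * Real.exp (-(y / 2))) * Real.exp (y / 2) := by
          linear_combination (-(2 * (j0:ℝ) + 1) * y) * hee
      _ ≤ 1 * Real.exp (y / 2) := mul_le_mul_of_nonneg_right this (Real.exp_pos _).le
      _ = _ := one_mul _
  have hρb : ρ ≤ b := by
    rw [hρ, hby]
    calc Real.exp (y / 2) / y ≤ Real.exp (y / 2) := div_le_self (Real.exp_pos _).le (by linarith)
      _ ≤ _ := Real.exp_le_exp.2 (by linarith)
  have hlogρ : Real.log ρ = y / 2 - Real.log y := by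
    rw [hρ, Real.log_div (Real.exp_pos _).ne' hy0.ne', Real.log_exp]
  have low := lower_main a b τ ha hab h ρ j0 C hj1 hρ1 hρb (by rw [hlogρ]; exact hG)
  rw [hlogρ] at low
  refine le_trans ?_ low
  set G := y / 2 - Real.log y + C with hGd
  have hτ0 : (1:ℝ) ≤ τ := by exact_mod_cast hτ
  have hτb : 19 ≤ τ * b := le_trans hb (Nat.le_mul_of_pos_left _ hτ)
  have hpl := pi_lower (τ * b) hτb
  have hlτ : 0 ≤ Real.log τ := Real.log_nonneg hτ0
  have hlog : Real.log ((τ * b : ℕ):ℝ) = Real.log τ + y := by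
    push_cast; rw [Real.log_mul (by linarith) hb0.ne']
  rw [hlog] at hpl
  have hA' : (A:ℝ) ≤ coefA (τ * b) := by exact_mod_cast hA
  have hp1 : (A:ℝ) / 1000 * (τ * b) ≤ Nat.primeCounting (τ * b) * (Real.log τ + y - 1) := by
    refine le_trans ?_ hpl
    push_cast
    apply mul_le_mul_of_nonneg_right _ (by positivity)
    linarith
  have hden : 0 < Real.log τ + y - 1 := by linarith
  have hφ : (0:ℝ) < Nat.totient a := by exact_mod_cast Nat.totient_pos.2 (by omega)
  -- term 1
  have T1 : (A:ℝ) / 1000 * τ * g1 * b ≤ u * Nat.primeCounting (τ * b) := by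
    have hAτ : 0 ≤ (A:ℝ) / 1000 * (τ * b) := by positivity
    have e1 : (A:ℝ) / 1000 * (τ * b) * (g1 * (Real.log τ + y - 1)) ≤ Nat.primeCounting (τ * b) * (Real.log τ + y - 1) * u := by
      calc _ ≤ (A:ℝ) / 1000 * (τ * b) * u := mul_le_mul_of_nonneg_left hg1 hAτ
        _ ≤ _ := mul_le_mul_of_nonneg_right hp1 hu.le
    refine le_of_mul_le_mul_right ?_ hden
    calc _ = (A:ℝ) / 1000 * (τ * b) * (g1 * (Real.log τ + y - 1)) := by ring
      _ ≤ _ := e1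
      _ = _ := by ring
  have T2 : u * (Wt a τ * b / (Nat.totient a * G)) ≤ Wt a τ / Nat.totient a * g2 * b := by
    have : u * (Wt a τ * b / (Nat.totient a * G)) = Wt a τ / Nat.totient a * b * (u / G) := by
      field_simp
    rw [this]
    have h2 : u / G ≤ g2 := by rw [div_le_iff₀ hG]; exact hg2
    have h3 : (0:ℝ) ≤ Wt a τ / Nat.totient a * b := by positivity
    calc _ ≤ (Wt a τ / Nat.totient a * b : ℝ) * g2 := mul_le_mul_of_nonneg_left h2 h3
      _ = _ := by ring
  set X := Real.exp (-(y / 2)) with hX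
  have hXp : 0 < X := Real.exp_pos _
  have hyX : y * X ≤ E := hanti.trans hE
  have hbX : (b:ℝ) * X ^ 2 = 1 := by
    rw [hby, hX, ← Real.exp_nat_mul, ← Real.exp_add]; simp; ring
  have hy00 : 0 < y0 := by linarith
  have hEp : 0 < E := lt_of_lt_of_le (by positivity) hyX
  have hcp : 0 < c := by
    by_contra hc0
    have := mul_nonpos_of_nonpos_of_nonneg (not_lt.1 hc0) hy0.le
    linarith
  have hcy : c / y ≤ c / y0 := div_le_div_of_nonneg_left hcp.le hy00 hy
  have hXX : Real.exp (y / 2) = b * X := by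
    rw [hby, hX, ← Real.exp_add]; congr 1; ring
  have T3 : u * ((ρ + 1) / 2) ^ 2 ≤ c / y0 * ((1 + E) ^ 2 / 4) * b := by
    have e1 : ((ρ + 1) / 2) ^ 2 = b * ((1 + y * X) ^ 2 / 4) / y ^ 2 := by
      rw [hρ, hXX]
      field_simp
      have : (b * X + y) ^ 2 = b * (b * X ^ 2) + 2 * b * X * y + y ^ 2 * (b * X ^ 2) + y ^ 2 * (1 - b * X ^ 2) := by ring
      rw [this, hbX]
      linear_combination (-4 * y ^ 2) * hbX
    rw [e1]
    calc u * (b * ((1 + y * X) ^ 2 / 4) / y ^ 2) ≤ (c * y) * (b * ((1 + E) ^ 2 / 4) / y ^ 2) := by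
          apply mul_le_mul hc _ (by positivity) (by positivity)
          gcongr
      _ = c / y * ((1 + E) ^ 2 / 4) * b := by field_simp
      _ ≤ _ := by gcongr
  have T4 : u * 2 ≤ c / y0 * (2 * E ^ 2) * b := by
    calc u * 2 ≤ c * y * 2 := by linarith
      _ = c / y * (2 * (y * X) ^ 2) * b := by
          field_simp
          linear_combination (-1) * hbX
      _ ≤ _ := by
          have h1 : (y * X) ^ 2 ≤ E ^ 2 := pow_le_pow_left₀ (by positivity) hyX 2
          apply mul_le_mul_of_nonneg_right _ hb0.le
          exact mul_le_mul hcy (by linarith) (by positivity) (by positivity)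
  have hn : (0:ℝ) ≤ (cops a τ).card := Nat.cast_nonneg _
  rw [div_le_iff₀ hu]
  have hM' := mul_le_mul_of_nonneg_right (hM.trans hV) hb0.le
  have T3' := mul_le_mul_of_nonneg_left T3 hn
  refine hM'.trans ?_
  linarith
end PS
end

section
namespace PS

structure Sl where
  m0 : ℕ
  m1 : ℕ
  ly : ℕ
  E : ℕ
  blo : ℕ

def CC (m : ℕ) : ℕ := cond (Nat.blt m 46) 900000 (cond (Nat.blt m 58) 1057000 1120000)

def InSl (s : Sl) (y : ℝ) : Prop := (s.m0 : ℝ) / 8 ≤ y ∧ (s.m1 = 0 ∨ y ≤ (s.m1 : ℝ) / 8)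

def allSl (P : Sl → Bool) (l : List Sl) : Bool := List.rec true (fun s _ ih => cond (P s) ih false) l

theorem allSl_cons (P : Sl → Bool) (s : Sl) (l : List Sl) : allSl P (s :: l) = cond (P s) (allSl P l) false := rfl

theorem allSl_mem (P : Sl → Bool) (l : List Sl) (h : allSl P l = true) : ∀ s ∈ l, P s = true := by
  induction l with
  | nil => simp
  | cons s l ih =>
    rw [allSl_cons] at h
    have h1 : P s = true ∧ allSl P l = true := by
      cases hp : P s <;> simp_all
    intro t ht
    rcases List.mem_cons.1 ht with rfl | ht
    · exact h1.1
    · exact ih h1.2 t ht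

def chainSl (l : List Sl) : ℕ → Bool :=
  List.rec (fun _ => false) (fun s _ ih m => s.m0 == m && (s.m1 == 0 || ih s.m1)) l

theorem chainSl_cons (s : Sl) (l : List Sl) (m : ℕ) :
    chainSl (s :: l) m = (s.m0 == m && (s.m1 == 0 || chainSl l s.m1)) := rfl

theorem chain_cover (l : List Sl) (y : ℝ) : ∀ m : ℕ, chainSl l m = true → (m : ℝ) / 8 ≤ y → ∃ s ∈ l, InSl s y := by
  induction l with
  | nil => intro m h; simp [chainSl] at h
  | cons s l ih =>
    intro m h hy
    rw [chainSl_cons] at h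
    simp only [Bool.and_eq_true, Bool.or_eq_true, beq_iff_eq] at h
    obtain ⟨h1, h2⟩ := h
    by_cases hc : s.m1 = 0 ∨ y ≤ (s.m1 : ℝ) / 8
    · exact ⟨s, List.mem_cons_self, by rw [h1]; exact hy, hc⟩
    · push Not at hc
      obtain ⟨t, ht, hty⟩ := ih s.m1 (h2.resolve_left hc.1) hc.2.le
      exact ⟨t, List.mem_cons_of_mem _ ht, hty⟩

def slabChk (s : Sl) : Bool :=
  Nat.ble 33 s.m0 && (Nat.blt s.m0 1024 && (Nat.ble ((lg (s.m0 ^ 3) + 1) * 693148) (192 * (s.ly + 3 * 693147)) &&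
  (Nat.ble ((s.m0 * 1000000) ^ 16 * 10 ^ (9 * s.m0)) ((8 * s.E) ^ 16 * 2718281828 ^ s.m0) &&
  (Nat.ble (s.blo ^ 8 * 10 ^ (9 * s.m0)) (2718281828 ^ s.m0) && Nat.ble 19 s.blo))))

theorem exp_nat_lo (m : ℕ) : (2718281828:ℝ) ^ m / 10 ^ (9 * m) ≤ Real.exp m := by
  have h1 := Real.exp_one_gt_d9
  have : Real.exp m = Real.exp 1 ^ m := by rw [← Real.exp_nat_mul]; simp
  rw [this, pow_mul, ← div_pow]
  exact pow_le_pow_left₀ (by norm_num) (by norm_num; linarith) m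

theorem exp_nat_hi (m : ℕ) : Real.exp m ≤ 2.7182818286 ^ m := by
  have h1 := Real.exp_one_lt_d9
  have : Real.exp m = Real.exp 1 ^ m := by rw [← Real.exp_nat_mul]; simp
  rw [this]
  exact pow_le_pow_left₀ (Real.exp_pos _).le h1.le m

theorem log_le_of_pow (x : ℝ) (hx : 0 < x) (n k : ℕ) (hn : 0 < n) (h : x ^ n ≤ 2.718281828 ^ k) : Real.log x ≤ k / n := by
  rw [le_div_iff₀ (by exact_mod_cast hn), mul_comm, ← Real.log_pow, Real.log_le_iff_le_exp (by positivity)]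
  refine h.trans ?_
  have := exp_nat_lo k
  rw [pow_mul, ← div_pow] at this
  norm_num at this ⊢
  exact this

theorem CV_mono (y0 y C : ℝ) (h : CV y0 C) (hy : y0 ≤ y) : CV y C := by
  obtain ⟨h1, j, h2, h3⟩ := h
  exact ⟨h1.trans hy, j, h2, le_trans (mul_le_mul_of_nonneg_left (yexp_anti _ _ h1 hy) (by positivity)) h3⟩

theorem yexp_le (m E : ℕ) (h : (m * 1000000) ^ 16 * 10 ^ (9 * m) ≤ (8 * E) ^ 16 * 2718281828 ^ m) :
    (m:ℝ) / 8 * Real.exp (-((m:ℝ) / 8 / 2)) ≤ E / 1000000 := by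
  have hR : ((m:ℝ) * 1000000) ^ 16 * 10 ^ (9 * m) ≤ (8 * E) ^ 16 * 2718281828 ^ m := by exact_mod_cast h
  have h1 := exp_nat_lo m
  rw [div_le_iff₀ (by positivity)] at h1
  have h2 : ((m:ℝ) * 1000000) ^ 16 ≤ (8 * E) ^ 16 * Real.exp m := by
    have : ((m:ℝ) * 1000000) ^ 16 * 10 ^ (9 * m) ≤ ((8 * E) ^ 16 * Real.exp m) * 10 ^ (9 * m) := by
      refine hR.trans ?_
      rw [mul_assoc]
      exact mul_le_mul_of_nonneg_left h1 (by positivity)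
    exact le_of_mul_le_mul_right this (by positivity)
  have h3 : Real.exp m = Real.exp ((m:ℝ) / 8 / 2) ^ 16 := by rw [← Real.exp_nat_mul]; congr 1; push_cast; ring
  rw [h3, ← mul_pow] at h2
  have h4 := le_of_pow_le_pow_left₀ (by norm_num) (by positivity) h2
  rw [Real.exp_neg, ← div_eq_mul_inv, div_le_iff₀ (Real.exp_pos _)]
  linarith

theorem CV_33 : CV (33/8) 0.9 := by
  refine ⟨by norm_num, 0, ?_, ?_⟩
  · have := log_le_of_pow 3 (by norm_num) 10 11 (by norm_num) (by norm_num)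
    norm_num at this ⊢; linarith
  · have := yexp_le 33 600000 (by decide +kernel)
    norm_num at this ⊢; linarith

theorem CV_46 : CV (46/8) 1.057 := by
  refine ⟨by norm_num, 1, ?_, ?_⟩
  · have := log_le_of_pow 5 (by norm_num) 105 169 (by norm_num) (by norm_num)
    norm_num [Finset.sum_range_succ] at this ⊢; linarith
  · have := yexp_le 46 330000 (by decide +kernel)
    norm_num at this ⊢; linarith

theorem CV_58 : CV (58/8) 1.12 := by
  refine ⟨by norm_num, 2, ?_, ?_⟩
  · have := log_le_of_pow 7 (by norm_num) 56 109 (by norm_num) (by norm_num)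
    norm_num [Finset.sum_range_succ] at this ⊢; linarith
  · have := yexp_le 58 199000 (by decide +kernel)
    norm_num at this ⊢; linarith

theorem CV_CC (m : ℕ) (hm : 33 ≤ m) : CV ((m:ℝ) / 8) ((CC m : ℝ) / 1000000) := by
  have hmR : (33:ℝ) ≤ m := by exact_mod_cast hm
  unfold CC
  rcases lt_or_ge m 46 with h | h
  · have e : Nat.blt m 46 = true := by simp [h]
    rw [e]; simp only [cond_true]
    have := CV_mono (33/8) ((m:ℝ)/8) 0.9 CV_33 (by linarith)
    norm_num at this ⊢; exact this
  have e : Nat.blt m 46 = false := Bool.eq_false_iff.2 (by simpa [Nat.blt_eq] using h)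
  rw [e]; simp only [cond_false]
  have hmR : (46:ℝ) ≤ m := by exact_mod_cast h
  rcases lt_or_ge m 58 with h | h
  · have e : Nat.blt m 58 = true := by simp [h]
    rw [e]; simp only [cond_true]
    have := CV_mono (46/8) ((m:ℝ)/8) 1.057 CV_46 (by linarith)
    norm_num at this ⊢; exact this
  have e : Nat.blt m 58 = false := Bool.eq_false_iff.2 (by simpa [Nat.blt_eq] using h)
  rw [e]; simp only [cond_false]
  have hmR : (58:ℝ) ≤ m := by exact_mod_cast h
  have := CV_mono (58/8) ((m:ℝ)/8) 1.12 CV_58 (by linarith)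
  norm_num at this ⊢; exact this

theorem log2_lo : (693147:ℝ) ≤ 1000000 * Real.log 2 := by have := Real.log_two_gt_d9; linarith
theorem log2_hi : 1000000 * Real.log 2 ≤ (693148:ℝ) := by have := Real.log_two_lt_d9; linarith

theorem slab_facts (s : Sl) (h : slabChk s = true) (b : ℕ) (hb0 : 0 < b) (hb : (s.m0 : ℝ) / 8 ≤ Real.log b) :
    33 ≤ s.m0 ∧ 19 ≤ s.blo ∧ s.blo ≤ b ∧ (s.m0:ℝ) / 8 * Real.exp (-((s.m0:ℝ) / 8 / 2)) ≤ s.E / 1000000 ∧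
    Real.log ((s.m0:ℝ) / 8) ≤ s.ly / 1000000 := by
  unfold slabChk at h
  simp only [Bool.and_eq_true, Nat.ble_eq] at h
  obtain ⟨h1, h2, h3, h4, h5, h6⟩ := h
  have h2 : s.m0 < 1024 := by simpa using h2
  refine ⟨h1, h6, ?_, yexp_le _ _ h4, ?_⟩
  · have hR : (s.blo:ℝ) ^ 8 * 10 ^ (9 * s.m0) ≤ 2718281828 ^ s.m0 := by exact_mod_cast h5
    have h7 := exp_nat_lo s.m0
    rw [← le_div_iff₀ (by positivity)] at hR
    have h8 : Real.exp s.m0 ≤ (b:ℝ) ^ 8 := by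
      have hbR : (0:ℝ) < b := by exact_mod_cast hb0
      rw [← Real.le_log_iff_exp_le (by positivity), Real.log_pow]
      push_cast; linarith
    have h9 : (s.blo:ℝ) ^ 8 ≤ (b:ℝ) ^ 8 := hR.trans (h7.trans h8)
    exact_mod_cast le_of_pow_le_pow_left₀ (by norm_num) (by positivity) h9
  · have hm0 : (0:ℝ) < s.m0 := by exact_mod_cast (by omega : 0 < s.m0)
    have h7 := le_lg (s.m0 ^ 3) (Nat.one_le_pow _ _ (by omega)) (by
      calc s.m0 ^ 3 < 1024 ^ 3 := Nat.pow_lt_pow_left h2 (by norm_num)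
        _ < _ := by norm_num)
    have h3R : ((lg (s.m0 ^ 3):ℝ) + 1) * 693148 ≤ 192 * (s.ly + 3 * 693147) := by exact_mod_cast h3
    have h8 : ((lg (s.m0 ^ 3):ℝ) + 1) * (1000000 * Real.log 2) ≤ ((lg (s.m0 ^ 3):ℝ) + 1) * 693148 :=
      mul_le_mul_of_nonneg_left log2_hi (by positivity)
    push_cast [Real.log_pow] at h7
    have h9 : Real.log ((s.m0:ℝ) / 8) = Real.log s.m0 - 3 * Real.log 2 := by
      rw [Real.log_div hm0.ne' (by norm_num), show (8:ℝ) = 2 ^ 3 by norm_num, Real.log_pow]; norm_num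
    rw [h9, le_div_iff₀ (by norm_num)]
    have := log2_lo
    linarith

theorem lin_slab (s : Sl) (y p q : ℝ) (hy : InSl s y) (h0 : 0 ≤ p * (s.m0 / 8) + q)
    (h1 : (s.m1 = 0 ∧ 0 ≤ p) ∨ (s.m1 ≠ 0 ∧ 0 ≤ p * (s.m1 / 8) + q)) : 0 ≤ p * y + q := by
  obtain ⟨ha, hb⟩ := hy
  rcases h1 with ⟨_, h1⟩ | ⟨hz, h1⟩
  · nlinarith
  · have hb := hb.resolve_left hz
    rcases le_total 0 p with hp | hp <;> nlinarith

/-- `core` specialised to a slab. -/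
theorem core2 (a b : ℕ) (ha : 3 ≤ a) (hab : a < b) (h : Nat.Coprime a b) (δ : ℝ) (hδ : 0 < δ)
    (hδ' : δ < Real.exp (-(3 / 2))) (h17 : 17 ≤ δ * (S a b : ℝ)) (haS : (a : ℝ) < δ * (S a b : ℝ))
    (s : Sl) (hs : slabChk s = true) (hy : (s.m0:ℝ) / 8 ≤ Real.log b)
    (c g1 g2 V r : ℝ) (A τ : ℕ) (hτ : 1 ≤ τ) (hA : A ≤ coefA (τ * s.blo))
    (hc : Real.log ((a - 1) * b) - 1.15 ≤ c * Real.log b)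
    (hg1 : g1 * (Real.log τ + Real.log b - 1) ≤ Real.log ((a - 1) * b) - 1.15) (hg20 : 0 ≤ g2)
    (hg2 : Real.log ((a - 1) * b) - 1.15 ≤ g2 * (Real.log b / 2 - 8 * Real.log b / s.m0 + 1 - s.ly / 1000000 + CC s.m0 / 1000000))
    (hr : r ≤ 1 + Real.log a / (Real.log b - 1.5 - 1 / a))
    (hV : V ≤ A / 1000 * τ * g1 - Wt a τ / Nat.totient a * g2 - c / (s.m0 / 8) * ((cops a τ).card * (1 + s.E / 1000000) ^ 2 / 4 + 2 * (s.E / 1000000) ^ 2))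
    (hM : max 0 (1 - 2 * r * N δ a / Nat.totient a) * (δ * a) * (1.0877 * (1 - 1 / a)) ≤ V) :
    (1 - 2 / (Nat.totient a : ℝ) * (N δ a : ℝ) * (1 - Real.log a / Real.log (δ * (S a b : ℝ)))⁻¹ -
        Real.log (δ * (S a b : ℝ)) / (δ * (S a b : ℝ))) * δ * (Nat.primeCounting (S a b) : ℝ) < (piStar a b : ℝ) := by
  obtain ⟨f1, f2, f3, f4, f5⟩ := slab_facts s hs b (by omega) hy
  have hm : (33:ℝ) ≤ s.m0 := by exact_mod_cast f1
  have hy4 : 4 < Real.log b := by linarith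
  have haR : (3:ℝ) ≤ a := by exact_mod_cast ha
  have hbR : (0:ℝ) < b := by exact_mod_cast (by omega : 0 < b)
  have hu : 0 < Real.log ((a - 1) * b) - 1.15 := by
    rw [Real.log_mul (by linarith) hbR.ne']
    have : 0 ≤ Real.log ((a:ℝ) - 1) := Real.log_nonneg (by linarith)
    linarith
  have hGG : Real.log b / 2 - 8 * Real.log b / s.m0 + 1 - s.ly / 1000000 + CC s.m0 / 1000000 ≤
      Real.log b / 2 - Real.log (Real.log b) + CC s.m0 / 1000000 := by
    have h1 : Real.log (Real.log b) = Real.log (s.m0 / 8) + Real.log (8 * Real.log b / s.m0) := by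
      rw [← Real.log_mul (by positivity) (by positivity)]; congr 1; field_simp
    have h2 := Real.log_le_sub_one_of_pos (show 0 < 8 * Real.log b / s.m0 by positivity)
    linarith
  have hg2' := hg2.trans (mul_le_mul_of_nonneg_left hGG hg20)
  have hG : 0 < Real.log b / 2 - Real.log (Real.log b) + CC s.m0 / 1000000 := by
    by_contra hcon
    push Not at hcon
    have := mul_nonpos_of_nonneg_of_nonpos hg20 hcon
    linarith
  exact core a b ha hab h δ hδ hδ' h17 haS (s.m0 / 8) (CC s.m0 / 1000000) (s.E / 1000000) c g1 g2 V r A τ (f2.trans f3) hτ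
    (hA.trans (coefA_mono _ _ (Nat.mul_le_mul_left _ f3))) hy (CV_CC _ f1) f4 hu hc hg1 hG hg2' hr hV hM

end PS
end

section
namespace PS

def co (v a : ℕ) : ℕ := Nat.sub 2 (Nat.gcd v a)

theorem co_eq (v a : ℕ) (ha : 1 ≤ a) : co v a = if Nat.Coprime v a then 1 else 0 := by
  unfold co
  have h1 : 1 ≤ Nat.gcd v a := Nat.gcd_pos_of_pos_right _ ha
  change 2 - Nat.gcd v a = _
  split_ifs with h
  · rw [Nat.coprime_iff_gcd_eq_one.1 h]
  · have : Nat.gcd v a ≠ 1 := h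
    omega

theorem cops_succ (a τ : ℕ) (ha : 1 ≤ a) : (cops a (τ + 1)).card = (cops a τ).card + co τ a := by
  rw [co_eq _ _ ha]
  unfold cops
  rw [Finset.range_add_one, Finset.filter_insert]
  split_ifs
  · rw [Finset.card_insert_of_notMem (by simp)]
  · rfl

theorem Wt_succ (a τ : ℕ) : Wt a (τ + 1) = Wt a τ + (cops a (τ + 1)).card := by
  unfold Wt
  have h1 : ∑ v ∈ cops a τ, (τ - v) = ∑ v ∈ cops a (τ + 1), (τ - v) := by
    unfold cops
    rw [Finset.range_add_one, Finset.filter_insert]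
    split_ifs
    · rw [Finset.sum_insert (by simp)]; simp
    · rfl
  rw [h1, Finset.card_eq_sum_ones, ← Finset.sum_add_distrib]
  apply Finset.sum_congr rfl
  intro v hv
  have : v < τ + 1 := by
    unfold cops at hv; simp at hv; omega
  omega

theorem cops_one (a : ℕ) (ha : 2 ≤ a) : (cops a 1).card = 0 := by
  have := cops_succ a 0 (by omega)
  rw [co_eq _ _ (by omega)] at this
  rw [this]
  have : ¬ Nat.Coprime 0 a := by simp; omega
  simp [this, cops]

theorem Wt_one (a : ℕ) (ha : 2 ≤ a) : Wt a 1 = 0 := by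
  rw [Wt_succ, cops_one a ha]; simp [Wt, cops]

theorem totient_cops (a : ℕ) : Nat.totient a = (cops a a).card := by
  unfold cops Nat.totient
  congr 1
  ext v
  simp [Nat.coprime_comm]

def cntLoop (a fuel : ℕ) : ℕ → ℕ → ℕ :=
  Nat.rec (fun _ n => n) (fun _ ih v n => force (Nat.add n (co v a)) fun n2 => force (Nat.succ v) fun v2 => ih v2 n2) fuel

theorem cntLoop_eq (a fuel : ℕ) (ha : 1 ≤ a) : ∀ v, cntLoop a fuel v (cops a v).card = (cops a (v + fuel)).card := by
  induction fuel with
  | zero => intro v; rfl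
  | succ f ih =>
    intro v
    have : cntLoop a (f + 1) v (cops a v).card = cntLoop a f (v + 1) ((cops a v).card + co v a) := by
      unfold cntLoop
      simp only [force_eq]; rfl
    rw [this, ← cops_succ a v ha, ih (v + 1)]
    congr 2; omega

def phiC (a : ℕ) : ℕ := cntLoop a a 0 0

theorem phiC_eq (a : ℕ) (ha : 1 ≤ a) : phiC a = Nat.totient a := by
  have := cntLoop_eq a a ha 0
  rw [totient_cops]
  simpa [cops, phiC] using this

structure Ent where
  x : ℕ
  np : ℕ
  t : ℕ
  n : ℕ
  W : ℕ

def innerL (a : ℕ) (k : ℕ → ℕ → ℕ → Bool) (fuel : ℕ) : ℕ → ℕ → ℕ → Bool :=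
  Nat.rec (fun v n W => k v n W) (fun _ ih v n W => force (Nat.add n (co v a)) fun n2 =>
    force (Nat.succ v) fun v2 => force (Nat.add W n2) fun W2 => ih v2 n2 W2) fuel

theorem innerL_eq (a : ℕ) (ha : 1 ≤ a) (k : ℕ → ℕ → ℕ → Bool) (fuel : ℕ) : ∀ v,
    innerL a k fuel v (cops a v).card (Wt a v) = k (v + fuel) (cops a (v + fuel)).card (Wt a (v + fuel)) := by
  induction fuel with
  | zero => intro v; rfl
  | succ f ih =>
    intro v
    have e : innerL a k (f + 1) v (cops a v).card (Wt a v) =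
        innerL a k f (v + 1) ((cops a v).card + co v a) (Wt a v + ((cops a v).card + co v a)) := by
      unfold innerL
      simp only [force_eq]; rfl
    rw [e, ← cops_succ a v ha, ← Wt_succ, ih (v + 1), show v + 1 + f = v + (f + 1) by omega]

def outerL (a B : ℕ) (F : List Ent → Bool) (M : ℕ) : ℕ → ℕ → ℕ → List Ent → Bool :=
  Nat.rec (fun _ _ _ l => F l) (fun _ ih v n W l =>
    innerL a (fun v2 n2 W2 => force (Nat.pred v2) fun x => ih v2 n2 W2 (List.cons ⟨x, n, v2, n2, W2⟩ l)) B v n W) M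

def EntOK (a : ℕ) (e : Ent) : Prop := 1 ≤ e.t ∧ e.n = (cops a e.t).card ∧ e.W = Wt a e.t
def CovL (a v : ℕ) (l : List Ent) : Prop := (∀ e ∈ l, EntOK a e) ∧
  ∀ x, 1 ≤ x → x < v → ∃ e ∈ l, e.np ≤ (cops a x).card ∧ x ≤ e.x

theorem cops_mono (a x y : ℕ) (h : x ≤ y) : (cops a x).card ≤ (cops a y).card := by
  unfold cops
  exact Finset.card_le_card (Finset.filter_subset_filter _ (Finset.range_mono h))

theorem outerL_sound (a B : ℕ) (ha : 1 ≤ a) (F : List Ent → Bool) (M : ℕ) : ∀ v l, 1 ≤ v → CovL a v l →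
    outerL a B F M v (cops a v).card (Wt a v) l = true → ∃ l, CovL a (v + M * B) l ∧ F l = true := by
  induction M with
  | zero => intro v l _ h1 h; exact ⟨l, by simpa using h1, h⟩
  | succ M ih =>
    intro v l hv h1 h
    have e : outerL a B F (M + 1) v (cops a v).card (Wt a v) l =
        innerL a (fun v2 n2 W2 => outerL a B F M v2 n2 W2 (⟨v2 - 1, (cops a v).card, v2, n2, W2⟩ :: l)) B v
          (cops a v).card (Wt a v) := by
      unfold outerL
      simp only [force_eq]; rfl
    rw [e, innerL_eq a ha] at h
    have := ih (v + B) _ (by omega) ?_ h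
    · rw [show v + (M + 1) * B = v + B + M * B by ring]; exact this
    · refine ⟨?_, ?_⟩
      · intro e he
        rcases List.mem_cons.1 he with rfl | he
        · exact ⟨by simp only; omega, rfl, rfl⟩
        · exact h1.1 e he
      · intro x hx1 hx2
        rcases lt_or_ge x v with hx | hx
        · obtain ⟨e, he, he2⟩ := h1.2 x hx1 hx
          exact ⟨e, List.mem_cons_of_mem _ he, he2⟩
        · exact ⟨_, List.mem_cons_self, cops_mono a v x hx, by simp only; omega⟩

def pickL (g2 lim : ℕ) (k : ℕ → ℕ → ℕ → Bool) (l : List Ent) : Bool :=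
  List.rec false (fun e _ ih => cond (Nat.ble (Nat.mul e.n g2) lim) (k e.t e.n e.W) ih) l

theorem pickL_sound (a v g2 lim : ℕ) (k : ℕ → ℕ → ℕ → Bool) (l : List Ent) (hl : CovL a v l)
    (h : pickL g2 lim k l = true) : ∃ τ, 1 ≤ τ ∧ k τ (cops a τ).card (Wt a τ) = true := by
  have : ∃ e ∈ l, k e.t e.n e.W = true := by
    clear hl
    induction l with
    | nil => simp [pickL] at h
    | cons e l ih =>
      have e1 : pickL g2 lim k (e :: l) = cond (Nat.ble (Nat.mul e.n g2) lim) (k e.t e.n e.W) (pickL g2 lim k l) := rfl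
      rw [e1] at h
      cases hb : Nat.ble (Nat.mul e.n g2) lim
      · rw [hb] at h
        obtain ⟨f, hf, hf2⟩ := ih h
        exact ⟨f, List.mem_cons_of_mem _ hf, hf2⟩
      · rw [hb] at h; exact ⟨e, List.mem_cons_self, h⟩
  obtain ⟨e, he, h2⟩ := this
  obtain ⟨h3, h4, h5⟩ := hl.1 e he
  rw [h4, h5] at h2
  exact ⟨e.t, h3, h2⟩

def minN (x y : ℕ) : ℕ := cond (Nat.ble x y) x y

theorem minN_eq (x y : ℕ) : minN x y = min x y := by
  unfold minN
  rcases le_or_gt x y with h | h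
  · rw [Nat.ble_eq_true_of_le h, min_eq_left h]; rfl
  · have : Nat.ble x y = false := Bool.eq_false_iff.2 (by rw [ne_eq, Nat.ble_eq]; omega)
    rw [this, min_eq_right h.le]; rfl

def jAll (pK r2 c1 R X : ℕ) (l : List Ent) : Bool :=
  List.rec true (fun e _ ih => cond (Nat.ble (Nat.mul (Nat.mul c1 (Nat.sub pK (Nat.mul r2 e.np))) (minN (Nat.mul e.x 100000) X)) R)
    ih false) l

theorem jAll_mem (pK r2 c1 R X : ℕ) (l : List Ent) (h : jAll pK r2 c1 R X l = true) : ∀ e ∈ l,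
    c1 * (pK - r2 * e.np) * min (e.x * 100000) X ≤ R := by
  induction l with
  | nil => simp
  | cons e l ih =>
    have e1 : jAll pK r2 c1 R X (e :: l) = cond (Nat.ble (c1 * (pK - r2 * e.np) * minN (e.x * 100000) X) R) (jAll pK r2 c1 R X l) false := rfl
    rw [e1, minN_eq] at h
    cases hb : Nat.ble (c1 * (pK - r2 * e.np) * min (e.x * 100000) X) R
    · rw [hb] at h; simp at h
    · rw [hb] at h
      intro f hf
      rcases List.mem_cons.1 hf with rfl | hf
      · exact Nat.le_of_ble_eq_true hb
      · exact ih h f hf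

theorem jAll_sound (a v pK r2 c1 R X : ℕ) (l : List Ent) (hl : CovL a v l) (h : jAll pK r2 c1 R X l = true) (x : ℕ)
    (h1 : 1 ≤ x) (h2 : x < v) : c1 * (pK - r2 * (cops a x).card) * min (x * 100000) X ≤ R := by
  obtain ⟨e, he, h3, h4⟩ := hl.2 x h1 h2
  refine le_trans ?_ (jAll_mem _ _ _ _ _ l h e he)
  gcongr

def loghi (n : ℕ) : ℕ := (lg n + 1) * 693148 / 64 + 1
def loglo (n : ℕ) : ℕ := lg n * 693147 / 64

theorem loglo_le (n : ℕ) (hn : 1 ≤ n) : (loglo n : ℝ) ≤ 1000000 * Real.log n := by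
  have h1 := lg_le n hn
  have h2 : (loglo n : ℝ) ≤ (lg n * 693147 : ℕ) / (64:ℕ) := Nat.cast_div_le
  push_cast at h2
  have h3 : (lg n : ℝ) * 693147 ≤ lg n * (1000000 * Real.log 2) := mul_le_mul_of_nonneg_left log2_lo (by positivity)
  rw [le_div_iff₀ (by norm_num)] at h2
  linarith

theorem le_loghi (n : ℕ) (hn : 1 ≤ n) (hn2 : n < 2 ^ 32) : 1000000 * Real.log n ≤ (loghi n : ℝ) := by
  have h1 := le_lg n hn hn2
  have h2 : (lg n + 1) * 693148 ≤ 64 * loghi n := by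
    unfold loghi; omega
  have h2R : ((lg n : ℝ) + 1) * 693148 ≤ 64 * loghi n := by exact_mod_cast h2
  have h3 : ((lg n : ℝ) + 1) * (1000000 * Real.log 2) ≤ (lg n + 1) * 693148 := mul_le_mul_of_nonneg_left log2_hi (by positivity)
  linarith

def smallFin (a φ al ah lam g2 : ℕ) (s : Sl) (l : List Ent) (τ n W : ℕ) : Bool :=
  force (cond (Nat.beq τ 1) 0 (loghi τ)) fun lt =>
  force ((125000 * s.m0 + al - 1150000) * 1000000 / (125000 * s.m0 + lt - 1000000)) fun g10 =>
  force (cond (Nat.beq s.m1 0) (minN g10 1000000)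
    (minN g10 ((125000 * s.m1 + al - 1150000) * 1000000 / (125000 * s.m1 + lt - 1000000)))) fun g1 =>
  force ((125000 * s.m0 + (ah - 1150000)) * (n * (1000000 + s.E) ^ 2 + 8 * s.E ^ 2) / (4 * (125000 * s.m0) ^ 2) + 1) fun err =>
  force (coefA (τ * s.blo)) fun A =>
  force ((A * τ * g1 * φ / 1000 - (W * g2 + φ * err)) / φ) fun V =>
  force (cond (Nat.beq s.m1 0) 0 (lam * 1000000 / (125000 * s.m1 - 1500000))) fun q =>
  Nat.ble (g1 * (125000 * s.m0 + lt) + 1150000000000) (1000000 * (125000 * s.m0 + al) + g1 * 1000000) &&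
  (cond (Nat.beq s.m1 0) (Nat.ble g1 1000000)
    (Nat.ble (g1 * (125000 * s.m1 + lt) + 1150000000000) (1000000 * (125000 * s.m1 + al) + g1 * 1000000)) &&
  (Nat.ble ((125000 * s.m0 + (ah - 1150000)) * (n * (1000000 + s.E) ^ 2 + 8 * s.E ^ 2)) (err * (4 * (125000 * s.m0) ^ 2)) &&
  (Nat.ble ((V * φ + W * g2 + φ * err) * 1000) (A * τ * g1 * φ) &&
  (cond (Nat.beq s.m1 0) (Nat.beq q 0) (Nat.ble (q * (125000 * s.m1)) (lam * 1000000 + q * 1500000)) &&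
  (Nat.ble τ a &&
  (force (φ * 1000000) fun pK => force (2 * (1000000 + q)) fun r2 => force (10877 * (a - 1)) fun c1 =>
    force (V * a * φ * 1000000000) fun R => force (22314 * a) fun X =>
      jAll pK r2 c1 R X l))))))

def g2Of (ah C : ℕ) (s : Sl) (m : ℕ) : ℕ :=
  (125000 * m + ah - 1150000) * 1000000 / (62500 * m + 1000000 + C - (1000000 * m / s.m0 + 1) - s.ly) + 1

def g2Ok (ah C g2 : ℕ) (s : Sl) (m : ℕ) : Bool :=
  Nat.ble (1000000 * (125000 * m + ah) * s.m0 + g2 * (1000000 * m + s.ly * s.m0))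
    (1150000000000 * s.m0 + g2 * (s.m0 * (62500 * m + 1000000 + C)))

def maxN (x y : ℕ) : ℕ := cond (Nat.ble x y) y x

def smallCell (a φ al ah lam lam1 : ℕ) (l : List Ent) (s : Sl) : Bool :=
  cond (Nat.blt 0 s.m1 && Nat.blt (125000 * s.m1) lam1) true
  (force (CC s.m0) fun C => force (maxN (g2Of ah C s s.m0) (cond (Nat.beq s.m1 0) (2000000 * s.m0 / (s.m0 - 16) + 1) (g2Of ah C s s.m1))) fun g2 =>
    (g2Ok ah C g2 s s.m0 && cond (Nat.beq s.m1 0) (Nat.ble (2000000 * s.m0 + 16 * g2) (g2 * s.m0)) (g2Ok ah C g2 s s.m1)) &&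
    (force (950000 * φ) fun lim => pickL g2 lim (smallFin a φ al ah lam g2 s l) l))

def smallA (T : List Sl) (a : ℕ) : Bool :=
  force (phiC a) fun φ => force (loglo (a - 1)) fun al => force (loghi (a - 1)) fun ah => force (loglo a) fun lam =>
  force (loglo (a + 1)) fun lam1 => force (a / 48 + 1) fun B =>
    outerL a B (fun l => allSl (smallCell a φ al ah lam lam1 l) T) (a / 2 / B) 1 0 0 [⟨0, 0, 1, 0, 0⟩]

def smallAll (T : List Sl) (fuel : ℕ) : ℕ → Bool :=
  Nat.rec (fun _ => true) (fun _ ih a => cond (smallA T a) (force (Nat.succ a) fun a2 => ih a2) false) fuel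

theorem smallAll_sound (T : List Sl) (fuel : ℕ) : ∀ a, smallAll T fuel a = true → ∀ i, a ≤ i → i < a + fuel → smallA T i = true := by
  induction fuel with
  | zero => intro a _ i h1 h2; omega
  | succ f ih =>
    intro a h i h1 h2
    have e : smallAll T (f + 1) a = cond (smallA T a) (smallAll T f (a + 1)) false := by
      unfold smallAll
      simp only [force_eq]
    rw [e] at h
    cases hb : smallA T a
    · rw [hb] at h; simp at h
    · rw [hb] at h
      rcases Nat.eq_or_lt_of_le h1 with rfl | hlt
      · exact hb
      · exact ih (a + 1) h i hlt (by omega)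
def TS : List Sl := [⟨33, 36, 1418791, 524436, 61⟩, ⟨36, 40, 1505434, 474298, 90⟩, ⟨40, 46, 1610129, 410426, 148⟩, ⟨46, 52, 1750924, 324394, 314⟩, ⟨52, 58, 1873669, 252034, 665⟩, ⟨58, 66, 1981974, 193207, 1000⟩, ⟨66, 76, 2111939, 133350, 1000⟩, ⟨76, 90, 2252734, 82193, 1000⟩, ⟨90, 112, 2422411, 40575, 1000⟩, ⟨112, 145, 2642630, 12768, 1000⟩, ⟨145, 190, 2898951, 2103, 1000⟩, ⟨190, 250, 3169712, 167, 1000⟩, ⟨250, 350, 3444083, 7, 1000⟩, ⟨350, 520, 3779826, 2, 1000⟩, ⟨520, 952, 4176942, 2, 1000⟩, ⟨952, 0, 4779837, 2, 1000⟩]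
end PS
end

section
namespace PS

theorem trunc_max (p r2 k φ : ℕ) (hφ : 0 < φ) (hp : p = φ * 1000000) :
    max 0 (1 - (r2:ℝ) / 1000000 * k / φ) * (φ * 1000000) ≤ ((p - r2 * k : ℕ) : ℝ) := by
  have hφR : (0:ℝ) < φ := by exact_mod_cast hφ
  rw [max_mul_of_nonneg _ _ (by positivity), zero_mul]
  apply max_le (by positivity)
  have h1 : (1 - (r2:ℝ) / 1000000 * k / φ) * (φ * 1000000) = φ * 1000000 - r2 * k := by field_simp
  have h2 : p ≤ (p - r2 * k) + r2 * k := by omega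
  have h3 : (p:ℝ) ≤ ((p - r2 * k : ℕ) : ℝ) + r2 * k := by exact_mod_cast h2
  rw [h1]
  have h4 : (p:ℝ) = φ * 1000000 := by rw [hp]; push_cast; ring
  linarith

/-- the bound on the comparison side from the staircase check. -/
theorem hM_small (a : ℕ) (ha : 3 ≤ a) (δ : ℝ) (hδ : 0 < δ) (hδ' : δ < Real.exp (-(3 / 2))) (q V v : ℕ) (φ : ℕ) (hφ : φ = Nat.totient a)
    (hv : 22314 * a / 100000 + 1 < v)
    (h : ∀ x, 1 ≤ x → x < v → (10877 * (a - 1)) * (φ * 1000000 - 2 * (1000000 + q) * (cops a x).card) * min (x * 100000) (22314 * a) ≤ V * a * φ * 1000000000) :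
    max 0 (1 - 2 * (1 + (q:ℝ) / 1000000) * N δ a / Nat.totient a) * (δ * a) * (1.0877 * (1 - 1 / a)) ≤ (V:ℝ) / 1000000 := by
  have haR : (3:ℝ) ≤ a := by exact_mod_cast ha
  have hφ0 : 0 < φ := by rw [hφ]; exact Nat.totient_pos.2 (by omega)
  have hφR : (0:ℝ) < φ := by exact_mod_cast hφ0
  have hd : δ * a ≤ 0.22314 * a := mul_le_mul_of_nonneg_right (hδ'.le.trans exp_bd.le) (by linarith)
  have hj1 : (⌊δ * a⌋₊ : ℝ) ≤ δ * a := Nat.floor_le (by positivity)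
  have hj2 : δ * a ≤ ⌊δ * a⌋₊ + 1 := (Nat.lt_floor_add_one _).le
  rw [N_eq δ a ha hδ, ← hφ]
  set j := ⌊δ * a⌋₊ with hjd
  have hjv : j + 1 < v := by
    have : (j:ℝ) * 100000 ≤ 22314 * a := by linarith
    have : j * 100000 ≤ 22314 * a := by exact_mod_cast this
    omega
  have h1 := h (j + 1) (by omega) hjv
  have h2 := trunc_max (φ * 1000000) (2 * (1000000 + q)) (cops a (j + 1)).card φ hφ0 rfl
  set k := (cops a (j + 1)).card with hk
  set Q : ℕ := φ * 1000000 - 2 * (1000000 + q) * k with hQ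
  have h3 : ((2 * (1000000 + q) : ℕ) : ℝ) / 1000000 = 2 * (1 + (q:ℝ) / 1000000) := by push_cast; ring
  rw [h3] at h2
  set X := max 0 (1 - 2 * (1 + (q:ℝ) / 1000000) * k / φ) with hX
  have hX0 : 0 ≤ X := le_max_left _ _
  have h4 : δ * a * 100000 ≤ ((min ((j + 1) * 100000) (22314 * a) : ℕ) : ℝ) := by
    rw [Nat.cast_min]
    apply le_min <;> push_cast <;> linarith
  have h1R : (10877 * ((a:ℝ) - 1)) * Q * ((min ((j + 1) * 100000) (22314 * a) : ℕ) : ℝ) ≤ V * a * φ * 1000000000 := by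
    have : ((10877 * (a - 1) * Q * min ((j + 1) * 100000) (22314 * a) : ℕ) : ℝ) ≤ ((V * a * φ * 1000000000 : ℕ) : ℝ) := by exact_mod_cast h1
    rw [Nat.cast_mul, Nat.cast_mul, Nat.cast_mul, Nat.cast_sub (by omega)] at this
    push_cast at this ⊢
    exact this
  have h5 : (10877 * ((a:ℝ) - 1)) * (X * (φ * 1000000)) * (δ * a * 100000) ≤ V * a * φ * 1000000000 := by
    refine le_trans ?_ h1R
    have ha1 : 0 ≤ (a:ℝ) - 1 := by linarith
    gcongr
  have h6 : X * (δ * a) * (1.0877 * (1 - 1 / a)) = (10877 * ((a:ℝ) - 1)) * (X * (φ * 1000000)) * (δ * a * 100000) / (a * φ * 1000000000) / 1000000 := by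
    field_simp; ring
  rw [h6, div_le_div_iff_of_pos_right (by norm_num), div_le_iff₀ (by positivity)]
  calc _ ≤ _ := h5
    _ = _ := by ring

theorem small_fin (a b : ℕ) (ha : 3 ≤ a) (ha2 : a < 100000) (hab : a < b) (h : Nat.Coprime a b) (δ : ℝ) (hδ : 0 < δ)
    (hδ' : δ < Real.exp (-(3 / 2))) (h17 : 17 ≤ δ * (S a b : ℝ)) (haS : (a : ℝ) < δ * (S a b : ℝ))
    (s : Sl) (hs : slabChk s = true) (hy : InSl s (Real.log b)) (g2 v : ℕ) (l : List Ent) (hl : CovL a v l)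
    (hv : 22314 * a / 100000 + 1 < v) (τ : ℕ) (hτ : 1 ≤ τ)
    (hg2 : g2Ok (loghi (a - 1)) (CC s.m0) g2 s s.m0 = true ∧ cond (Nat.beq s.m1 0) (Nat.ble (2000000 * s.m0 + 16 * g2) (g2 * s.m0))
      (g2Ok (loghi (a - 1)) (CC s.m0) g2 s s.m1) = true)
    (hf : smallFin a (Nat.totient a) (loglo (a - 1)) (loghi (a - 1)) (loglo a) g2 s l τ (cops a τ).card (Wt a τ) = true) :
    (1 - 2 / (Nat.totient a : ℝ) * (N δ a : ℝ) * (1 - Real.log a / Real.log (δ * (S a b : ℝ)))⁻¹ -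
        Real.log (δ * (S a b : ℝ)) / (δ * (S a b : ℝ))) * δ * (Nat.primeCounting (S a b) : ℝ) < (piStar a b : ℝ) := by
  unfold smallFin at hf
  simp only [force_eq] at hf
  obtain ⟨f1, f2, f3, f4, f5⟩ := slab_facts s hs b (by omega) hy.1
  have hlt : ∃ lt : ℕ, lt = cond (Nat.beq τ 1) 0 (loghi τ) := ⟨_, rfl⟩
  obtain ⟨lt, hlt⟩ := hlt
  rw [← hlt] at hf
  obtain ⟨g1, hg1⟩ : ∃ g1 : ℕ, g1 = cond (Nat.beq s.m1 0) (minN ((125000 * s.m0 + loglo (a - 1) - 1150000) * 1000000 / (125000 * s.m0 + lt - 1000000)) 1000000)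
    (minN ((125000 * s.m0 + loglo (a - 1) - 1150000) * 1000000 / (125000 * s.m0 + lt - 1000000)) ((125000 * s.m1 + loglo (a - 1) - 1150000) * 1000000 / (125000 * s.m1 + lt - 1000000))) := ⟨_, rfl⟩
  rw [← hg1] at hf
  obtain ⟨err, herr⟩ : ∃ err : ℕ, err = (125000 * s.m0 + (loghi (a - 1) - 1150000)) * ((cops a τ).card * (1000000 + s.E) ^ 2 + 8 * s.E ^ 2) / (4 * (125000 * s.m0) ^ 2) + 1 := ⟨_, rfl⟩
  rw [← herr] at hf
  generalize (coefA (τ * s.blo) * τ * g1 * Nat.totient a / 1000 - (Wt a τ * g2 + Nat.totient a * err)) / Nat.totient a = V at hf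
  generalize cond (Nat.beq s.m1 0) 0 (loglo a * 1000000 / (125000 * s.m1 - 1500000)) = q at hf
  clear hg1 herr
  simp only [Bool.and_eq_true, Nat.ble_eq] at hf
  obtain ⟨e1, e2, e3, e4, e5, e6, e7⟩ := hf
  have hjj := fun x h1 h2 => jAll_sound a v _ _ _ _ _ l hl e7 x h1 h2
  have hM := hM_small a ha δ hδ hδ' q V v _ rfl hv hjj
  have haR : (3:ℝ) ≤ a := by exact_mod_cast ha
  have hbR : (0:ℝ) < b := by exact_mod_cast (by omega : 0 < b)
  have hm0R : (33:ℝ) ≤ s.m0 := by exact_mod_cast f1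
  set x := Real.log ((a:ℝ) - 1) with hx
  have hlog : Real.log (((a:ℝ) - 1) * b) = x + Real.log b := by rw [Real.log_mul (by linarith) hbR.ne']
  have hcast : (((a - 1 : ℕ)) : ℝ) = (a:ℝ) - 1 := by rw [Nat.cast_sub (by omega)]; simp
  have hal : (loglo (a - 1) : ℝ) ≤ 1000000 * x := by rw [hx, ← hcast]; exact loglo_le _ (by omega)
  have hah : 1000000 * x ≤ loghi (a - 1) := by rw [hx, ← hcast]; exact le_loghi _ (by omega) (by norm_num; omega)
  have hlam := loglo_le a (by omega)
  have hltR : 1000000 * Real.log τ ≤ lt := by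
    rw [hlt]
    rcases Nat.eq_or_lt_of_le hτ with rfl | hlt2
    · simp
    · have : Nat.beq τ 1 = false := by
        rw [Bool.eq_false_iff, ne_eq, Nat.beq_eq]; omega
      rw [this, cond_false]
      exact le_loghi _ hτ (by norm_num; omega)
  generalize loglo (a - 1) = al at *
  generalize loghi (a - 1) = ah at *
  generalize loglo a = lam at *
  set y := Real.log b with hyd
  have hy0 : (33:ℝ) / 8 ≤ y := by have := hy.1; linarith
  have hφ0 : 0 < Nat.totient a := Nat.totient_pos.2 (by omega)
  have hφR : (0:ℝ) < Nat.totient a := by exact_mod_cast hφ0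
  have m1c : (s.m1 = 0 ∧ Nat.beq s.m1 0 = true) ∨ (s.m1 ≠ 0 ∧ Nat.beq s.m1 0 = false) := by
    rcases Nat.eq_zero_or_pos s.m1 with hz | hz
    · left; exact ⟨hz, by rw [hz]; rfl⟩
    · right; exact ⟨by omega, by rw [Bool.eq_false_iff, ne_eq, Nat.beq_eq]; omega⟩
  refine core2 a b ha hab h δ hδ hδ' h17 haS s hs hy.1 (1 + ((ah - 1150000 : ℕ) : ℝ) / (125000 * s.m0)) (g1 / 1000000) (g2 / 1000000) (V / 1000000)
    (1 + q / 1000000) (coefA (τ * s.blo)) τ hτ le_rfl ?_ ?_ (by positivity) ?_ ?_ ?_ hM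
  · -- hc
    rw [hlog]
    have h1 : (ah:ℝ) ≤ ((ah - 1150000 : ℕ) : ℝ) + 1150000 := by exact_mod_cast (by omega : ah ≤ (ah - 1150000) + 1150000)
    have h2 : ((ah - 1150000 : ℕ) : ℝ) / 1000000 ≤ ((ah - 1150000 : ℕ) : ℝ) / (125000 * s.m0) * y := by
      rw [div_mul_eq_mul_div, div_le_div_iff₀ (by norm_num) (by positivity)]
      have : (125000 * s.m0 : ℝ) ≤ y * 1000000 := by have := hy.1; linarith
      calc _ ≤ ((ah - 1150000 : ℕ) : ℝ) * (y * 1000000) := mul_le_mul_of_nonneg_left this (Nat.cast_nonneg _)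
        _ = _ := by ring
    linarith
  · -- hg1
    rw [hlog]
    have h1 := lin_slab s y (1 - (g1:ℝ) / 1000000) ((al:ℝ) / 1000000 - 1.15 - (g1:ℝ) / 1000000 * (lt / 1000000 - 1)) hy (by
        have : (g1:ℝ) * (125000 * s.m0 + lt) + 1150000000000 ≤ 1000000 * (125000 * s.m0 + al) + g1 * 1000000 := by exact_mod_cast e1
        linarith) (by
        rcases m1c with ⟨hz, hb⟩ | ⟨hz, hb⟩
        · left
          rw [hb, cond_true] at e2
          have : (g1:ℝ) ≤ 1000000 := by exact_mod_cast (Nat.le_of_ble_eq_true e2)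
          exact ⟨hz, by linarith⟩
        · right
          rw [hb, cond_false] at e2
          have : (g1:ℝ) * (125000 * s.m1 + lt) + 1150000000000 ≤ 1000000 * (125000 * s.m1 + al) + g1 * 1000000 := by exact_mod_cast (Nat.le_of_ble_eq_true e2)
          exact ⟨hz, by linarith⟩)
    have h2 : (g1:ℝ) / 1000000 * Real.log τ ≤ (g1:ℝ) / 1000000 * (lt / 1000000) := mul_le_mul_of_nonneg_left (by linarith) (by positivity)
    linarith
  · -- hg2
    rw [hlog]
    have hP : ∀ m : ℕ, g2Ok ah (CC s.m0) g2 s m = true → 0 ≤ ((g2:ℝ) / 1000000 * (1 / 2 - 8 / s.m0) - 1) * (m / 8) + ((g2:ℝ) / 1000000 * (1 - s.ly / 1000000 + CC s.m0 / 1000000) - ah / 1000000 + 1.15) := by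
      intro m hm
      unfold g2Ok at hm
      have : (1000000:ℝ) * (125000 * m + ah) * s.m0 + g2 * (1000000 * m + s.ly * s.m0) ≤ 1150000000000 * s.m0 + g2 * (s.m0 * (62500 * m + 1000000 + CC s.m0)) := by exact_mod_cast (Nat.le_of_ble_eq_true hm)
      have e : ((g2:ℝ) / 1000000 * (1 / 2 - 8 / s.m0) - 1) * (m / 8) + ((g2:ℝ) / 1000000 * (1 - s.ly / 1000000 + CC s.m0 / 1000000) - ah / 1000000 + 1.15) =
        (1150000000000 * s.m0 + g2 * (s.m0 * (62500 * m + 1000000 + CC s.m0)) - ((1000000:ℝ) * (125000 * m + ah) * s.m0 + g2 * (1000000 * m + s.ly * s.m0))) / (1000000000000 * s.m0) := by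
        field_simp; ring
      rw [e]
      exact div_nonneg (by linarith) (by positivity)
    have h1 := lin_slab s y _ _ hy (hP _ hg2.1) (by
        have hg := hg2.2
        rcases m1c with ⟨hz, hb⟩ | ⟨hz, hb⟩
        · left
          rw [hb, cond_true] at hg
          have : (2000000:ℝ) * s.m0 + 16 * g2 ≤ g2 * s.m0 := by exact_mod_cast (Nat.le_of_ble_eq_true hg)
          refine ⟨hz, ?_⟩
          have e : ((g2:ℝ) / 1000000 * (1 / 2 - 8 / s.m0) - 1) = (g2 * s.m0 - (2000000 * s.m0 + 16 * g2)) / (2000000 * s.m0) := by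
            field_simp; ring
          rw [e]
          exact div_nonneg (by linarith) (by positivity)
        · right
          rw [hb, cond_false] at hg
          exact ⟨hz, hP _ hg⟩)
    have e : (g2:ℝ) / 1000000 * (y / 2 - 8 * y / s.m0 + 1 - s.ly / 1000000 + CC s.m0 / 1000000) =
       ((g2:ℝ) / 1000000 * (1 / 2 - 8 / s.m0) - 1) * y + ((g2:ℝ) / 1000000 * (1 - s.ly / 1000000 + CC s.m0 / 1000000) - ah / 1000000 + 1.15) + y + ah / 1000000 - 1.15 := by ring
    rw [e]
    linarith
  · -- hr
    have hia : 1 / (a:ℝ) ≤ 1 / 3 := one_div_le_one_div_of_le (by norm_num) haR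
    have hia0 : 0 < 1 / (a:ℝ) := by positivity
    have hden : 0 < y - 1.5 - 1 / a := by linarith
    have hla : 0 ≤ Real.log a := Real.log_nonneg (by linarith)
    have : (q:ℝ) / 1000000 ≤ Real.log a / (y - 1.5 - 1 / a) := by
      rcases m1c with ⟨hz, hb⟩ | ⟨hz, hb⟩
      · rw [hb, cond_true] at e5
        have : q = 0 := Nat.eq_of_beq_eq_true e5
        rw [this]; simp only [Nat.cast_zero, zero_div]; positivity
      · rw [hb, cond_false] at e5
        have h1 : (q:ℝ) * (125000 * s.m1) ≤ lam * 1000000 + q * 1500000 := by exact_mod_cast (Nat.le_of_ble_eq_true e5)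
        have h2 := hy.2.resolve_left hz
        rw [le_div_iff₀ hden]
        have h3 : (q:ℝ) / 1000000 * (y - 1.5 - 1 / a) ≤ (q:ℝ) / 1000000 * (s.m1 / 8 - 1.5) := mul_le_mul_of_nonneg_left (by linarith) (by positivity)
        linarith
    linarith
  · -- hV
    have h3 : (125000 * (s.m0:ℝ) + ((ah - 1150000 : ℕ) : ℝ)) * ((cops a τ).card * (1000000 + (s.E:ℝ)) ^ 2 + 8 * (s.E:ℝ) ^ 2) ≤ err * (4 * (125000 * (s.m0:ℝ)) ^ 2) := by exact_mod_cast e3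
    have h4 : ((V:ℝ) * Nat.totient a + Wt a τ * g2 + Nat.totient a * err) * 1000 ≤ coefA (τ * s.blo) * τ * g1 * Nat.totient a := by exact_mod_cast e4
    have h5 : (1 + ((ah - 1150000 : ℕ) : ℝ) / (125000 * s.m0)) / (s.m0 / 8) * ((cops a τ).card * (1 + (s.E:ℝ) / 1000000) ^ 2 / 4 + 2 * ((s.E:ℝ) / 1000000) ^ 2) =
       (125000 * (s.m0:ℝ) + ((ah - 1150000 : ℕ) : ℝ)) * ((cops a τ).card * (1000000 + (s.E:ℝ)) ^ 2 + 8 * (s.E:ℝ) ^ 2) / (4 * (125000 * (s.m0:ℝ)) ^ 2) / 1000000 := by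
      field_simp; ring
    have h6 : (125000 * (s.m0:ℝ) + ((ah - 1150000 : ℕ) : ℝ)) * ((cops a τ).card * (1000000 + (s.E:ℝ)) ^ 2 + 8 * (s.E:ℝ) ^ 2) / (4 * (125000 * (s.m0:ℝ)) ^ 2) ≤ err := by
      rw [div_le_iff₀ (by positivity)]; exact h3
    rw [h5]
    have h7 : (V:ℝ) / 1000000 + Wt a τ / Nat.totient a * (g2 / 1000000) + err / 1000000 ≤ coefA (τ * s.blo) / 1000 * τ * (g1 / 1000000) := by
      have e : (V:ℝ) / 1000000 + Wt a τ / Nat.totient a * (g2 / 1000000) + err / 1000000 = ((V:ℝ) * Nat.totient a + Wt a τ * g2 + Nat.totient a * err) * 1000 / (Nat.totient a * 1000000000) := by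
        field_simp; ring
      rw [e, div_le_iff₀ (by positivity)]
      refine h4.trans (le_of_eq ?_)
      ring
    linarith

theorem small_case (T : List Sl) (hT : allSl slabChk T = true) (hT2 : chainSl T 33 = true) (a b : ℕ) (ha : 3 ≤ a) (ha2 : a < 100000) (hab : a < b) (h : Nat.Coprime a b) (δ : ℝ) (hδ : 0 < δ)
    (hδ' : δ < Real.exp (-(3 / 2))) (h17 : 17 ≤ δ * (S a b : ℝ)) (haS : (a : ℝ) < δ * (S a b : ℝ))
    (hb : (33:ℝ) / 8 ≤ Real.log b) (hc : smallA T a = true) :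
    (1 - 2 / (Nat.totient a : ℝ) * (N δ a : ℝ) * (1 - Real.log a / Real.log (δ * (S a b : ℝ)))⁻¹ -
        Real.log (δ * (S a b : ℝ)) / (δ * (S a b : ℝ))) * δ * (Nat.primeCounting (S a b) : ℝ) < (piStar a b : ℝ) := by
  unfold smallA at hc
  simp only [force_eq] at hc
  rw [phiC_eq a (by omega)] at hc
  have h1 := cops_one a (by omega)
  have h2 := Wt_one a (by omega)
  have hc' : outerL a (a / 48 + 1) (fun l => allSl (smallCell a a.totient (loglo (a - 1)) (loghi (a - 1)) (loglo a) (loglo (a + 1)) l) T)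
    (a / 2 / (a / 48 + 1)) 1 (cops a 1).card (Wt a 1) [⟨0, 0, 1, 0, 0⟩] = true := by rw [h1, h2]; exact hc
  obtain ⟨l, hl, hF⟩ := outerL_sound a _ (by omega) _ _ 1 _ le_rfl (by
    refine ⟨?_, fun x h1 h2 => by omega⟩
    intro e he
    simp only [List.mem_singleton] at he
    subst he
    exact ⟨le_rfl, h1.symm, h2.symm⟩) hc'
  obtain ⟨s, hs, hsy⟩ := chain_cover T (Real.log b) 33 hT2 (by exact_mod_cast hb)
  have hcell := allSl_mem _ _ hF s hs
  have hchk := allSl_mem _ _ hT s hs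
  unfold smallCell at hcell
  have hnoskip : (Nat.blt 0 s.m1 && Nat.blt (125000 * s.m1) (loglo (a + 1))) = false := by
    rw [Bool.eq_false_iff]
    intro hcon
    rw [Bool.and_eq_true, Nat.blt_eq, Nat.blt_eq] at hcon
    obtain ⟨k1, k2⟩ := hcon
    have k3 := hsy.2.resolve_left (by omega)
    have k4 := loglo_le (a + 1) (by omega)
    have k5 : Real.log ((a + 1 : ℕ):ℝ) ≤ Real.log b := Real.log_le_log (by positivity) (by exact_mod_cast hab)
    have k6 : (125000:ℝ) * s.m1 < loglo (a + 1) := by exact_mod_cast k2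
    linarith
  rw [hnoskip, cond_false] at hcell
  simp only [force_eq] at hcell
  generalize maxN (g2Of (loghi (a - 1)) (CC s.m0) s s.m0) (cond (Nat.beq s.m1 0) (2000000 * s.m0 / (s.m0 - 16) + 1) (g2Of (loghi (a - 1)) (CC s.m0) s s.m1)) = g2 at hcell
  rw [Bool.and_eq_true, Bool.and_eq_true] at hcell
  obtain ⟨hg, hp⟩ := hcell
  obtain ⟨τ, hτ, hk⟩ := pickL_sound a _ g2 _ _ l hl hp
  refine small_fin a b ha ha2 hab h δ hδ hδ' h17 haS s hchk hsy g2 _ l hl ?_ τ hτ hg hk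
  -- coverage length
  have hB : a / 2 < (a / 2 / (a / 48 + 1)) * (a / 48 + 1) + (a / 48 + 1) := by
    have := Nat.div_add_mod (a / 2) (a / 48 + 1)
    have h4 := Nat.mod_lt (a / 2) (show 0 < a / 48 + 1 by omega)
    rw [mul_comm]; omega
  omega

end PS
end

section
namespace PS

theorem TS_ok : allSl slabChk TS = true := by decide +kernel
theorem TS_ch : chainSl TS 33 = true := by decide +kernel
set_option maxRecDepth 100000 in
theorem sm1 : smallAll TS 150 3 = true := by decide +kernel
set_option maxRecDepth 100000 in
theorem sm2 : smallAll TS 180 153 = true := by decide +kernel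
set_option maxRecDepth 100000 in
theorem sm3 : smallAll TS 179 333 = true := by decide +kernel

theorem small_done (a b : ℕ) (ha : 3 ≤ a) (ha2 : a < 512) (hab : a < b) (h : Nat.Coprime a b) (δ : ℝ) (hδ : 0 < δ)
    (hδ' : δ < Real.exp (-(3 / 2))) (h17 : 17 ≤ δ * (S a b : ℝ)) (haS : (a : ℝ) < δ * (S a b : ℝ)) (hb : 62 ≤ b) :
    (1 - 2 / (Nat.totient a : ℝ) * (N δ a : ℝ) * (1 - Real.log a / Real.log (δ * (S a b : ℝ)))⁻¹ -
        Real.log (δ * (S a b : ℝ)) / (δ * (S a b : ℝ))) * δ * (Nat.primeCounting (S a b) : ℝ) < (piStar a b : ℝ) := by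
  have hc : smallA TS a = true := by
    rcases lt_or_ge a 153 with h1 | h1
    · exact smallAll_sound TS 150 3 sm1 a ha h1
    rcases lt_or_ge a 333 with h2 | h2
    · exact smallAll_sound TS 180 153 sm2 a h1 h2
    · exact smallAll_sound TS 179 333 sm3 a h2 ha2
  have hbl : (33:ℝ) / 8 ≤ Real.log b := by
    have hbR : (62:ℝ) ≤ b := by exact_mod_cast hb
    have h1 : Real.log 62 ≤ Real.log b := Real.log_le_log (by norm_num) hbR
    have h2 : (33:ℝ) ≤ Real.log (62 ^ 8) := by
      rw [Real.le_log_iff_exp_le (by norm_num)]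
      have := exp_nat_hi 33
      norm_num at this ⊢
      linarith
    rw [Real.log_pow] at h2
    norm_num at h2
    linarith
  exact small_case TS TS_ok TS_ch a b ha (by omega) hab h δ hδ hδ' h17 haS hbl hc

end PS
end

section
namespace PS

def PL : List ℕ := [2, 3, 5, 7, 11, 13, 17, 19, 23, 29, 31, 37, 41, 43, 47, 53, 59, 61, 67, 71, 73, 79, 83, 89, 97, 101, 103, 107, 109, 113, 127, 131, 137, 139, 149, 151, 157, 163, 167, 173, 179, 181, 191, 193, 197, 199, 211, 223, 227, 229, 233, 239, 241, 251, 257, 263, 269, 271, 277, 281, 283, 293, 307, 311, 313, 317, 331, 337, 347, 349, 353, 359, 367, 373, 379, 383, 389, 397, 401, 409, 419, 421, 431, 433, 439, 443, 449, 457, 461, 463, 467, 479, 487, 491, 499, 503, 509, 521, 523, 541, 547, 557, 563, 569, 571, 577, 587, 593, 599, 601, 607, 613, 617, 619, 631, 641, 643, 647, 653, 659, 661, 673, 677, 683, 691]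

theorem PL_aux : ∀ p ∈ PL, p ∈ [2, 3, 5, 7, 11, 13, 17, 19, 23] ∨ (26 < p ∧ p < 729 ∧ Nat.gcd p 403291461126605635584000000 = 1) := by decide +kernel
theorem PL_prime : ∀ p ∈ PL, p.Prime := by
  intro p hp
  rcases PL_aux p hp with h | ⟨h1, h2, h3⟩
  · fin_cases h <;> norm_num
  · refine (prime_iff_gcd 26 p h1 (by omega) (by omega)).2 ?_
    rw [← h3]; rfl
theorem PL_nodup : PL.Nodup := by decide +kernel

def nrT (a b i p : ℕ) : Bool := force (Nat.mul (Nat.mod (Nat.mul p i) a) b) fun w => cond (Nat.ble w p) false (Nat.beq (Nat.mod w a) (Nat.mod p a))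

theorem nrT_sound (a b i p : ℕ) (ha : 3 ≤ a) (h : Nat.Coprime a b) (ht : nrT a b i p = true) : ¬ ∃ u v : ℕ, p = a * u + b * v := by
  rintro ⟨u, v, rfl⟩
  have e : nrT a b i (a * u + b * v) = cond (Nat.ble ((a * u + b * v) * i % a * b) (a * u + b * v)) false
    (Nat.beq ((a * u + b * v) * i % a * b % a) ((a * u + b * v) % a)) := by unfold nrT; rw [force_eq]; rfl
  rw [e] at ht
  have hw : (a * u + b * v) * i % a < a := Nat.mod_lt _ (by omega)
  generalize (a * u + b * v) * i % a = w at *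
  cases hb : Nat.ble (w * b) (a * u + b * v)
  · rw [hb, cond_false] at ht
    have h1 : a * u + b * v < w * b := by
      by_contra hc
      rw [Nat.ble_eq_true_of_le (not_lt.1 hc)] at hb
      exact absurd hb (by simp)
    have h2 : w * b % a = (a * u + b * v) % a := Nat.eq_of_beq_eq_true ht
    rw [Nat.mul_add_mod, mul_comm b v] at h2
    have h3 : w ≡ v [MOD a] := Nat.ModEq.cancel_right_of_coprime (c := b) h h2
    have h4 : w ≤ v := by
      have := Nat.mod_le v a
      rw [← h3, Nat.mod_eq_of_lt hw] at this
      exact this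
    have : w * b ≤ v * b := Nat.mul_le_mul_right b h4
    have : b * v = v * b := mul_comm _ _
    omega
  · rw [hb, cond_true] at ht
    exact absurd ht (by simp)

def nrL (a b i : ℕ) (l : List ℕ) : ℕ → Bool :=
  List.rec (fun n => Nat.beq n 0) (fun p _ ih n => cond (Nat.beq n 0) true (cond (nrT a b i p) (force (Nat.pred n) fun n2 => ih n2) (ih n))) l

theorem nrL_cons (a b i p : ℕ) (l : List ℕ) (n : ℕ) : nrL a b i (p :: l) n =
    cond (Nat.beq n 0) true (cond (nrT a b i p) (nrL a b i l (n - 1)) (nrL a b i l n)) := by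
  have : nrL a b i (p :: l) n = cond (Nat.beq n 0) true (cond (nrT a b i p) (force (Nat.pred n) fun n2 => nrL a b i l n2) (nrL a b i l n)) := rfl
  rw [this, force_eq]; rfl

theorem nrL_sound (a b i : ℕ) (l : List ℕ) : ∀ n, nrL a b i l n = true → n ≤ (l.filter (fun p => nrT a b i p)).length := by
  induction l with
  | nil => intro n hn; have := Nat.eq_of_beq_eq_true (show Nat.beq n 0 = true from hn); simp [this]
  | cons p l ih =>
    intro n hn
    rw [nrL_cons] at hn
    rcases Nat.eq_zero_or_pos n with h0 | h0
    · rw [h0]; exact Nat.zero_le _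
    · have hz : Nat.beq n 0 = false := by rw [Bool.eq_false_iff, ne_eq, Nat.beq_eq]; omega
      rw [hz, cond_false] at hn
      cases hb : nrT a b i p
      · rw [hb, cond_false] at hn
        have := ih n hn
        rw [List.filter_cons, hb]
        simpa using this
      · rw [hb, cond_true] at hn
        have := ih _ hn
        rw [List.filter_cons, hb]
        simp only [if_true, List.length_cons]
        omega

theorem piStar_ge (a b i n : ℕ) (ha : 3 ≤ a) (hab : a < b) (h : Nat.Coprime a b) (hn : nrL a b i PL n = true) : n ≤ piStar a b := by
  have h1 := nrL_sound a b i PL n hn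
  have h2 : (PL.filter (fun p => nrT a b i p)).Nodup := PL_nodup.filter _
  rw [← List.toFinset_card_of_nodup h2] at h1
  refine h1.trans ?_
  rw [← Set.ncard_coe_finset]
  unfold piStar
  apply Set.ncard_le_ncard _ (nonrep_finite a b ha hab h)
  intro p hp
  have hp2 : p ∈ PL ∧ nrT a b i p = true := by simpa using hp
  exact ⟨PL_prime p hp2.1, nrT_sound a b i p ha h hp2.2⟩

def mxL (a pK c1 X fuel : ℕ) : ℕ → ℕ → ℕ → ℕ :=
  Nat.rec (fun _ _ acc => acc) (fun _ ih v n acc =>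
    force (maxN acc (Nat.mul (Nat.mul c1 (Nat.sub pK (Nat.mul 2000000 n))) (minN (Nat.mul v 100000) X))) fun acc2 =>
    force (Nat.add n (co v a)) fun n2 => force (Nat.succ v) fun v2 => ih v2 n2 acc2) fuel

theorem maxN_ge (x y : ℕ) : x ≤ maxN x y ∧ y ≤ maxN x y := by
  unfold maxN
  rcases le_or_gt x y with h | h
  · rw [Nat.ble_eq_true_of_le h, cond_true]; exact ⟨h, le_rfl⟩
  · have : Nat.ble x y = false := Bool.eq_false_iff.2 (by rw [ne_eq, Nat.ble_eq]; omega)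
    rw [this, cond_false]; exact ⟨le_rfl, h.le⟩

theorem mxL_sound (a pK c1 X fuel : ℕ) (ha : 1 ≤ a) : ∀ v acc, acc ≤ mxL a pK c1 X fuel v (cops a v).card acc ∧
    ∀ x, v ≤ x → x < v + fuel → c1 * (pK - 2000000 * (cops a x).card) * min (x * 100000) X ≤ mxL a pK c1 X fuel v (cops a v).card acc := by
  induction fuel with
  | zero => intro v acc; exact ⟨le_rfl, fun x h1 h2 => by omega⟩
  | succ f ih =>
    intro v acc
    have e : mxL a pK c1 X (f + 1) v (cops a v).card acc = mxL a pK c1 X f (v + 1) ((cops a v).card + co v a)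
      (maxN acc (c1 * (pK - 2000000 * (cops a v).card) * minN (v * 100000) X)) := by
      unfold mxL
      simp only [force_eq]; rfl
    rw [e, ← cops_succ a v ha, minN_eq]
    obtain ⟨h1, h2⟩ := ih (v + 1) (maxN acc (c1 * (pK - 2000000 * (cops a v).card) * min (v * 100000) X))
    obtain ⟨h3, h4⟩ := maxN_ge acc (c1 * (pK - 2000000 * (cops a v).card) * min (v * 100000) X)
    refine ⟨h3.trans h1, ?_⟩
    intro x hx1 hx2
    rcases Nat.eq_or_lt_of_le hx1 with rfl | hlt
    · exact h4.trans h1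
    · exact h2 x hlt (by omega)

def sbV (a φ : ℕ) : ℕ := mxL a (φ * 1000000) (10877 * (a - 1)) (22314 * a) (22314 * a / 100000 + 1) 1 0 0 / (a * φ * 1000000000) + 1

def sbChk (a φ V b : ℕ) : Bool :=
  cond (Nat.blt (a * b) (a + b + 77)) true (cond (Nat.beq (Nat.gcd a b) 1)
    (force (loglo ((a - 1) * b) - 1150000) fun l => force (V * b / l + 1) fun n => force (Nat.mod (b ^ (φ - 1)) a) fun i =>
      Nat.ble 1 l && (Nat.ble (V * b) (n * l) && nrL a b i PL n)) true)

def sbB (a φ V fuel : ℕ) : ℕ → Bool :=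
  Nat.rec (fun _ => true) (fun _ ih b => cond (sbChk a φ V b) (force (Nat.succ b) fun b2 => ih b2) false) fuel

theorem sbB_sound (a φ V fuel : ℕ) : ∀ b, sbB a φ V fuel b = true → ∀ i, b ≤ i → i < b + fuel → sbChk a φ V i = true := by
  induction fuel with
  | zero => intro a _ i h1 h2; omega
  | succ f ih =>
    intro b h i h1 h2
    have e : sbB a φ V (f + 1) b = cond (sbChk a φ V b) (sbB a φ V f (b + 1)) false := by
      unfold sbB
      simp only [force_eq]
    rw [e] at h
    cases hb : sbChk a φ V b
    · rw [hb] at h; simp at h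
    · rw [hb] at h
      rcases Nat.eq_or_lt_of_le h1 with rfl | hlt
      · exact hb
      · exact ih (b + 1) h i hlt (by omega)

def sbAll (a0 : ℕ) : Bool := force a0 fun a => force (phiC a) fun φ => force (sbV a φ) fun V => force (a + 1) fun b => sbB a φ V (61 - a) b

set_option maxRecDepth 100000 in
theorem sbAll_ok : ∀ a ∈ List.range' 3 58, sbAll a = true := by decide +kernel

theorem small_b (a b : ℕ) (ha : 3 ≤ a) (hab : a < b) (h : Nat.Coprime a b) (δ : ℝ) (hδ : 0 < δ)
    (hδ' : δ < Real.exp (-(3 / 2))) (h17 : 17 ≤ δ * (S a b : ℝ)) (haS : (a : ℝ) < δ * (S a b : ℝ)) (hb : b < 62) :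
    (1 - 2 / (Nat.totient a : ℝ) * (N δ a : ℝ) * (1 - Real.log a / Real.log (δ * (S a b : ℝ)))⁻¹ -
        Real.log (δ * (S a b : ℝ)) / (δ * (S a b : ℝ))) * δ * (Nat.primeCounting (S a b) : ℝ) < (piStar a b : ℝ) := by
  have e1 := exp_bd
  have hS77 : 76 < S a b := by
    by_contra hc
    have : (S a b : ℝ) ≤ 76 := by exact_mod_cast not_lt.1 hc
    nlinarith
  have hSb : ¬ a * b < a + b + 77 := by unfold S at hS77; omega
  have hc := sbAll_ok a (by rw [List.mem_range'_1]; omega)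
  unfold sbAll at hc
  simp only [force_eq] at hc
  rw [phiC_eq a (by omega)] at hc
  have hc := sbB_sound _ _ _ _ _ hc b (by omega) (by omega)
  obtain ⟨V, hV⟩ : ∃ V, V = sbV a (Nat.totient a) := ⟨_, rfl⟩
  rw [← hV] at hc
  unfold sbChk at hc
  have hbl : Nat.blt (a * b) (a + b + 77) = false := by rw [Bool.eq_false_iff, ne_eq, Nat.blt_eq]; exact hSb
  have hg : Nat.beq (Nat.gcd a b) 1 = true := by rw [h]; rfl
  rw [hbl, hg, cond_false, cond_true] at hc
  simp only [force_eq] at hc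
  generalize V * b / (loglo ((a - 1) * b) - 1150000) + 1 = n at hc
  generalize Nat.mod (b ^ (Nat.totient a - 1)) a = i at hc
  simp only [Bool.and_eq_true, Nat.ble_eq] at hc
  obtain ⟨c1, c2, c3⟩ := hc
  have hpi := piStar_ge a b i n ha hab h c3
  have hφ0 : 0 < Nat.totient a := Nat.totient_pos.2 (by omega)
  have hM := hM_small a ha δ hδ hδ' 0 V (22314 * a / 100000 + 2) _ rfl (by omega) (by
    intro x hx1 hx2
    have := (mxL_sound a (Nat.totient a * 1000000) (10877 * (a - 1)) (22314 * a) (22314 * a / 100000 + 1) (by omega) 1 0).2 x hx1 (by omega)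
    rw [cops_one a (by omega)] at this
    simp only [add_zero, Nat.reduceMul]
    refine this.trans ?_
    have h2 := Nat.lt_div_mul_add (a := mxL a (Nat.totient a * 1000000) (10877 * (a - 1)) (22314 * a) (22314 * a / 100000 + 1) 1 0 0) (b := a * Nat.totient a * 1000000000) (by positivity)
    rw [hV]
    unfold sbV
    generalize mxL a (Nat.totient a * 1000000) (10877 * (a - 1)) (22314 * a) (22314 * a / 100000 + 1) 1 0 0 = R at *
    refine h2.le.trans (le_of_eq ?_)
    ring)
  have haR : (3:ℝ) ≤ a := by exact_mod_cast ha
  have hb7 : 7 ≤ b := by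
    by_contra hcc
    have : a * b ≤ 6 * 6 := Nat.mul_le_mul (by omega) (by omega)
    omega
  have hb7R : (7:ℝ) ≤ b := by exact_mod_cast hb7
  have hlb : (11:ℝ) / 6 ≤ Real.log b := by
    have h1 : Real.log 7 ≤ Real.log b := Real.log_le_log (by norm_num) hb7R
    have h2 : (11:ℝ) ≤ Real.log (7 ^ 6) := by
      rw [Real.le_log_iff_exp_le (by norm_num)]
      have := exp_nat_hi 11
      norm_num at this ⊢
      linarith
    rw [Real.log_pow] at h2
    norm_num at h2
    linarith
  have hr : (1:ℝ) ≤ 1 + Real.log a / (Real.log b - 1.5 - 1 / a) := by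
    have h1 : (1:ℝ) / a ≤ 1 / 3 := one_div_le_one_div_of_le (by norm_num) haR
    have : 0 ≤ Real.log a / (Real.log b - 1.5 - 1 / a) := div_nonneg (Real.log_nonneg (by linarith)) (by linarith)
    linarith
  have hu := upper_main a b ha hab δ hδ hδ' h17 haS 1 hr
  refine hu.trans_le ?_
  have hpos : 1 ≤ (a - 1) * b := Nat.mul_pos (by omega) (by omega)
  have hl := loglo_le ((a - 1) * b) hpos
  have hcast : (((a - 1) * b : ℕ) : ℝ) = ((a:ℝ) - 1) * b := by rw [Nat.cast_mul, Nat.cast_sub (by omega)]; simp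
  rw [hcast] at hl
  have hl2 : ((loglo ((a - 1) * b) - 1150000 : ℕ) : ℝ) = (loglo ((a - 1) * b) : ℝ) - 1150000 := by
    rw [Nat.cast_sub (by omega)]; norm_num
  have c2R : (V:ℝ) * b ≤ n * ((loglo ((a - 1) * b) : ℝ) - 1150000) := by rw [← hl2]; exact_mod_cast c2
  have c1R : (1:ℝ) ≤ (loglo ((a - 1) * b) : ℝ) - 1150000 := by rw [← hl2]; exact_mod_cast c1
  have hpiR : (n:ℝ) ≤ piStar a b := by exact_mod_cast hpi
  refine le_trans ?_ hpiR
  rw [div_le_iff₀ (by linarith)]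
  simp only [Nat.cast_zero, zero_div, add_zero] at hM
  have h3 := mul_le_mul_of_nonneg_right hM (by linarith : (0:ℝ) ≤ b)
  have h4 : (n:ℝ) * ((loglo ((a - 1) * b) : ℝ) - 1150000) ≤ n * (1000000 * (Real.log (((a:ℝ) - 1) * b) - 1.15)) :=
    mul_le_mul_of_nonneg_left (by linarith) (Nat.cast_nonneg _)
  linarith

end PS
end

section
namespace PS

/-- integers up to j free of prime factors in P. -/
def fP (P : Finset ℕ) (j : ℕ) : ℕ := ((Finset.Ioc 0 j).filter (fun v => ∀ p ∈ P, ¬ p ∣ v)).card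

theorem fP_insert (P : Finset ℕ) (p : ℕ) (hP : ∀ q ∈ P, q.Prime) (hp : p.Prime) (hpP : p ∉ P) (j : ℕ) :
    fP (insert p P) j + fP P (j / p) = fP P j := by
  unfold fP
  have h1 := Finset.card_filter_add_card_filter_not (s := (Finset.Ioc 0 j).filter (fun v => ∀ q ∈ P, ¬ q ∣ v)) (fun v => ¬ p ∣ v)
  rw [← h1]
  congr 1
  · congr 1
    rw [Finset.filter_filter]
    ext v
    simp only [Finset.mem_filter, Finset.forall_mem_insert]
    tauto
  · symm
    apply Finset.card_bij' (fun v _ => v / p) (fun w _ => p * w)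
    · intro v hv
      simp only [Finset.mem_filter, Finset.mem_Ioc, not_not] at hv ⊢
      obtain ⟨⟨⟨h2, h3⟩, h4⟩, w, rfl⟩ := hv
      rw [Nat.mul_div_cancel_left _ hp.pos]
      refine ⟨⟨Nat.pos_of_mul_pos_left h2, ?_⟩, fun q hq hqw => h4 q hq (hqw.mul_left p)⟩
      rw [Nat.le_div_iff_mul_le hp.pos, mul_comm]; exact h3
    · intro w hw
      simp only [Finset.mem_filter, Finset.mem_Ioc, not_not] at hw ⊢
      obtain ⟨⟨h2, h3⟩, h4⟩ := hw
      rw [Nat.le_div_iff_mul_le hp.pos, mul_comm] at h3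
      refine ⟨⟨⟨Nat.mul_pos hp.pos h2, h3⟩, fun q hq hqw => ?_⟩, dvd_mul_right p w⟩
      rcases (hP q hq).dvd_mul.1 hqw with h5 | h5
      · rw [Nat.prime_dvd_prime_iff_eq (hP q hq) hp] at h5
        exact hpP (h5 ▸ hq)
      · exact h4 q hq h5
    · intro v hv
      simp only [Finset.mem_filter, not_not] at hv
      exact Nat.mul_div_cancel' hv.2
    · intro w _
      exact Nat.mul_div_cancel_left _ hp.pos

noncomputable def EP (P : Finset ℕ) (x : ℝ) : ℝ := fP P ⌊x⌋₊ - x * ∏ p ∈ P, (1 - (p:ℝ)⁻¹)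

theorem EP_insert (P : Finset ℕ) (p : ℕ) (hP : ∀ q ∈ P, q.Prime) (hp : p.Prime) (hpP : p ∉ P) (x : ℝ) :
    EP (insert p P) x = EP P x - EP P (x / p) := by
  unfold EP
  have h1 := fP_insert P p hP hp hpP ⌊x⌋₊
  rw [← Nat.floor_div_natCast] at h1
  have h2 : (fP (insert p P) ⌊x⌋₊ : ℝ) + fP P ⌊x / p⌋₊ = fP P ⌊x⌋₊ := by exact_mod_cast h1
  rw [Finset.prod_insert hpP, ← h2, div_eq_mul_inv]
  ring

theorem EP_empty (x : ℝ) (hx : 0 ≤ x) : |EP ∅ x + 1 / 2| ≤ 1 / 2 := by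
  unfold EP fP
  simp only [Finset.notMem_empty, false_imp_iff, implies_true, Finset.filter_true, Nat.card_Ioc, Finset.prod_empty, Nat.sub_zero]
  have h1 := Nat.floor_le hx
  have h2 := (Nat.lt_floor_add_one x).le
  rw [abs_le]
  constructor <;> linarith

theorem EP_two (x : ℝ) (hx : 0 ≤ x) : |EP {2} x| ≤ 1 / 2 := by
  have h0 := EP_insert ∅ 2 (by simp) Nat.prime_two (by simp) x
  rw [show insert 2 (∅ : Finset ℕ) = {2} by rfl] at h0
  rw [h0]
  unfold EP fP
  simp only [Finset.notMem_empty, false_imp_iff, implies_true, Finset.filter_true, Nat.card_Ioc, Finset.prod_empty, Nat.sub_zero]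
  rw [Nat.floor_div_natCast x 2]
  have h1 := Nat.floor_le hx
  have h2 := (Nat.lt_floor_add_one x).le
  generalize ⌊x⌋₊ = n at *
  rcases Nat.even_or_odd' n with ⟨m, rfl | rfl⟩
  · rw [show 2 * m / 2 = m by omega]
    push_cast at *
    rw [abs_le]; constructor <;> linarith
  · rw [show (2 * m + 1) / 2 = m by omega]
    push_cast at *
    rw [abs_le]; constructor <;> linarith

theorem EP_bound (B : Finset ℕ) (c : ℝ) (hB : ∀ q ∈ B, q.Prime) (h0 : ∀ x, 0 ≤ x → |EP B x + c| ≤ 1 / 2) (Q : Finset ℕ)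
    (hQ : ∀ q ∈ Q, q.Prime) (hd : ∀ q ∈ Q, q ∉ B) :
    ∀ x, 0 ≤ x → |EP (Q ∪ B) x + (if Q = ∅ then c else 0)| ≤ 2 ^ Q.card / 2 := by
  induction Q using Finset.induction_on with
  | empty => intro x hx; simpa using h0 x hx
  | insert p Q hp ih =>
    intro x hx
    have ih2 := ih (fun q hq => hQ q (Finset.mem_insert_of_mem hq)) (fun q hq => hd q (Finset.mem_insert_of_mem hq))
    have h1 := ih2 x hx
    have h2 := ih2 (x / p) (by positivity)
    have hpp := hQ p (Finset.mem_insert_self _ _)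
    have h3 : p ∉ Q ∪ B := by
      rw [Finset.mem_union, not_or]; exact ⟨hp, hd p (Finset.mem_insert_self _ _)⟩
    have h4 := EP_insert (Q ∪ B) p (by
      intro q hq
      rcases Finset.mem_union.1 hq with h | h
      · exact hQ q (Finset.mem_insert_of_mem h)
      · exact hB q h) hpp h3 x
    rw [Finset.insert_union, h4, if_neg (Finset.insert_ne_empty _ _), Finset.card_insert_of_notMem hp, pow_succ]
    rw [abs_le] at *
    constructor <;> linarith [h1.1, h1.2, h2.1, h2.2]

theorem EP_main (P : Finset ℕ) (hP : ∀ q ∈ P, q.Prime) (hne : P ≠ ∅) (x : ℝ) (hx : 0 ≤ x) :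
    |EP P x| ≤ 2 ^ (P.erase 2).card / 2 := by
  by_cases h2 : 2 ∈ P
  · have := EP_bound {2} 0 (by simp [Nat.prime_two]) (by intro x hx; simpa using EP_two x hx) (P.erase 2)
      (fun q hq => hP q (Finset.mem_of_mem_erase hq)) (by intro q hq; simpa using Finset.ne_of_mem_erase hq) x hx
    rw [Finset.union_comm, show {2} ∪ P.erase 2 = P by rw [← Finset.insert_eq, Finset.insert_erase h2]] at this
    simpa using this
  · have := EP_bound ∅ (1 / 2) (by simp) (fun x hx => EP_empty x hx) P hP (by simp) x hx
    rw [Finset.erase_eq_of_notMem h2]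
    simpa [hne] using this

theorem cops_fP (a j : ℕ) (ha : 2 ≤ a) : (cops a (j + 1)).card = fP a.primeFactors j := by
  unfold cops fP
  congr 1
  ext v
  simp only [Finset.mem_filter, Finset.mem_range, Finset.mem_Ioc]
  have h1 : Nat.Coprime v a ↔ ∀ p ∈ a.primeFactors, ¬ p ∣ v := by
    rw [Nat.coprime_iff_gcd_eq_one]
    constructor
    · intro h p hp hpv
      have := Nat.dvd_gcd hpv (Nat.dvd_of_mem_primeFactors hp)
      rw [h] at this
      exact (Nat.prime_of_mem_primeFactors hp).one_lt.ne' (Nat.dvd_one.1 this)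
    · intro h
      by_contra hc
      obtain ⟨p, hp, hpd⟩ := Nat.exists_prime_and_dvd hc
      exact h p (Nat.mem_primeFactors.2 ⟨hp, hpd.trans (Nat.gcd_dvd_right _ _), by omega⟩) (hpd.trans (Nat.gcd_dvd_left _ _))
  rw [h1]
  constructor
  · rintro ⟨h2, h3⟩
    refine ⟨⟨Nat.pos_of_ne_zero ?_, by omega⟩, h3⟩
    rintro rfl
    exact h3 _ (Nat.mem_primeFactors.2 ⟨Nat.minFac_prime (by omega : a ≠ 1), Nat.minFac_dvd a, by omega⟩) (dvd_zero _)
  · rintro ⟨⟨_, h2⟩, h3⟩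
    exact ⟨by omega, h3⟩

theorem tot_prod (a : ℕ) : (Nat.totient a : ℝ) = a * ∏ p ∈ a.primeFactors, (1 - (p:ℝ)⁻¹) := by
  have := Nat.totient_eq_mul_prod_factors a
  have h2 := congrArg (fun q : ℚ => (q : ℝ)) this
  push_cast at h2
  exact h2

def Disc (a j : ℕ) : Prop := (cops a (j + 1)).card * (a:ℝ) ≤ Nat.totient a * (j + 0.012 * a) ∧
  Nat.totient a * ((j:ℝ) + 1 - 0.012 * a) ≤ (cops a (j + 1)).card * (a:ℝ)

theorem disc_of (a : ℕ) (ha : 2 ≤ a) (hD : (2:ℝ) ^ (a.primeFactors.erase 2).card / 2 ≤ 0.012 * Nat.totient a) (j : ℕ) : Disc a j := by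
  have haR : (0:ℝ) < a := by exact_mod_cast (by omega : 0 < a)
  have hne : a.primeFactors ≠ ∅ := by
    intro h
    have : a.minFac ∈ a.primeFactors := Nat.mem_primeFactors.2 ⟨Nat.minFac_prime (by omega : a ≠ 1), Nat.minFac_dvd a, by omega⟩
    rw [h] at this
    exact absurd this (Finset.notMem_empty _)
  have key : ∀ x : ℝ, (j:ℝ) ≤ x → x < j + 1 → |(cops a (j + 1)).card * (a:ℝ) - Nat.totient a * x| ≤ a * (0.012 * Nat.totient a) := by
    intro x h1 h2
    have hx : 0 ≤ x := le_trans (Nat.cast_nonneg _) h1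
    have h3 := EP_main a.primeFactors (fun q hq => Nat.prime_of_mem_primeFactors hq) hne x hx
    have hf : ⌊x⌋₊ = j := by rw [Nat.floor_eq_iff hx]; exact ⟨h1, h2⟩
    have h4 : (cops a (j + 1)).card * (a:ℝ) - Nat.totient a * x = a * EP a.primeFactors x := by
      unfold EP
      rw [hf, cops_fP a j ha, tot_prod]; ring
    rw [h4, abs_mul, abs_of_pos haR]
    exact mul_le_mul_of_nonneg_left (h3.trans hD) haR.le
  constructor
  · have := (abs_le.1 (key j le_rfl (by linarith))).2
    linarith
  · apply le_of_forall_pos_le_add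
    intro η hη
    have hφ0 : (0:ℝ) < Nat.totient a := by exact_mod_cast Nat.totient_pos.2 (by omega)
    obtain ⟨ξ, h1, h2, h3⟩ : ∃ ξ : ℝ, 0 < ξ ∧ ξ ≤ 1 ∧ Nat.totient a * ξ ≤ η := by
      refine ⟨min 1 (η / Nat.totient a), by positivity, min_le_left _ _, ?_⟩
      calc (Nat.totient a : ℝ) * min 1 (η / Nat.totient a) ≤ Nat.totient a * (η / Nat.totient a) := mul_le_mul_of_nonneg_left (min_le_right _ _) hφ0.le
        _ = η := by field_simp
    have := (abs_le.1 (key (j + 1 - ξ) (by linarith) (by linarith))).1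
    linarith

noncomputable def mf (p : ℕ) : ℝ := if p = 2 then 1 / 4 else if p = 3 then 1 / 9 else if p = 5 then 8 / 25 else if p = 7 then 27 / 49 else 1

theorem mf_pos (p : ℕ) : 0 ≤ mf p := by
  unfold mf; split_ifs <;> norm_num

theorem mf_le (p : ℕ) (hp : p.Prime) : mf p * (if p = 2 then 1 else 8) ≤ p * (1 - (p:ℝ)⁻¹) ^ 3 := by
  unfold mf
  by_cases h2 : p = 2
  · subst h2; norm_num
  by_cases h3 : p = 3
  · subst h3; norm_num
  by_cases h5 : p = 5
  · subst h5; norm_num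
  by_cases h7 : p = 7
  · subst h7; norm_num
  rw [if_neg h2, if_neg h3, if_neg h5, if_neg h7, if_neg h2]
  have h11 : 11 ≤ p := by
    by_contra hc
    have : p ≤ 10 := by omega
    have := hp.two_le
    interval_cases p <;> first | omega | (revert hp; norm_num)
  have hR : (11:ℝ) ≤ p := by exact_mod_cast h11
  have h4 : (10:ℝ) / 11 ≤ 1 - (p:ℝ)⁻¹ := by
    have : (p:ℝ)⁻¹ ≤ 11⁻¹ := inv_anti₀ (by norm_num) hR
    linarith
  calc (1:ℝ) * 8 ≤ 11 * (10 / 11) ^ 3 := by norm_num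
    _ ≤ _ := by gcongr

theorem prod_mf (P : Finset ℕ) : ∏ p ∈ P, mf p = (if 2 ∈ P then 1 / 4 else 1) * (if 3 ∈ P then 1 / 9 else 1) * (if 5 ∈ P then 8 / 25 else 1) * (if 7 ∈ P then 27 / 49 else 1) := by
  have h1 : ∏ p ∈ P, mf p = ∏ p ∈ ({2, 3, 5, 7} : Finset ℕ), (if p ∈ P then mf p else 1) := by
    rw [← Finset.prod_filter, Finset.filter_mem_eq_inter]
    symm
    apply Finset.prod_subset Finset.inter_subset_right
    intro p hp hn
    rw [Finset.mem_inter, not_and] at hn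
    have : p ∉ ({2, 3, 5, 7} : Finset ℕ) := fun h => hn h hp
    simp only [Finset.mem_insert, Finset.mem_singleton, not_or] at this
    unfold mf
    rw [if_neg this.1, if_neg this.2.1, if_neg this.2.2.1, if_neg this.2.2.2]
  rw [h1, Finset.prod_insert (by simp), Finset.prod_insert (by simp), Finset.prod_insert (by simp), Finset.prod_singleton]
  simp [mf, mul_assoc]

theorem disc_crit (a : ℕ) (ha : 2 ≤ a) (h : (72338:ℝ) ≤ a ^ 2 * ∏ p ∈ a.primeFactors, mf p) (j : ℕ) : Disc a j := by
  apply disc_of a ha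
  have haR : (0:ℝ) < a := by exact_mod_cast (by omega : 0 < a)
  have hφ0 : (0:ℝ) < Nat.totient a := by exact_mod_cast Nat.totient_pos.2 (by omega)
  set P := a.primeFactors with hP
  have h8 : (8:ℝ) ^ (P.erase 2).card = ∏ p ∈ P, (if p = 2 then (1:ℝ) else 8) := by
    by_cases h2 : 2 ∈ P
    · rw [← Finset.mul_prod_erase P _ h2, if_pos rfl, one_mul, Finset.prod_congr rfl (g := fun _ => (8:ℝ)), Finset.prod_const]
      intro p hp; rw [if_neg (Finset.ne_of_mem_erase hp)]
    · rw [Finset.erase_eq_of_notMem h2, Finset.prod_congr rfl (g := fun _ => (8:ℝ)), Finset.prod_const]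
      intro p hp; rw [if_neg (fun h0 : p = 2 => h2 (h0 ▸ hp))]
  have h3 : (∏ p ∈ P, mf p) * 8 ^ (P.erase 2).card ≤ (∏ p ∈ P, (p:ℝ)) * (∏ p ∈ P, (1 - (p:ℝ)⁻¹)) ^ 3 := by
    rw [h8, ← Finset.prod_mul_distrib, ← Finset.prod_pow, ← Finset.prod_mul_distrib]
    apply Finset.prod_le_prod
    · intro p _; have := mf_pos p; positivity
    · intro p hp; exact mf_le p (Nat.prime_of_mem_primeFactors hp)
  have h4 : (∏ p ∈ P, (p:ℝ)) ≤ a := by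
    have := Nat.le_of_dvd (by omega) (Nat.prod_primeFactors_dvd a)
    have h5 : ((∏ p ∈ a.primeFactors, p : ℕ) : ℝ) ≤ a := by exact_mod_cast this
    rw [Nat.cast_prod] at h5
    exact h5
  have hpr : (0:ℝ) ≤ ∏ p ∈ P, (1 - (p:ℝ)⁻¹) := by
    apply Finset.prod_nonneg
    intro p hp
    have : (1:ℝ) ≤ p := by exact_mod_cast (Nat.prime_of_mem_primeFactors hp).one_le
    have := inv_le_one_of_one_le₀ this
    linarith
  have h5 : (72338:ℝ) * 8 ^ (P.erase 2).card ≤ (Nat.totient a:ℝ) ^ 3 := by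
    calc (72338:ℝ) * 8 ^ (P.erase 2).card ≤ a ^ 2 * (∏ p ∈ P, mf p) * 8 ^ (P.erase 2).card := by gcongr
      _ = a ^ 2 * ((∏ p ∈ P, mf p) * 8 ^ (P.erase 2).card) := by ring
      _ ≤ a ^ 2 * (a * (∏ p ∈ P, (1 - (p:ℝ)⁻¹)) ^ 3) := by
        have := h3.trans (mul_le_mul_of_nonneg_right h4 (pow_nonneg hpr 3))
        exact mul_le_mul_of_nonneg_left this (by positivity)
      _ = _ := by rw [tot_prod]; ring
  have h6 : (2:ℝ) ^ (P.erase 2).card * (125 / 3) ≤ Nat.totient a := by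
    apply le_of_pow_le_pow_left₀ (n := 3) (by norm_num) hφ0.le
    refine le_trans ?_ h5
    rw [mul_pow, ← pow_mul, mul_comm _ 3, pow_mul]
    have : (0:ℝ) < 8 ^ (P.erase 2).card := by positivity
    norm_num
    linarith
  linarith

def critA (a : ℕ) : Bool :=
  Nat.ble 3190105800 (Nat.mul (Nat.mul a a) (Nat.mul (Nat.mul (cond (Nat.beq (Nat.mod a 2) 0) 1 4) (cond (Nat.beq (Nat.mod a 3) 0) 1 9))
    (Nat.mul (cond (Nat.beq (Nat.mod a 5) 0) 8 25) (cond (Nat.beq (Nat.mod a 7) 0) 27 49))))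

theorem cond_dvd (a p m n : ℕ) (x : ℝ) (ha : 2 ≤ a) (hp : p.Prime) (hx : x * n = m) :
    ((cond (Nat.beq (Nat.mod a p) 0) m n : ℕ) : ℝ) = (if p ∈ a.primeFactors then x else 1) * n := by
  by_cases h : p ∈ a.primeFactors
  · have : a % p = 0 := Nat.mod_eq_zero_of_dvd (Nat.dvd_of_mem_primeFactors h)
    have h2 : Nat.beq (Nat.mod a p) 0 = true := by rw [Nat.beq_eq]; exact this
    rw [h2, cond_true, if_pos h, hx]
  · have : ¬ p ∣ a := fun hd => h (Nat.mem_primeFactors.2 ⟨hp, hd, by omega⟩)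
    have h2 : Nat.beq (Nat.mod a p) 0 = false := by
      rw [Bool.eq_false_iff, ne_eq, Nat.beq_eq]
      exact fun h0 => this (Nat.dvd_of_mod_eq_zero h0)
    rw [h2, cond_false, if_neg h, one_mul]

theorem disc_critA (a : ℕ) (ha : 2 ≤ a) (h : critA a = true) (j : ℕ) : Disc a j := by
  apply disc_crit a ha
  unfold critA at h
  have h1 := Nat.le_of_ble_eq_true h
  simp only [Nat.mul_eq] at h1
  have h2 : ((3190105800 : ℕ) : ℝ) ≤ _ := Nat.cast_le.2 h1
  rw [Nat.cast_mul, Nat.cast_mul, Nat.cast_mul, Nat.cast_mul, Nat.cast_mul, cond_dvd a 2 1 4 (1 / 4) ha Nat.prime_two (by norm_num),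
    cond_dvd a 3 1 9 (1 / 9) ha Nat.prime_three (by norm_num), cond_dvd a 5 8 25 (8 / 25) ha Nat.prime_five (by norm_num),
    cond_dvd a 7 27 49 (27 / 49) ha (by norm_num) (by norm_num)] at h2
  rw [prod_mf]
  generalize (if 2 ∈ a.primeFactors then (1:ℝ) / 4 else 1) = x2 at *
  generalize (if 3 ∈ a.primeFactors then (1:ℝ) / 9 else 1) = x3 at *
  generalize (if 5 ∈ a.primeFactors then (8:ℝ) / 25 else 1) = x5 at *
  generalize (if 7 ∈ a.primeFactors then (27:ℝ) / 49 else 1) = x7 at *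
  push_cast at h2
  linarith

theorem critA_big (a : ℕ) (ha : 3844 ≤ a) : critA a = true := by
  unfold critA
  apply Nat.ble_eq_true_of_le
  simp only [Nat.mul_eq]
  have hc : ∀ (t : Bool) (m n k : ℕ), k ≤ m → k ≤ n → k ≤ cond t m n := by intro t m n k h1 h2; cases t <;> simpa
  calc 3190105800 ≤ 3844 * 3844 * (1 * 1 * (8 * 27)) := by norm_num
    _ ≤ _ := Nat.mul_le_mul (Nat.mul_le_mul ha ha) (Nat.mul_le_mul (Nat.mul_le_mul (hc _ _ _ _ (by norm_num) (by norm_num)) (hc _ _ _ _ (by norm_num) (by norm_num)))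
      (Nat.mul_le_mul (hc _ _ _ _ (by norm_num) (by norm_num)) (hc _ _ _ _ (by norm_num) (by norm_num))))

end PS
end

section
namespace PS

def dLoop (a A P L fuel : ℕ) : ℕ → ℕ → Bool :=
  Nat.rec (fun v k => Nat.ble (Nat.mul P v) (Nat.add (Nat.mul A k) L)) (fun _ ih v k =>
    cond (Nat.beq (Nat.gcd v a) 1)
      (force (Nat.mul P v) fun x => force (Nat.mul A k) fun y =>
        cond (Nat.ble x (Nat.add y L)) (cond (Nat.ble (Nat.add y A) (Nat.add x L)) (force (Nat.succ v) fun v2 => force (Nat.succ k) fun k2 => ih v2 k2) false) false)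
      (force (Nat.succ v) fun v2 => ih v2 k)) fuel

theorem dLoop_sound (a A P L : ℕ) (ha : 1 ≤ a) (fuel : ℕ) : ∀ v, dLoop a A P L fuel v (cops a v).card = true →
    (∀ j, v ≤ j → j ≤ v + fuel → P * j ≤ A * (cops a j).card + L) ∧
    (A * (cops a v).card + P ≤ P * v + L → ∀ j, v ≤ j → j ≤ v + fuel → A * (cops a j).card + P ≤ P * j + L) := by
  induction fuel with
  | zero =>
    intro v h
    have h1 : P * v ≤ A * (cops a v).card + L := Nat.le_of_ble_eq_true h
    refine ⟨fun j h2 h3 => ?_, fun h0 j h2 h3 => ?_⟩ <;> (have : j = v := by omega) <;> rw [this] <;> assumption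
  | succ f ih =>
    intro v h
    have e : dLoop a A P L (f + 1) v (cops a v).card = cond (Nat.beq (Nat.gcd v a) 1)
        (cond (Nat.ble (P * v) (A * (cops a v).card + L)) (cond (Nat.ble (A * (cops a v).card + A) (P * v + L)) (dLoop a A P L f (v + 1) ((cops a v).card + 1)) false) false)
        (dLoop a A P L f (v + 1) (cops a v).card) := by
      unfold dLoop
      simp only [force_eq]; rfl
    rw [e] at h
    have hs := cops_succ a v ha
    rw [co_eq v a ha] at hs
    by_cases hc : Nat.Coprime v a
    · have hg : Nat.beq (Nat.gcd v a) 1 = true := by rw [Nat.beq_eq]; exact hc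
      rw [if_pos hc] at hs
      rw [hg, cond_true] at h
      cases hb : Nat.ble (P * v) (A * (cops a v).card + L)
      · rw [hb, cond_false] at h; exact absurd h (by simp)
      rw [hb, cond_true] at h
      cases hb2 : Nat.ble (A * (cops a v).card + A) (P * v + L)
      · rw [hb2, cond_false] at h; exact absurd h (by simp)
      rw [hb2, cond_true, ← hs] at h
      have h1 := Nat.le_of_ble_eq_true hb
      have h2 := Nat.le_of_ble_eq_true hb2
      obtain ⟨i1, i2⟩ := ih (v + 1) h
      have i3 := i2 (by rw [hs, Nat.mul_add, Nat.mul_add]; omega)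
      refine ⟨fun j h3 h4 => ?_, fun h0 j h3 h4 => ?_⟩
      · rcases Nat.eq_or_lt_of_le h3 with rfl | hl
        · exact h1
        · exact i1 j hl (by omega)
      · rcases Nat.eq_or_lt_of_le h3 with rfl | hl
        · exact h0
        · exact i3 j hl (by omega)
    · have hg : Nat.beq (Nat.gcd v a) 1 = false := by rw [Bool.eq_false_iff, ne_eq, Nat.beq_eq]; exact hc
      rw [if_neg hc, add_zero] at hs
      rw [hg, cond_false, ← hs] at h
      obtain ⟨i1, i2⟩ := ih (v + 1) h
      refine ⟨fun j h3 h4 => ?_, fun h0 j h3 h4 => ?_⟩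
      · rcases Nat.eq_or_lt_of_le h3 with rfl | hl
        · have := i1 (v + 1) le_rfl (by omega)
          rw [hs, Nat.mul_add] at this
          omega
        · exact i1 j hl (by omega)
      · rcases Nat.eq_or_lt_of_le h3 with rfl | hl
        · exact h0
        · exact i2 (by rw [hs, Nat.mul_add]; omega) j hl (by omega)

def phS (p a : ℕ) (ih : ℕ → ℕ) (k : ℕ) : ℕ := cond (Nat.beq (Nat.mod a p) 0)
  (force (Nat.div a p) fun m => cond (Nat.beq (Nat.mod m p) 0) (Nat.mul p (ih m)) (Nat.mul (Nat.sub p 1) (ih m))) k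

theorem phS_eq (p a : ℕ) (ih : ℕ → ℕ) (k : ℕ) (hp : p.Prime) (ha : 1 ≤ a) (h : ∀ m, 1 ≤ m → ih m = Nat.totient m) (hk : k = Nat.totient a) :
    phS p a ih k = Nat.totient a := by
  unfold phS
  rw [force_eq]
  cases hb : Nat.beq (Nat.mod a p) 0
  · rw [cond_false, hk]
  · obtain ⟨m, rfl⟩ := Nat.dvd_of_mod_eq_zero (Nat.eq_of_beq_eq_true hb)
    have hm : 1 ≤ m := Nat.pos_of_mul_pos_left ha
    have hd : Nat.div (p * m) p = m := Nat.mul_div_cancel_left _ hp.pos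
    rw [cond_true, hd, h m hm]
    cases hb2 : Nat.beq (Nat.mod m p) 0
    · rw [cond_false, Nat.totient_mul_of_prime_of_not_dvd hp]
      · rfl
      · intro hd2
        have : Nat.mod m p = 0 := Nat.mod_eq_zero_of_dvd hd2
        rw [this] at hb2
        exact absurd hb2 (by simp)
    · rw [cond_true, Nat.totient_mul_of_prime_of_dvd hp (Nat.dvd_of_mod_eq_zero (Nat.eq_of_beq_eq_true hb2))]
      rfl

def phQ (fuel : ℕ) : ℕ → ℕ := Nat.rec phiC (fun _ ih a => phS 2 a ih (phS 3 a ih (phS 5 a ih (phS 7 a ih (phiC a))))) fuel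

theorem phQ_eq (fuel : ℕ) : ∀ a, 1 ≤ a → phQ fuel a = Nat.totient a := by
  induction fuel with
  | zero => intro a ha; exact phiC_eq a ha
  | succ f ih =>
    intro a ha
    exact phS_eq 2 a _ _ Nat.prime_two ha ih (phS_eq 3 a _ _ Nat.prime_three ha ih (phS_eq 5 a _ _ Nat.prime_five ha ih
      (phS_eq 7 a _ _ (by norm_num) ha ih (phiC_eq a ha))))

def dA (a : ℕ) : Bool := cond (critA a) true (force (phQ 12 a) fun φ =>
  force (Nat.mul 1000 a) fun A => force (Nat.mul 1000 φ) fun P => force (Nat.mul 12 (Nat.mul φ a)) fun L => dLoop a A P L (Nat.div a 2) 1 0)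

theorem dA_sound (a : ℕ) (ha : 12 ≤ a) (h : dA a = true) (j : ℕ) (hj : 2 * j ≤ a) : Disc a j := by
  cases hb : critA a
  swap
  · exact disc_critA a (by omega) hb j
  unfold dA at h
  rw [hb, cond_false] at h
  simp only [force_eq, Nat.mul_eq] at h
  rw [phQ_eq 12 a (by omega), ← cops_one a (by omega)] at h
  have hd : j + 1 ≤ 1 + a.div 2 := by
    have : a.div 2 = a / 2 := rfl
    omega
  obtain ⟨h1, h2⟩ := dLoop_sound a _ _ _ (by omega) _ 1 h
  have h3 := h1 (j + 1) (by omega) hd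
  have h4 := h2 (by rw [cops_one a (by omega)]; omega) (j + 1) (by omega) hd
  have h3R : (1000:ℝ) * Nat.totient a * (j + 1) ≤ 1000 * a * (cops a (j + 1)).card + 12 * (Nat.totient a * a) := by exact_mod_cast h3
  have h4R : (1000:ℝ) * a * (cops a (j + 1)).card + 1000 * Nat.totient a ≤ 1000 * Nat.totient a * (j + 1) + 12 * (Nat.totient a * a) := by exact_mod_cast h4
  constructor <;> linarith

def dAll (fuel : ℕ) : ℕ → Bool :=
  Nat.rec (fun _ => true) (fun _ ih a => cond (dA a) (force (Nat.succ a) fun a2 => ih a2) false) fuel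

theorem dAll_sound (fuel : ℕ) : ∀ a, dAll fuel a = true → ∀ i, a ≤ i → i < a + fuel → dA i = true := by
  induction fuel with
  | zero => intro a _ i h1 h2; omega
  | succ f ih =>
    intro a h i h1 h2
    have e : dAll (f + 1) a = cond (dA a) (dAll f (a + 1)) false := by
      unfold dAll
      simp only [force_eq]
    rw [e] at h
    cases hb : dA a
    · rw [hb] at h; simp at h
    · rw [hb] at h
      rcases Nat.eq_or_lt_of_le h1 with rfl | hlt
      · exact hb
      · exact ih (a + 1) h i hlt (by omega)

set_option maxRecDepth 100000 in
theorem dAll_1 : dAll 800 512 = true := by decide +kernel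
set_option maxRecDepth 100000 in
theorem dAll_2 : dAll 1300 1312 = true := by decide +kernel
set_option maxRecDepth 100000 in
theorem dAll_3 : dAll 1232 2612 = true := by decide +kernel

theorem disc_all (a : ℕ) (ha : 512 ≤ a) (j : ℕ) (hj : 2 * j ≤ a) : Disc a j := by
  rcases lt_or_ge a 1312 with h1 | h1
  · exact dA_sound a (by omega) (dAll_sound _ _ dAll_1 a ha h1) j hj
  rcases lt_or_ge a 2612 with h2 | h2
  · exact dA_sound a (by omega) (dAll_sound _ _ dAll_2 a h1 h2) j hj
  rcases lt_or_ge a 3844 with h3 | h3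
  · exact dA_sound a (by omega) (dAll_sound _ _ dAll_3 a h2 h3) j hj
  · exact disc_critA a (by omega) (critA_big a h3) j

end PS
end

section
namespace PS

theorem Wt_le (a : ℕ) (ha : 512 ≤ a) (τ : ℕ) : 2 * τ ≤ a + 2 → (Wt a τ : ℝ) * a ≤ Nat.totient a * ((τ:ℝ) ^ 2 / 2 + 0.012 * τ * a) := by
  induction τ with
  | zero => intro _; simp [Wt, cops]
  | succ n ih =>
    intro hn
    have h1 := ih (by omega)
    have h2 := (disc_all a ha n (by omega)).1
    rw [Wt_succ]
    push_cast
    have hφ0 : (0:ℝ) ≤ Nat.totient a := Nat.cast_nonneg _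
    have e : (Nat.totient a : ℝ) * (((n:ℝ) + 1) ^ 2 / 2 + 0.012 * (n + 1) * a) =
      Nat.totient a * ((n:ℝ) ^ 2 / 2 + 0.012 * n * a) + Nat.totient a * (n + 0.012 * a) + Nat.totient a * (1 / 2) := by ring
    rw [e]
    linarith

theorem cops_le (a : ℕ) (ha : 512 ≤ a) (τ : ℕ) (hτ : 1 ≤ τ) (h : 2 * τ ≤ a) : ((cops a τ).card : ℝ) * a ≤ Nat.totient a * (τ + 0.012 * a) := by
  have h1 := (disc_all a ha (τ - 1) (by omega)).1
  rw [Nat.sub_add_cancel hτ, Nat.cast_sub hτ] at h1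
  refine h1.trans ?_
  have hφ0 : (0:ℝ) ≤ Nat.totient a := Nat.cast_nonneg _
  apply mul_le_mul_of_nonneg_left _ hφ0
  push_cast; linarith

theorem N_ge (a : ℕ) (ha : 512 ≤ a) (δ : ℝ) (hδ : 0 < δ) (hδ' : δ < Real.exp (-(3 / 2))) :
    Nat.totient a * (δ - 0.012) ≤ (N δ a : ℝ) := by
  have haR : (512:ℝ) ≤ a := by exact_mod_cast ha
  have hd : δ * a ≤ 0.22314 * a := mul_le_mul_of_nonneg_right (hδ'.le.trans exp_bd.le) (by linarith)
  have hj1 : (⌊δ * a⌋₊ : ℝ) ≤ δ * a := Nat.floor_le (by positivity)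
  have hj2 : δ * a ≤ ⌊δ * a⌋₊ + 1 := (Nat.lt_floor_add_one _).le
  rw [N_eq δ a (by omega) hδ]
  set j := ⌊δ * a⌋₊ with hjd
  have hj : 2 * j ≤ a := by
    have : 2 * (j:ℝ) ≤ a := by linarith
    exact_mod_cast this
  have h1 := (disc_all a ha j hj).2
  have hφ0 : (0:ℝ) ≤ Nat.totient a := Nat.cast_nonneg _
  have h2 : (Nat.totient a : ℝ) * (δ - 0.012) * a ≤ Nat.totient a * ((j:ℝ) + 1 - 0.012 * a) := by
    rw [mul_assoc]
    apply mul_le_mul_of_nonneg_left _ hφ0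
    linarith
  exact le_of_mul_le_mul_right (h2.trans h1) (by linarith)

theorem hM_big (a : ℕ) (ha : 512 ≤ a) (δ : ℝ) (hδ : 0 < δ) (hδ' : δ < Real.exp (-(3 / 2))) (r v : ℝ) (hr : 1 ≤ r)
    (hv : 1.0877 * (1 + 0.024 * r) ^ 2 ≤ 8 * r * v) :
    max 0 (1 - 2 * r * N δ a / Nat.totient a) * (δ * a) * (1.0877 * (1 - 1 / a)) ≤ a * v := by
  have haR : (512:ℝ) ≤ a := by exact_mod_cast ha
  have hφ0 : (0:ℝ) < Nat.totient a := by exact_mod_cast Nat.totient_pos.2 (by omega)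
  have h1 := N_ge a ha δ hδ hδ'
  have hinv : 0 < 1 / (a:ℝ) := by positivity
  have hinv1 : 1 / (a:ℝ) ≤ 1 := by rw [div_le_one (by linarith)]; linarith
  have h2 : δ - 0.012 ≤ N δ a / Nat.totient a := by rw [le_div_iff₀ hφ0]; linarith
  have h3 : 1 - 2 * r * N δ a / Nat.totient a ≤ 1 + 0.024 * r - 2 * r * δ := by
    rw [mul_div_assoc]
    have := mul_le_mul_of_nonneg_left h2 (by linarith : 0 ≤ 2 * r)
    linarith
  have hv0 : 0 ≤ v := by
    have : 0 ≤ 8 * r * v := le_trans (by positivity) hv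
    by_contra hc
    have : 8 * r * v < 0 := mul_neg_of_pos_of_neg (by linarith) (not_le.1 hc)
    linarith
  have h4 : max 0 (1 - 2 * r * N δ a / Nat.totient a) * δ * 1.0877 ≤ v := by
    rcases le_total (1 - 2 * r * N δ a / Nat.totient a) 0 with h | h
    · rw [max_eq_left h]; simpa using hv0
    · rw [max_eq_right h]
      have h5 : (1 - 2 * r * N δ a / Nat.totient a) * δ ≤ (1 + 0.024 * r - 2 * r * δ) * δ := mul_le_mul_of_nonneg_right h3 hδ.le
      have h6 : 8 * r * ((1 + 0.024 * r - 2 * r * δ) * δ) ≤ (1 + 0.024 * r) ^ 2 := by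
        nlinarith [sq_nonneg (1 + 0.024 * r - 4 * r * δ)]
      have h7 : 8 * r * ((1 + 0.024 * r - 2 * r * δ) * δ * 1.0877) ≤ 8 * r * v := by linarith
      have h8 := le_of_mul_le_mul_left h7 (by linarith)
      linarith
  have hX : 0 ≤ max 0 (1 - 2 * r * N δ a / Nat.totient a) := le_max_left _ _
  generalize max 0 (1 - 2 * r * N δ a / Nat.totient a) = X at *
  have hXd : 0 ≤ X * δ * 1.0877 := by positivity
  calc X * (δ * a) * (1.0877 * (1 - 1 / a)) = (X * δ * 1.0877) * a * (1 - 1 / a) := by ring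
    _ ≤ (X * δ * 1.0877) * a * 1 := mul_le_mul_of_nonneg_left (by linarith) (by positivity)
    _ = a * (X * δ * 1.0877) := by ring
    _ ≤ a * v := mul_le_mul_of_nonneg_left h4 (by linarith)

def bigFin (i C g2 : ℕ) (s : Sl) : Bool :=
  force (57600000 / g2) fun m => force (loghi (m ^ 4)) fun lm => force ((24 * 693147 - lm) / 4) fun nl =>
  force (cond (Nat.beq s.m1 0) 1000000 ((6250 * (21 + i) * s.m1 - 1152000) * 1000000 / (6250 * (21 + i) * s.m1 - nl - 1000000))) fun g1 =>
  force (cond (Nat.beq s.m1 0) (50000 * i) (i * s.m1 * 1000000 / (20 * s.m1 - 240))) fun q => force (1000000 + q) fun R =>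
  force (914 * (8 * m - 1) * g1 / 512000) fun t1 =>
  force (g2 * (1000 * m ^ 2 + 1536 * m) / 8192000 + 1) fun t2 =>
  force ((21 + i) * ((1000 * m + 768) * (1000000 + s.E) ^ 2 + 1000 * s.E ^ 2) / (640000000000 * s.m0) + 1) fun t3 =>
  force (t1 - t2 - t3) fun V =>
  (Nat.ble 1 m && Nat.ble m 32) && (Nat.ble (4 * nl + lm) (24 * 693147) &&
  ((Nat.ble 1000000 g1 && (Nat.ble (6250 * (g1 - 1000000) * (21 + i) * s.m1 + 1152000000000) (g1 * (nl + 1000000)) &&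
    cond (Nat.beq s.m1 0) (Nat.beq g1 1000000) true)) &&
  ((Nat.ble (20 * q * s.m0) (i * s.m0 * 1000000 + 240 * q) && cond (Nat.beq s.m1 0) (Nat.ble (20 * q) (i * 1000000)) (Nat.ble (20 * q * s.m1) (i * s.m1 * 1000000 + 240 * q))) &&
  (Nat.ble (t1 * 512000) (914 * (8 * m - 1) * g1) &&
  (Nat.ble (g2 * (1000 * m ^ 2 + 1536 * m)) (t2 * 8192000) &&
  (Nat.ble ((21 + i) * ((1000 * m + 768) * (1000000 + s.E) ^ 2 + 1000 * s.E ^ 2)) (t3 * (640000000000 * s.m0)) &&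
  (Nat.ble (V + t2 + t3) t1 && (Nat.ble 457 s.blo &&
    Nat.ble (10877 * (1000000000 + 24 * R) ^ 2) (80000000000 * V * R)))))))))

def bigCell (i : ℕ) (s : Sl) : Bool :=
  cond (Nat.blt 0 s.m1 && Nat.blt (6250 * (i + 1) * s.m1) 6238320) true
  (force (CC s.m0) fun C => force (maxN (g2Of (6250 * (i + 1) * s.m0) C s s.m0)
      (cond (Nat.beq s.m1 0) ((21 + i) * s.m0 * 1000000 / (10 * s.m0 - 160) + 1) (g2Of (6250 * (i + 1) * s.m1) C s s.m1))) fun g2 =>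
    (g2Ok (6250 * (i + 1) * s.m0) C g2 s s.m0 &&
      cond (Nat.beq s.m1 0) (Nat.ble ((21 + i) * s.m0 * 1000000 + 160 * g2) (10 * g2 * s.m0)) (g2Ok (6250 * (i + 1) * s.m1) C g2 s s.m1)) &&
    bigFin i C g2 s)

def TL : List Sl := [⟨49, 53, 1815907, 286472, 457⟩, ⟨53, 58, 1891720, 241317, 753⟩, ⟨58, 64, 1981974, 193207, 1000⟩, ⟨64, 70, 2083058, 146527, 1000⟩, ⟨70, 77, 2169701, 110148, 1000⟩, ⟨77, 85, 2267175, 78229, 1000⟩, ⟨85, 95, 2364649, 52378, 1000⟩, ⟨95, 106, 2476564, 31335, 1000⟩, ⟨106, 120, 2584868, 17581, 1000⟩, ⟨120, 137, 2711223, 8298, 1000⟩, ⟨137, 158, 2841188, 3275, 1000⟩, ⟨158, 184, 2985594, 1018, 1000⟩, ⟨184, 216, 3137220, 234, 1000⟩, ⟨216, 256, 3296067, 39, 1000⟩, ⟨256, 310, 3469354, 5, 1000⟩, ⟨310, 380, 3660691, 2, 1000⟩, ⟨380, 480, 3862860, 2, 1000⟩, ⟨480, 640, 4097519, 2, 1000⟩,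 ⟨640, 900, 4382721, 2, 1000⟩, ⟨900, 0, 4725684, 2, 1000⟩]

theorem TL_ok : allSl slabChk TL = true := by decide +kernel
theorem TL_ch : chainSl TL 49 = true := by decide +kernel

def bigI (i0 : ℕ) : Bool := force i0 fun i => allSl (bigCell i) TL
set_option maxRecDepth 100000 in
theorem bigI_ok : ∀ i ∈ List.range 20, bigI i = true := by decide +kernel

end PS
end

section
namespace PS

theorem big_hV (a m g1 g2 i t1 t2 t3 V E m0 τ : ℕ) (ha : 512 ≤ a) (hm : 1 ≤ m) (hm2 : m ≤ 32) (hm0 : 33 ≤ m0) (hτd : τ = m * a / 64)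
    (e1 : t1 * 512000 ≤ 914 * (8 * m - 1) * g1) (e2 : g2 * (1000 * m ^ 2 + 1536 * m) ≤ t2 * 8192000)
    (e3 : (21 + i) * ((1000 * m + 768) * (1000000 + E) ^ 2 + 1000 * E ^ 2) ≤ t3 * (640000000000 * m0)) (e4 : V + t2 + t3 ≤ t1) :
    (a:ℝ) * (V / 1000000) ≤ (914:ℕ) / 1000 * τ * ((g1:ℝ) / 1000000) - Wt a τ / Nat.totient a * ((g2:ℝ) / 1000000) -
      ((21 + i : ℝ) / 20) / (m0 / 8) * ((cops a τ).card * (1 + (E:ℝ) / 1000000) ^ 2 / 4 + 2 * ((E:ℝ) / 1000000) ^ 2) := by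
  have haR : (512:ℝ) ≤ a := by exact_mod_cast ha
  have ha0 : (0:ℝ) < a := by linarith
  have hm0R : (33:ℝ) ≤ m0 := by exact_mod_cast hm0
  have hφ0 : (0:ℝ) < Nat.totient a := by exact_mod_cast Nat.totient_pos.2 (by omega)
  have hφa : (Nat.totient a : ℝ) ≤ a := by exact_mod_cast Nat.totient_le a
  have hma : m * a ≤ 32 * a := Nat.mul_le_mul_right a hm2
  have hma' : 1 * a ≤ m * a := Nat.mul_le_mul_right a hm
  have hτ1 : 1 ≤ τ := by omega
  have hτ2 : 2 * τ ≤ a := by omega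
  have hτu : (τ:ℝ) * 64 ≤ m * a := by exact_mod_cast (by omega : τ * 64 ≤ m * a)
  have hτl : (m:ℝ) * a ≤ τ * 64 + 64 := by exact_mod_cast (by omega : m * a ≤ τ * 64 + 64)
  have hW := Wt_le a ha τ (by omega)
  have hC := cops_le a ha τ hτ1 hτ2
  have hW0 : (Wt a τ : ℝ) / Nat.totient a ≤ a * ((1000 * m ^ 2 + 1536 * m) / 8192000) := by
    rw [div_le_iff₀ hφ0]
    have h1 : (τ:ℝ) ^ 2 ≤ (m * a / 64) ^ 2 := pow_le_pow_left₀ (Nat.cast_nonneg _) (by linarith) 2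
    have h2 : (τ:ℝ) * a ≤ m * a / 64 * a := mul_le_mul_of_nonneg_right (by linarith) ha0.le
    have h3 : (Nat.totient a : ℝ) * ((τ:ℝ)^2/2 + 0.012*τ*a) ≤ Nat.totient a * ((m * a / 64) ^ 2 / 2 + 0.012 * (m * a / 64 * a)) :=
      mul_le_mul_of_nonneg_left (by linarith) hφ0.le
    have h4 : (Wt a τ : ℝ) * a ≤ (a * ((1000 * m ^ 2 + 1536 * m) / 8192000) * Nat.totient a) * a := by
      refine (hW.trans h3).trans (le_of_eq ?_)
      ring
    exact le_of_mul_le_mul_right h4 ha0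
  have hC0 : ((cops a τ).card : ℝ) ≤ a * ((1000 * m + 768) / 64000) := by
    have h1 : ((cops a τ).card : ℝ) * a ≤ (τ + 0.012 * a) * a := by
      refine hC.trans ?_
      rw [mul_comm]
      exact mul_le_mul_of_nonneg_left hφa (add_nonneg (Nat.cast_nonneg _) (by linarith))
    have h2 := le_of_mul_le_mul_right h1 ha0
    refine h2.trans ?_
    linarith
  have e1R : (t1:ℝ) * 512000 ≤ 914 * (8 * m - 1) * g1 := by
    have : ((t1 * 512000 : ℕ):ℝ) ≤ ((914 * (8 * m - 1) * g1 : ℕ) : ℝ) := by exact_mod_cast e1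
    rw [Nat.cast_mul, Nat.cast_mul, Nat.cast_mul, Nat.cast_sub (by omega)] at this
    push_cast at this
    exact this
  have e2R : (g2:ℝ) * (1000 * m ^ 2 + 1536 * m) ≤ t2 * 8192000 := by exact_mod_cast e2
  have e3R : (21 + i : ℝ) * ((1000 * m + 768) * (1000000 + E) ^ 2 + 1000 * E ^ 2) ≤ t3 * (640000000000 * m0) := by exact_mod_cast e3
  have e4R : (V:ℝ) + t2 + t3 ≤ t1 := by exact_mod_cast e4
  -- term 1
  have T1 : (a:ℝ) * (t1 / 1000000) ≤ (914:ℕ) / 1000 * τ * ((g1:ℝ) / 1000000) := by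
    have h1 : (a:ℝ) * (8 * m - 1) ≤ 512 * τ := by linarith
    have h2 : (a:ℝ) * (8 * m - 1) * g1 ≤ 512 * τ * g1 := mul_le_mul_of_nonneg_right h1 (Nat.cast_nonneg _)
    have h3 : (a:ℝ) * (t1 * 512000) ≤ a * (914 * (8 * m - 1) * g1) := mul_le_mul_of_nonneg_left e1R ha0.le
    push_cast
    linarith
  have T2 : (Wt a τ : ℝ) / Nat.totient a * ((g2:ℝ) / 1000000) ≤ a * (t2 / 1000000) := by
    have h1 : (Wt a τ : ℝ) / Nat.totient a * ((g2:ℝ) / 1000000) ≤ a * ((1000 * m ^ 2 + 1536 * m) / 8192000) * ((g2:ℝ) / 1000000) :=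
      mul_le_mul_of_nonneg_right hW0 (by positivity)
    have h3 := mul_le_mul_of_nonneg_left e2R ha0.le
    linarith
  have T3 : ((21 + i : ℝ) / 20) / (m0 / 8) * ((cops a τ).card * (1 + (E:ℝ) / 1000000) ^ 2 / 4 + 2 * ((E:ℝ) / 1000000) ^ 2) ≤ a * (t3 / 1000000) := by
    have h1 : ((cops a τ).card : ℝ) * (1 + (E:ℝ) / 1000000) ^ 2 / 4 + 2 * ((E:ℝ) / 1000000) ^ 2 ≤
        a * ((1000 * m + 768) / 64000) * (1 + (E:ℝ) / 1000000) ^ 2 / 4 + a / 512 * (2 * ((E:ℝ) / 1000000) ^ 2) := by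
      have h2 : ((cops a τ).card : ℝ) * (1 + (E:ℝ) / 1000000) ^ 2 ≤ a * ((1000 * m + 768) / 64000) * (1 + (E:ℝ) / 1000000) ^ 2 :=
        mul_le_mul_of_nonneg_right hC0 (sq_nonneg _)
      have h3 : 1 * (2 * ((E:ℝ) / 1000000) ^ 2) ≤ a / 512 * (2 * ((E:ℝ) / 1000000) ^ 2) :=
        mul_le_mul_of_nonneg_right (by linarith) (by positivity)
      linarith
    refine (mul_le_mul_of_nonneg_left h1 (by positivity)).trans ?_
    have e : ((21 + i : ℝ) / 20) / (m0 / 8) * (a * ((1000 * m + 768) / 64000) * (1 + (E:ℝ) / 1000000) ^ 2 / 4 + a / 512 * (2 * ((E:ℝ) / 1000000) ^ 2)) =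
      a * ((21 + i : ℝ) * ((1000 * m + 768) * (1000000 + E) ^ 2 + 1000 * E ^ 2) / (640000000000 * m0) / 1000000) := by
      field_simp; ring
    rw [e]
    apply mul_le_mul_of_nonneg_left _ ha0.le
    rw [div_le_div_iff_of_pos_right (by norm_num), div_le_iff₀ (by positivity)]
    exact e3R
  have T4 := mul_le_mul_of_nonneg_left e4R ha0.le
  linarith

theorem big_logτ (a m nl lm τ : ℕ) (ha : 512 ≤ a) (hm : 1 ≤ m) (hm2 : m ≤ 32) (hτ : 1 ≤ τ) (hτd : τ = m * a / 64) (hlm : lm = loghi (m ^ 4))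
    (e : 4 * nl + lm ≤ 24 * 693147) : Real.log τ ≤ Real.log a - nl / 1000000 := by
  have hτu : (τ:ℝ) * 64 ≤ m * a := by exact_mod_cast (by omega : τ * 64 ≤ m * a)
  have hmR : (0:ℝ) < m := by exact_mod_cast hm
  have haR : (0:ℝ) < a := by exact_mod_cast (by omega : 0 < a)
  have hτR : (0:ℝ) < τ := by exact_mod_cast hτ
  have h1 := Real.log_le_log (by positivity) hτu
  rw [Real.log_mul hτR.ne' (by norm_num), Real.log_mul hmR.ne' haR.ne', show (64:ℝ) = 2 ^ 6 by norm_num, Real.log_pow] at h1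
  have hp : m ^ 4 ≤ 32 ^ 4 := Nat.pow_le_pow_left hm2 4
  have h2 := le_loghi (m ^ 4) (Nat.one_le_pow _ _ hm) (lt_of_le_of_lt hp (by norm_num))
  rw [← hlm, Nat.cast_pow, Real.log_pow] at h2
  have h3 := log2_lo
  have eR : 4 * (nl:ℝ) + lm ≤ 24 * 693147 := by exact_mod_cast e
  push_cast at h1 h2
  linarith

theorem big_fin (a b : ℕ) (ha : 512 ≤ a) (hab : a < b) (h : Nat.Coprime a b) (δ : ℝ) (hδ : 0 < δ)
    (hδ' : δ < Real.exp (-(3 / 2))) (h17 : 17 ≤ δ * (S a b : ℝ)) (haS : (a : ℝ) < δ * (S a b : ℝ))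
    (s : Sl) (hs : slabChk s = true) (hy : InSl s (Real.log b)) (i g2 : ℕ)
    (hi1 : (i:ℝ) * Real.log b ≤ 20 * Real.log a) (hi2 : 20 * Real.log a ≤ (i + 1) * Real.log b)
    (hg2 : g2Ok (6250 * (i + 1) * s.m0) (CC s.m0) g2 s s.m0 = true ∧
      cond (Nat.beq s.m1 0) (Nat.ble ((21 + i) * s.m0 * 1000000 + 160 * g2) (10 * g2 * s.m0)) (g2Ok (6250 * (i + 1) * s.m1) (CC s.m0) g2 s s.m1) = true)
    (hf : bigFin i (CC s.m0) g2 s = true) (hy6 : 6 ≤ Real.log b) :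
    (1 - 2 / (Nat.totient a : ℝ) * (N δ a : ℝ) * (1 - Real.log a / Real.log (δ * (S a b : ℝ)))⁻¹ -
        Real.log (δ * (S a b : ℝ)) / (δ * (S a b : ℝ))) * δ * (Nat.primeCounting (S a b) : ℝ) < (piStar a b : ℝ) := by
  unfold bigFin at hf
  simp only [force_eq] at hf
  obtain ⟨f1, f2, f3, f4, f5⟩ := slab_facts s hs b (by omega) hy.1
  generalize 57600000 / g2 = m at hf
  obtain ⟨lm, hlm⟩ : ∃ lm : ℕ, lm = loghi (m ^ 4) := ⟨_, rfl⟩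
  rw [← hlm] at hf
  generalize (24 * 693147 - lm) / 4 = nl at hf
  generalize cond (Nat.beq s.m1 0) 1000000 ((6250 * (21 + i) * s.m1 - 1152000) * 1000000 / (6250 * (21 + i) * s.m1 - nl - 1000000)) = g1 at hf
  generalize cond (Nat.beq s.m1 0) (50000 * i) (i * s.m1 * 1000000 / (20 * s.m1 - 240)) = q at hf
  generalize 914 * (8 * m - 1) * g1 / 512000 = t1 at hf
  generalize g2 * (1000 * m ^ 2 + 1536 * m) / 8192000 + 1 = t2 at hf
  generalize (21 + i) * ((1000 * m + 768) * (1000000 + s.E) ^ 2 + 1000 * s.E ^ 2) / (640000000000 * s.m0) + 1 = t3 at hf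
  generalize t1 - t2 - t3 = V at hf
  simp only [Bool.and_eq_true, Nat.ble_eq] at hf
  obtain ⟨⟨k1, k2⟩, k3, ⟨k4, k5, k6⟩, ⟨k7, k8⟩, k9, k10, k11, k12, k13, k14⟩ := hf
  have haR : (512:ℝ) ≤ a := by exact_mod_cast ha
  have ha0 : (0:ℝ) < a := by linarith
  have hbR : (0:ℝ) < b := by exact_mod_cast (by omega : 0 < b)
  have hm0R : (33:ℝ) ≤ s.m0 := by exact_mod_cast f1
  obtain ⟨τ, hτd⟩ : ∃ τ : ℕ, τ = m * a / 64 := ⟨_, rfl⟩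
  have hτ7 : 7 ≤ τ := by
    have hma' : 1 * a ≤ m * a := Nat.mul_le_mul_right a k1
    omega
  have hV := big_hV a m g1 g2 i t1 t2 t3 V s.E s.m0 τ ha k1 k2 f1 hτd k9 k10 k11 k12
  have hlt := big_logτ a m nl lm τ ha k1 k2 (by omega) hτd hlm k3
  have hM := hM_big a ha δ hδ hδ' (1 + (q:ℝ) / 1000000) ((V:ℝ) / 1000000) (by have : (0:ℝ) ≤ (q:ℝ) / 1000000 := by positivity
                                                                              linarith) (by
    have h1 : (10877:ℝ) * (1000000000 + 24 * (1000000 + q)) ^ 2 ≤ 80000000000 * V * (1000000 + q) := by exact_mod_cast k14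
    linarith)
  have hlog : Real.log (((a:ℝ) - 1) * b) = Real.log ((a:ℝ) - 1) + Real.log b := by rw [Real.log_mul (by linarith) hbR.ne']
  have hx1 : Real.log ((a:ℝ) - 1) ≤ Real.log a := Real.log_le_log (by linarith) (by linarith)
  have hx2 : Real.log a - 0.002 ≤ Real.log ((a:ℝ) - 1) := by
    have h1 : Real.log ((a:ℝ) / (a - 1)) ≤ (a:ℝ) / (a - 1) - 1 := Real.log_le_sub_one_of_pos (div_pos ha0 (by linarith))
    rw [Real.log_div ha0.ne' (by linarith)] at h1
    have h2 : (a:ℝ) / (a - 1) - 1 ≤ 0.002 := by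
      rw [sub_le_iff_le_add, div_le_iff₀ (by linarith)]; linarith
    linarith
  have m1c : (s.m1 = 0 ∧ Nat.beq s.m1 0 = true) ∨ (s.m1 ≠ 0 ∧ Nat.beq s.m1 0 = false) := by
    rcases Nat.eq_zero_or_pos s.m1 with hz | hz
    · left; exact ⟨hz, by rw [hz]; rfl⟩
    · right; exact ⟨by omega, by rw [Bool.eq_false_iff, ne_eq, Nat.beq_eq]; omega⟩
  have hA : 914 ≤ coefA (τ * s.blo) := by
    have h1 : 1000 ≤ τ * s.blo := le_trans (by norm_num) (Nat.mul_le_mul hτ7 k13)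
    exact le_trans (by decide) (coefA_mono _ _ h1)
  refine core2 a b (by omega) hab h δ hδ hδ' h17 haS s hs hy.1 ((21 + i : ℝ) / 20) (g1 / 1000000) (g2 / 1000000) (a * (V / 1000000))
    (1 + q / 1000000) 914 τ (by omega) hA ?_ ?_ (by positivity) ?_ ?_ hV hM
  · rw [hlog]; linarith
  · -- hg1
    rw [hlog]
    have hg1R : (1000000:ℝ) ≤ g1 := by exact_mod_cast k4
    have h2 : (g1:ℝ) / 1000000 * Real.log τ ≤ (g1:ℝ) / 1000000 * (Real.log a - nl / 1000000) := mul_le_mul_of_nonneg_left hlt (by positivity)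
    have h3 : ((g1:ℝ) / 1000000 - 1) * (Real.log a + Real.log b) + 1.152 ≤ (g1:ℝ) / 1000000 * (nl / 1000000 + 1) := by
      have k5R : 6250 * ((g1:ℝ) - 1000000) * (21 + i) * s.m1 + 1152000000000 ≤ g1 * (nl + 1000000) := by
        have : ((6250 * (g1 - 1000000) * (21 + i) * s.m1 + 1152000000000 : ℕ) : ℝ) ≤ ((g1 * (nl + 1000000) : ℕ) : ℝ) := by exact_mod_cast k5
        rw [Nat.cast_add, Nat.cast_mul, Nat.cast_mul, Nat.cast_mul, Nat.cast_sub k4] at this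
        push_cast at this
        exact this
      rcases m1c with ⟨hz, hb⟩ | ⟨hz, hb⟩
      · rw [hb, cond_true] at k6
        have : (g1:ℝ) = 1000000 := by exact_mod_cast Nat.eq_of_beq_eq_true k6
        rw [this] at k5R ⊢
        linarith
      · have hyy := hy.2.resolve_left hz
        have h4 : Real.log a + Real.log b ≤ (21 + i : ℝ) / 20 * (s.m1 / 8) := by
          have : (21 + i : ℝ) / 20 * Real.log b ≤ (21 + i : ℝ) / 20 * (s.m1 / 8) := mul_le_mul_of_nonneg_left hyy (by positivity)
          linarith
        have h5 := mul_le_mul_of_nonneg_left h4 (by linarith : 0 ≤ (g1:ℝ) / 1000000 - 1)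
        linarith
    linarith
  · -- hg2
    rw [hlog]
    generalize Real.log b = y at *
    have hP : ∀ m : ℕ, g2Ok (6250 * (i + 1) * m) (CC s.m0) g2 s m = true → 0 ≤ ((g2:ℝ) / 1000000 * (1 / 2 - 8 / s.m0) - (21 + i : ℝ) / 20) * (m / 8) + ((g2:ℝ) / 1000000 * (1 - s.ly / 1000000 + CC s.m0 / 1000000) + 1.15) := by
      intro m hm
      unfold g2Ok at hm
      have : (1000000:ℝ) * (125000 * m + 6250 * (i + 1) * m) * s.m0 + g2 * (1000000 * m + s.ly * s.m0) ≤ 1150000000000 * s.m0 + g2 * (s.m0 * (62500 * m + 1000000 + CC s.m0)) := by exact_mod_cast (Nat.le_of_ble_eq_true hm)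
      have e : ((g2:ℝ) / 1000000 * (1 / 2 - 8 / s.m0) - (21 + i : ℝ) / 20) * (m / 8) + ((g2:ℝ) / 1000000 * (1 - s.ly / 1000000 + CC s.m0 / 1000000) + 1.15) =
        (1150000000000 * s.m0 + g2 * (s.m0 * (62500 * m + 1000000 + CC s.m0)) - ((1000000:ℝ) * (125000 * m + 6250 * (i + 1) * m) * s.m0 + g2 * (1000000 * m + s.ly * s.m0))) / (1000000000000 * s.m0) := by
        field_simp; ring
      rw [e]
      exact div_nonneg (by linarith) (by positivity)
    have h1 := lin_slab s y _ _ hy (hP _ hg2.1) (by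
        have hg := hg2.2
        rcases m1c with ⟨hz, hb⟩ | ⟨hz, hb⟩
        · left
          rw [hb, cond_true] at hg
          have : (21 + i : ℝ) * s.m0 * 1000000 + 160 * g2 ≤ 10 * g2 * s.m0 := by exact_mod_cast (Nat.le_of_ble_eq_true hg)
          refine ⟨hz, ?_⟩
          have e : ((g2:ℝ) / 1000000 * (1 / 2 - 8 / s.m0) - (21 + i : ℝ) / 20) = (10 * g2 * s.m0 - ((21 + i : ℝ) * s.m0 * 1000000 + 160 * g2)) / (20000000 * s.m0) := by
            field_simp; ring
          rw [e]
          exact div_nonneg (by linarith) (by positivity)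
        · right
          rw [hb, cond_false] at hg
          exact ⟨hz, hP _ hg⟩)
    have e : (g2:ℝ) / 1000000 * (y / 2 - 8 * y / s.m0 + 1 - s.ly / 1000000 + CC s.m0 / 1000000) =
       ((g2:ℝ) / 1000000 * (1 / 2 - 8 / s.m0) - (21 + i : ℝ) / 20) * y + ((g2:ℝ) / 1000000 * (1 - s.ly / 1000000 + CC s.m0 / 1000000) + 1.15) + (21 + i : ℝ) / 20 * y - 1.15 := by ring
    rw [e]
    linarith
  · -- hr
    have hia : 1 / (a:ℝ) ≤ 1 / 3 := one_div_le_one_div_of_le (by norm_num) (by linarith)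
    have hia0 : 0 < 1 / (a:ℝ) := by positivity
    have hden : 0 < Real.log b - 1.5 - 1 / a := by linarith
    have h1 := lin_slab s (Real.log b) ((i:ℝ) / 20 - q / 1000000) (1.5 * (q / 1000000)) hy (by
        have : (20:ℝ) * q * s.m0 ≤ i * s.m0 * 1000000 + 240 * q := by exact_mod_cast k7
        linarith) (by
        rcases m1c with ⟨hz, hb⟩ | ⟨hz, hb⟩
        · left
          rw [hb, cond_true] at k8
          have : (20:ℝ) * q ≤ i * 1000000 := by exact_mod_cast (Nat.le_of_ble_eq_true k8)
          exact ⟨hz, by linarith⟩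
        · right
          rw [hb, cond_false] at k8
          have : (20:ℝ) * q * s.m1 ≤ i * s.m1 * 1000000 + 240 * q := by exact_mod_cast (Nat.le_of_ble_eq_true k8)
          exact ⟨hz, by linarith⟩)
    have h2 : (q:ℝ) / 1000000 ≤ Real.log a / (Real.log b - 1.5 - 1 / a) := by
      rw [le_div_iff₀ hden]
      have h3 : (q:ℝ) / 1000000 * (Real.log b - 1.5 - 1 / a) ≤ (q:ℝ) / 1000000 * (Real.log b - 1.5) := mul_le_mul_of_nonneg_left (by linarith) (by positivity)
      linarith
    linarith

theorem big_done (a b : ℕ) (ha : 512 ≤ a) (hab : a < b) (h : Nat.Coprime a b) (δ : ℝ) (hδ : 0 < δ)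
    (hδ' : δ < Real.exp (-(3 / 2))) (h17 : 17 ≤ δ * (S a b : ℝ)) (haS : (a : ℝ) < δ * (S a b : ℝ)) :
    (1 - 2 / (Nat.totient a : ℝ) * (N δ a : ℝ) * (1 - Real.log a / Real.log (δ * (S a b : ℝ)))⁻¹ -
        Real.log (δ * (S a b : ℝ)) / (δ * (S a b : ℝ))) * δ * (Nat.primeCounting (S a b) : ℝ) < (piStar a b : ℝ) := by
  have haR : (512:ℝ) ≤ a := by exact_mod_cast ha
  have habR : (a:ℝ) < b := by exact_mod_cast hab
  have hla : 6.238323 ≤ Real.log a := by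
    have h1 := Real.log_le_log (by norm_num) haR
    rw [show (512:ℝ) = 2 ^ 9 by norm_num, Real.log_pow] at h1
    have h2 := log2_lo
    push_cast at h1
    linarith
  have hlab : Real.log a < Real.log b := Real.log_lt_log (by linarith) habR
  obtain ⟨i, hi, hi1, hi2⟩ : ∃ i : ℕ, i < 20 ∧ (i:ℝ) * Real.log b ≤ 20 * Real.log a ∧ 20 * Real.log a ≤ (i + 1) * Real.log b := by
    have hb0 : 0 < Real.log b := by linarith
    refine ⟨⌊20 * Real.log a / Real.log b⌋₊, ?_, ?_, ?_⟩
    · rw [Nat.floor_lt (by positivity), div_lt_iff₀ hb0]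
      push_cast; linarith
    · rw [← le_div_iff₀ hb0]
      exact Nat.floor_le (by positivity)
    · rw [← div_le_iff₀ hb0]
      exact (Nat.lt_floor_add_one _).le
  obtain ⟨s, hs, hsy⟩ := chain_cover TL (Real.log b) 49 TL_ch (by push_cast; linarith)
  have hchk := allSl_mem _ _ TL_ok s hs
  have hI := bigI_ok i (List.mem_range.2 hi)
  unfold bigI at hI
  simp only [force_eq] at hI
  have hcell := allSl_mem _ _ hI s hs
  unfold bigCell at hcell
  have hnoskip : (Nat.blt 0 s.m1 && Nat.blt (6250 * (i + 1) * s.m1) 6238320) = false := by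
    rw [Bool.eq_false_iff]
    intro hcon
    rw [Bool.and_eq_true, Nat.blt_eq, Nat.blt_eq] at hcon
    obtain ⟨k1, k2⟩ := hcon
    have k3 := hsy.2.resolve_left (by omega)
    have k6 : (6250:ℝ) * (i + 1) * s.m1 < 6238320 := by exact_mod_cast k2
    have k7 : ((i:ℝ) + 1) * Real.log b ≤ (i + 1) * (s.m1 / 8) := mul_le_mul_of_nonneg_left k3 (by positivity)
    linarith
  rw [hnoskip, cond_false] at hcell
  simp only [force_eq] at hcell
  generalize maxN _ _ = g2 at hcell
  rw [Bool.and_eq_true, Bool.and_eq_true] at hcell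
  exact big_fin a b ha hab h δ hδ hδ' h17 haS s hchk hsy i g2 hi1 hi2 hcell.1 hcell.2 (by linarith)

end PS
end

theorem piStar_gt_delta_pi (a b : ℕ) (ha : 3 ≤ a) (hab : a < b)
    (h : Nat.Coprime a b) (δ : ℝ) (hδ : 0 < δ)
    (hδ' : δ < Real.exp (-(3 / 2))) (h17 : 17 ≤ δ * (S a b : ℝ))
    (haS : (a : ℝ) < δ * (S a b : ℝ)) :
    (1 - 2 / (Nat.totient a : ℝ) * (N δ a : ℝ) *
          (1 - Real.log a / Real.log (δ * (S a b : ℝ)))⁻¹ -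
        Real.log (δ * (S a b : ℝ)) / (δ * (S a b : ℝ))) * δ *
        (Nat.primeCounting (S a b) : ℝ)
      < (piStar a b : ℝ) := by
  rcases lt_or_ge b 62 with h1 | h1
  · exact PS.small_b a b ha hab h δ hδ hδ' h17 haS h1
  rcases lt_or_ge a 512 with h2 | h2
  · exact PS.small_done a b ha h2 hab h δ hδ hδ' h17 haS h1
  · exact PS.big_done a b h2 hab h δ hδ hδ' h17 haS
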